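/- Let k be a field and let m, n, r be integers with 0 < r < min{m,n} and m ≠ n. Set R = R_{r+1}(k;m,n) = k[X_ij]/I_{r+1}(X). Then there are exactly two isomorphism classes of semidualizing R-modules: every semidualizing R-module is isomorphic either to R or to a semidualizing R-module of finite injective dimension (a dualizing module for R), such a dualizing module exists, and no dualizing module is isomorphic to R. -/

import Mathlib

open CategoryTheory

/-- The `i`-th Ext module of two `R`-modules, over a commutative ring `R`. -/
noncomputable def ExtModule (R : Type) [CommRing R] (M N : ModuleCat.{0} R) (i : ℕ) :
    ModuleCat R :=
  ((Ext R (ModuleCat.{0} R) i).obj (Opposite.op M)).obj N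

/-- `C` is a semidualizing `R`-module: it is finitely generated, the homothety map
`R → Hom_R(C,C)` is bijective, and `Ext^i_R(C,C) = 0` for all `i > 0`. -/
def IsSemidualizing (R : Type) [CommRing R] (C : Type) [AddCommGroup C] [Module R C] : Prop :=
  Module.Finite R C ∧
  Function.Bijective (algebraMap R (Module.End R C)) ∧
  ∀ i : ℕ, 0 < i → Subsingleton (ExtModule R (ModuleCat.of R C) (ModuleCat.of R C) i)

/-- `M` has finite injective dimension over `R`: `Ext^i_R(-, M)` vanishes uniformly
for all large `i`. -/
def HasFiniteInjectiveDimension (R : Type) [CommRing R] (M : Type) [AddCommGroup M]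
    [Module R M] : Prop :=
  ∃ n : ℕ, ∀ (N : ModuleCat.{0} R) (i : ℕ), n < i →
    Subsingleton (ExtModule R N (ModuleCat.of R M) i)

/-- A Gorenstein local ring: a commutative Noetherian local ring having finite injective
dimension as a module over itself. -/
def IsGorensteinLocalRing (R : Type) [CommRing R] : Prop :=
  IsNoetherianRing R ∧ IsLocalRing R ∧ HasFiniteInjectiveDimension R R

/-- The length of an `R`-module, i.e. the Krull dimension of its lattice of submodules. -/
noncomputable def moduleLength (R M : Type) [CommRing R] [AddCommGroup M] [Module R M] :
    WithBot ℕ∞ :=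
  Order.krullDim (Submodule R M)

/-- The ideal of the polynomial ring `A[X_ij]` generated by the size `t` minors of the
generic `m × n` matrix `(X_ij)`. -/
noncomputable def minorsIdeal (A : Type) [CommRing A] (m n t : ℕ) :
    Ideal (MvPolynomial (Fin m × Fin n) A) :=
  Ideal.span { d | ∃ (ρ : Fin t → Fin m) (γ : Fin t → Fin n),
    d = (Matrix.of fun i j => MvPolynomial.X (ρ i, γ j)).det }

/-- The determinantal ring `R_t(A; m, n) = A[X_ij]/I_t(X)`. -/
abbrev DetRing (A : Type) [CommRing A] (m n t : ℕ) : Type :=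
  MvPolynomial (Fin m × Fin n) A ⧸ minorsIdeal A m n t

section

namespace Semidual
open Abelian

theorem subsingleton_extModule_iff {R : Type} [CommRing R] (M N : ModuleCat.{0} R) (p : ℕ) :
    Subsingleton (ExtModule R M N (p + 1)) ↔ Subsingleton (Ext M N (p + 1)) := by
  let P := projectiveResolution M
  have h1 : Subsingleton (ExtModule R M N (p + 1)) ↔
      ∀ f : P.complex.X (p + 1) ⟶ N, P.complex.d (p + 2) (p + 1) ≫ f = 0 →
        ∃ g : P.complex.X p ⟶ N, P.complex.d (p + 1) p ≫ g = f := by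
    have e := P.isoExt (R := R) (p + 1) N
    have e' : ExtModule R M N (p + 1) ≃ ((P.complex.linearYonedaObj R N).homology (p + 1)) :=
      e.toLinearEquiv.toEquiv
    rw [e'.subsingleton_congr, ← ModuleCat.isZero_iff_subsingleton,
      ← HomologicalComplex.exactAt_iff_isZero_homology, HomologicalComplex.exactAt_iff' _ p (p + 1) (p + 2)
        (by simp) (by simp), ShortComplex.moduleCat_exact_iff]
    rfl
  rw [h1]
  constructor
  · intro h
    refine subsingleton_of_forall_eq 0 fun α => ?_
    obtain ⟨f, hf, rfl⟩ := P.extMk_surjective α (p + 2) rfl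
    exact (P.extMk_eq_zero_iff f _ rfl hf p rfl).2 (h f hf)
  · intro h f hf
    exact (P.extMk_eq_zero_iff f _ rfl hf p rfl).1 (Subsingleton.elim _ _)

/-- Vanishing of `Ext^i_R(M, N)`. -/
def ExtVanish (R M N : Type) [CommRing R] [AddCommGroup M] [Module R M] [AddCommGroup N]
    [Module R N] (i : ℕ) : Prop :=
  Subsingleton (Ext (ModuleCat.of R M) (ModuleCat.of R N) i)

/-- A short exact sequence `0 → A → B → C → 0` of modules. -/
structure SES {R A B C : Type} [CommRing R] [AddCommGroup A] [Module R A] [AddCommGroup B]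
    [Module R B] [AddCommGroup C] [Module R C] (f : A →ₗ[R] B) (g : B →ₗ[R] C) : Prop where
  inj : Function.Injective f
  exact : Function.Exact f g
  surj : Function.Surjective g

section
variable {R A B C N M : Type} [CommRing R] [AddCommGroup A] [Module R A] [AddCommGroup B]
    [Module R B] [AddCommGroup C] [Module R C] [AddCommGroup N] [Module R N]
    [AddCommGroup M] [Module R M]

/-- The short complex of a short exact sequence. -/
abbrev SES.sc {f : A →ₗ[R] B} {g : B →ₗ[R] C} (h : SES f g) : ShortComplex (ModuleCat.{0} R) :=
  ShortComplex.mk (ModuleCat.ofHom f) (ModuleCat.ofHom g)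
    (by ext x; exact h.exact.apply_apply_eq_zero x)

theorem SES.sc_exact {f : A →ₗ[R] B} {g : B →ₗ[R] C} (h : SES f g) : h.sc.ShortExact where
  exact := by
    rw [ShortComplex.moduleCat_exact_iff]
    exact fun x hx => (h.exact x).1 hx
  mono_f := (ModuleCat.mono_iff_injective _).2 h.inj
  epi_g := (ModuleCat.epi_iff_surjective _).2 h.surj

theorem ses_of_surjective {g : B →ₗ[R] C} (h : Function.Surjective g) :
    SES (LinearMap.ker g).subtype g :=
  ⟨Subtype.val_injective, LinearMap.exact_subtype_ker_map g, h⟩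

theorem ses_of_injective {f : A →ₗ[R] B} (h : Function.Injective f) :
    SES f (LinearMap.range f).mkQ :=
  ⟨h, LinearMap.exact_map_mkQ_range f, Submodule.mkQ_surjective _⟩

namespace ExtVanish

theorem zero {i : ℕ} (h : ExtVanish R M N i) (x : Ext (ModuleCat.of R M) (ModuleCat.of R N) i) :
    x = 0 := Subsingleton.elim (h := h) _ _

theorem sub_left {f : A →ₗ[R] B} {g : B →ₗ[R] C} (h : SES f g) {i : ℕ}
    (hB : ExtVanish R B N i) (hC : ExtVanish R C N (i + 1)) : ExtVanish R A N i := by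
  refine subsingleton_of_forall_eq 0 fun x => ?_
  obtain ⟨y, rfl⟩ := Ext.contravariant_sequence_exact₁ h.sc_exact _ x (add_comm 1 i) (hC.zero _)
  rw [show y = 0 from hB.zero y]; simp

theorem quot_left {f : A →ₗ[R] B} {g : B →ₗ[R] C} (h : SES f g) {i : ℕ}
    (hA : ExtVanish R A N i) (hB : ExtVanish R B N (i + 1)) : ExtVanish R C N (i + 1) := by
  refine subsingleton_of_forall_eq 0 fun x => ?_
  obtain ⟨y, rfl⟩ := Ext.contravariant_sequence_exact₃ h.sc_exact _ x (hB.zero _) (add_comm 1 i)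
  rw [show y = 0 from hA.zero y]; simp

theorem sub_right {f : A →ₗ[R] B} {g : B →ₗ[R] C} (h : SES f g) {i : ℕ}
    (hC : ExtVanish R M C i) (hB : ExtVanish R M B (i + 1)) : ExtVanish R M A (i + 1) := by
  refine subsingleton_of_forall_eq 0 fun x => ?_
  obtain ⟨y, rfl⟩ := Ext.covariant_sequence_exact₁ _ h.sc_exact x (hB.zero _) rfl
  rw [show y = 0 from hC.zero y]; simp

theorem quot_right {f : A →ₗ[R] B} {g : B →ₗ[R] C} (h : SES f g) {i : ℕ}
    (hB : ExtVanish R M B i) (hA : ExtVanish R M A (i + 1)) : ExtVanish R M C i := by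
  refine subsingleton_of_forall_eq 0 fun x => ?_
  obtain ⟨y, rfl⟩ := Ext.covariant_sequence_exact₃ _ h.sc_exact x rfl (hA.zero _)
  rw [show y = 0 from hB.zero y]; simp

theorem congr_left (e : A ≃ₗ[R] B) {i : ℕ} (h : ExtVanish R A N i) : ExtVanish R B N i := by
  refine subsingleton_of_forall_eq 0 fun x => ?_
  have : x = (Ext.mk₀ (e.toModuleIso.inv)).comp ((Ext.mk₀ (e.toModuleIso.hom)).comp x
      (zero_add i)) (zero_add i) := by
    rw [Ext.mk₀_comp_mk₀_assoc, Iso.inv_hom_id, Ext.mk₀_id_comp]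
  rw [this, h.zero ((Ext.mk₀ (e.toModuleIso.hom)).comp x (zero_add i))]; simp

theorem congr_right (e : A ≃ₗ[R] B) {i : ℕ} (h : ExtVanish R M A i) : ExtVanish R M B i := by
  refine subsingleton_of_forall_eq 0 fun x => ?_
  have : x = (x.comp (Ext.mk₀ (e.toModuleIso.inv)) (add_zero i)).comp
      (Ext.mk₀ (e.toModuleIso.hom)) (add_zero i) := by
    rw [Ext.comp_assoc_of_third_deg_zero, Ext.mk₀_comp_mk₀, Iso.inv_hom_id, Ext.comp_mk₀_id]
  rw [this, h.zero (x.comp (Ext.mk₀ (e.toModuleIso.inv)) (add_zero i))]; simp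

theorem of_projective [Module.Projective R M] (i : ℕ) : ExtVanish R M N (i + 1) :=
  haveI := IsProjective.iff_projective M |>.1 ‹_›
  Ext.subsingleton_of_projective _ _ _

theorem of_injective [Module.Injective R N] (i : ℕ) : ExtVanish R M N (i + 1) :=
  haveI := Module.injective_iff_injective_object R N |>.1 ‹_›
  Ext.subsingleton_of_injective _ _ _

theorem zero_iff : ExtVanish R M N 0 ↔ ∀ f : M →ₗ[R] N, f = 0 := by
  constructor
  · intro h f
    have := h.zero (Ext.mk₀ (ModuleCat.ofHom f))
    rw [Ext.mk₀_eq_zero_iff] at this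
    simpa using congrArg ModuleCat.Hom.hom this
  · intro h
    refine subsingleton_of_forall_eq 0 fun x => ?_
    obtain ⟨f, rfl⟩ := (Ext.mk₀_bijective _ _).2 x
    rw [Ext.mk₀_eq_zero_iff]
    ext1
    exact h _

theorem smul_left (r : R) (h0 : ∀ m : M, r • m = 0) {i : ℕ}
    (x : Ext (ModuleCat.of R M) (ModuleCat.of R N) i) : r • x = 0 := by
  have : r • x = (Ext.mk₀ (r • 𝟙 (ModuleCat.of R M))).comp x (zero_add _) := by
    simp [Ext.mk₀_smul]
  rw [this, show r • 𝟙 (ModuleCat.of R M) = 0 by ext m; exact h0 m]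
  simp

theorem subsingleton_left [Subsingleton M] (i : ℕ) : ExtVanish R M N i := by
  refine subsingleton_of_forall_eq 0 fun x => ?_
  rw [← one_smul R x]
  exact smul_left 1 (fun m => Subsingleton.elim _ _) x

/-- `Ext¹` vanishing extends maps. -/
theorem exists_extend {f : A →ₗ[R] B} {g : B →ₗ[R] C} (h : SES f g)
    (hC : ExtVanish R C N 1) (φ : A →ₗ[R] N) : ∃ ψ : B →ₗ[R] N, ψ ∘ₗ f = φ := by
  obtain ⟨y, hy⟩ := Ext.contravariant_sequence_exact₁ h.sc_exact (ModuleCat.of R N)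
    (Ext.mk₀ (ModuleCat.ofHom φ)) (add_comm 1 0) (hC.zero _)
  obtain ⟨ψ, rfl⟩ := (Ext.mk₀_bijective _ _).2 y
  rw [Ext.mk₀_comp_mk₀] at hy
  exact ⟨ψ.hom, by simpa using congrArg ModuleCat.Hom.hom ((Ext.mk₀_bijective _ _).1 hy)⟩

theorem of_extend {f : A →ₗ[R] B} {g : B →ₗ[R] C} (h : SES f g) (hB : ExtVanish R B N 1)
    (H : ∀ φ : A →ₗ[R] N, ∃ ψ : B →ₗ[R] N, ψ ∘ₗ f = φ) : ExtVanish R C N 1 := by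
  refine subsingleton_of_forall_eq 0 fun x => ?_
  obtain ⟨y, rfl⟩ := Ext.contravariant_sequence_exact₃ h.sc_exact _ x (hB.zero _) (add_comm 1 0)
  obtain ⟨φ, rfl⟩ := (Ext.mk₀_bijective _ _).2 y
  obtain ⟨ψ, hψ⟩ := H φ.hom
  have : φ = h.sc.f ≫ ModuleCat.ofHom ψ := by ext1; exact hψ.symm
  rw [this, ← Ext.mk₀_comp_mk₀, ← Ext.comp_assoc _ _ _ (add_zero 1) (zero_add 0) (by simp),
    h.sc_exact.extClass_comp, Ext.zero_comp]

theorem exists_lift {f : A →ₗ[R] B} {g : B →ₗ[R] C} (h : SES f g)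
    (hA : ExtVanish R M A 1) (φ : M →ₗ[R] C) : ∃ ψ : M →ₗ[R] B, g ∘ₗ ψ = φ := by
  obtain ⟨y, hy⟩ := Ext.covariant_sequence_exact₃ (ModuleCat.of R M) h.sc_exact
    (Ext.mk₀ (ModuleCat.ofHom φ)) rfl (hA.zero _)
  obtain ⟨ψ, rfl⟩ := (Ext.mk₀_bijective _ _).2 y
  rw [Ext.mk₀_comp_mk₀] at hy
  exact ⟨ψ.hom, by simpa using congrArg ModuleCat.Hom.hom ((Ext.mk₀_bijective _ _).1 hy)⟩

theorem of_lift {f : A →ₗ[R] B} {g : B →ₗ[R] C} (h : SES f g) (hB : ExtVanish R M B 1)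
    (H : ∀ φ : M →ₗ[R] C, ∃ ψ : M →ₗ[R] B, g ∘ₗ ψ = φ) : ExtVanish R M A 1 := by
  refine subsingleton_of_forall_eq 0 fun x => ?_
  obtain ⟨y, rfl⟩ := Ext.covariant_sequence_exact₁ _ h.sc_exact x (hB.zero _) rfl
  obtain ⟨φ, rfl⟩ := (Ext.mk₀_bijective _ _).2 y
  obtain ⟨ψ, hψ⟩ := H φ.hom
  have : φ = ModuleCat.ofHom ψ ≫ h.sc.g := by ext1; exact hψ.symm
  rw [this, ← Ext.mk₀_comp_mk₀, Ext.comp_assoc _ _ _ (zero_add 0) (zero_add 1) (by simp),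
    h.sc_exact.comp_extClass, Ext.comp_zero]

end ExtVanish
end

theorem extModule_iff {R M N : Type} [CommRing R] [AddCommGroup M] [Module R M] [AddCommGroup N]
    [Module R N] {i : ℕ} (hi : 0 < i) :
    Subsingleton (ExtModule R (ModuleCat.of R M) (ModuleCat.of R N) i) ↔ ExtVanish R M N i := by
  obtain ⟨p, rfl⟩ : ∃ p, i = p + 1 := ⟨i - 1, by omega⟩
  exact subsingleton_extModule_iff _ _ p

end Semidual

end

section

namespace Semidual
open Abelian TensorProduct

/-- Uniform vanishing of `Ext^i(-, E)` for large `i`. -/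
def FID (R E : Type) [CommRing R] [AddCommGroup E] [Module R E] : Prop :=
  ∃ n : ℕ, ∀ (K : Type) [AddCommGroup K] [Module R K] (i : ℕ), n < i → ExtVanish R K E i

theorem hasFiniteInjectiveDimension_iff (R E : Type) [CommRing R] [AddCommGroup E] [Module R E] :
    HasFiniteInjectiveDimension R E ↔ FID R E := by
  constructor
  · rintro ⟨n, hn⟩
    exact ⟨n, fun K _ _ i hi => (extModule_iff (by omega)).1 (hn (ModuleCat.of R K) i hi)⟩
  · rintro ⟨n, hn⟩
    exact ⟨n, fun K i hi => (extModule_iff (M := K) (by omega)).2 (hn K i hi)⟩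

theorem isSemidualizing_iff (R C : Type) [CommRing R] [AddCommGroup C] [Module R C] :
    IsSemidualizing R C ↔ Module.Finite R C ∧ Function.Bijective (algebraMap R (Module.End R C)) ∧
      ∀ i, 0 < i → ExtVanish R C C i :=
  and_congr_right fun _ => and_congr_right fun _ =>
    forall_congr' fun _ => forall_congr' fun h => extModule_iff h

section
variable {R M N E K F : Type} [CommRing R] [AddCommGroup M] [Module R M] [AddCommGroup N]
    [Module R N] [AddCommGroup E] [Module R E] [AddCommGroup K] [Module R K] [AddCommGroup F]
    [Module R F]

theorem ExtVanish.of_sum {ι : Type} [Fintype ι] (a : ι → M →ₗ[R] N) (b : ι → N →ₗ[R] M)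
    (hab : ∑ j, b j ∘ₗ a j = LinearMap.id) {i : ℕ} (h : ExtVanish R N E i) :
    ExtVanish R M E i := by
  refine subsingleton_of_forall_eq 0 fun x => ?_
  have h1 : ∑ j, ModuleCat.ofHom (a j) ≫ ModuleCat.ofHom (b j) = 𝟙 (ModuleCat.of R M) := by
    ext1
    rw [← ModuleCat.ofHom_id, ← hab]
    simp
  rw [← Ext.mk₀_id_comp x, ← h1, Ext.mk₀_sum, Ext.sum_comp]
  refine Finset.sum_eq_zero fun j _ => ?_
  rw [← Ext.mk₀_comp_mk₀_assoc, h.zero ((Ext.mk₀ (ModuleCat.ofHom (b j))).comp x _), Ext.comp_zero]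

/-- The maps `N → Hom(Rⁿ, N)` dual to evaluation at basis vectors. -/
noncomputable def coev (R N : Type) [CommRing R] [AddCommGroup N] [Module R N] {n : ℕ} (j : Fin n) :
    N →ₗ[R] ((Fin n → R) →ₗ[R] N) :=
  LinearMap.flip (LinearMap.toSpanSingleton R (N →ₗ[R] N) LinearMap.id ∘ₗ LinearMap.proj j)

@[simp] theorem coev_apply {n : ℕ} (j : Fin n) (x : N) (v : Fin n → R) :
    coev R N j x v = v j • x := by simp [coev]

/-- Evaluation at a vector. -/
abbrev evAt (m : M) : (M →ₗ[R] N) →ₗ[R] N := LinearMap.applyₗ m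

theorem sum_coev_evAt (n : ℕ) : ∑ j : Fin n, coev R N j ∘ₗ evAt (Pi.single j (1 : R)) =
    LinearMap.id := by
  ext φ k
  simp only [LinearMap.sum_apply, LinearMap.comp_apply, coev_apply, LinearMap.applyₗ_apply_apply,
    LinearMap.id_apply]
  rw [Finset.sum_eq_single k] <;> simp +contextual

theorem SES.hom {f : K →ₗ[R] F} {g : F →ₗ[R] M} (h : SES f g) (h1 : ExtVanish R M N 1) :
    SES (LinearMap.lcomp R N g) (LinearMap.lcomp R N f) where
  inj := LinearMap.lcomp_injective_of_surjective _ h.surj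
  exact := by
    intro φ
    constructor
    · intro hφ
      have hk : LinearMap.range f ≤ LinearMap.ker φ := by
        rintro _ ⟨x, rfl⟩
        exact LinearMap.congr_fun hφ x
      rw [← h.exact.linearMap_ker_eq] at hk
      refine ⟨(LinearMap.ker g).liftQ φ hk ∘ₗ (g.quotKerEquivOfSurjective h.surj).symm, ?_⟩
      ext x
      simp only [LinearMap.lcomp_apply, LinearMap.comp_apply, LinearEquiv.coe_coe]
      have : (g.quotKerEquivOfSurjective h.surj).symm (g x) = Submodule.Quotient.mk x := by
        rw [LinearEquiv.symm_apply_eq]; rfl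
      rw [this]; rfl
    · rintro ⟨ψ, rfl⟩
      ext x
      simp [h.exact.apply_apply_eq_zero]
  surj φ := by
    obtain ⟨ψ, hψ⟩ := h1.exists_extend h φ
    exact ⟨ψ, hψ⟩

theorem exists_free_cover (R M : Type) [CommRing R] [IsNoetherianRing R] [AddCommGroup M]
    [Module R M] [Module.Finite R M] : ∃ (n : ℕ) (f : (Fin n → R) →ₗ[R] M),
      Function.Surjective f ∧ Module.Finite R (LinearMap.ker f) := by
  obtain ⟨n, f, hf⟩ := Module.Finite.exists_fin' R M
  exact ⟨n, f, hf, inferInstance⟩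

/-- `Ext` vanishing is preserved under syzygies. -/
theorem ExtVanish.syzygy {n : ℕ} {f : (Fin n → R) →ₗ[R] M} (hf : Function.Surjective f)
    (h : ∀ i, 0 < i → ExtVanish R M N i) (i : ℕ) (hi : 0 < i) :
    ExtVanish R (LinearMap.ker f) N i := by
  obtain ⟨p, rfl⟩ : ∃ p, i = p + 1 := ⟨i - 1, by omega⟩
  exact sub_left (ses_of_surjective hf) (of_projective p) (h _ (by omega))

theorem ExtVanish.hom [IsNoetherianRing R] {s : ℕ} (hE : FID R E)
    (hs : ∀ i, s < i → ExtVanish R N E i) (i : ℕ) (hi : s < i) :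
    ∀ (M : Type) [AddCommGroup M] [Module R M] [Module.Finite R M],
    (∀ i, 0 < i → ExtVanish R M N i) → ExtVanish R (M →ₗ[R] N) E i := by
  obtain ⟨b, hb⟩ := hE
  suffices H : ∀ d i, s < i → b < i + d → ∀ (M : Type) [AddCommGroup M] [Module R M]
      [Module.Finite R M], (∀ i, 0 < i → ExtVanish R M N i) → ExtVanish R (M →ₗ[R] N) E i from
    H (b + 1) i hi (by omega)
  intro d
  induction d with
  | zero => intro i _ hi M _ _ _ _; exact hb _ i hi
  | succ d ih =>
    intro i hi hid M _ _ _ hM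
    obtain ⟨n, f, hf, _⟩ := exists_free_cover R M
    refine sub_left ((ses_of_surjective hf).hom (hM 1 one_pos)) ?_
      (ih (i + 1) (by omega) (by omega) _ (syzygy hf hM))
    exact of_sum _ _ (sum_coev_evAt n) (hs i hi)

/-- The natural map `M ⊗ Ext^s(N, E) → Ext^s(Hom(M, N), E)`. -/
noncomputable def zeta (R M N E : Type) [CommRing R] [AddCommGroup M] [Module R M]
    [AddCommGroup N] [Module R N] [AddCommGroup E] [Module R E] (s : ℕ) :
    M ⊗[R] Ext (ModuleCat.of R N) (ModuleCat.of R E) s →ₗ[R]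
      Ext (ModuleCat.of R (M →ₗ[R] N)) (ModuleCat.of R E) s :=
  TensorProduct.lift (LinearMap.mk₂ R
    (fun m x => (Ext.mk₀ (ModuleCat.ofHom (evAt (N := N) m))).comp x (zero_add s))
    (fun m m' x => by simp [evAt, map_add, ModuleCat.ofHom_add, Ext.mk₀_add])
    (fun r m x => by
      rw [evAt, map_smul]
      rw [show ModuleCat.ofHom (r • (LinearMap.applyₗ m : (M →ₗ[R] N) →ₗ[R] N)) =
        r • ModuleCat.ofHom (LinearMap.applyₗ m : (M →ₗ[R] N) →ₗ[R] N) from rfl]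
      rw [Ext.mk₀_smul, Ext.smul_comp])
    (fun m x y => by simp) (fun r m x => by simp))

@[simp] theorem zeta_tmul {s : ℕ} (m : M) (x : Ext (ModuleCat.of R N) (ModuleCat.of R E) s) :
    zeta R M N E s (m ⊗ₜ x) = (Ext.mk₀ (ModuleCat.ofHom (evAt (N := N) m))).comp x (zero_add s) :=
  rfl

theorem zeta_naturality {s : ℕ} (h : F →ₗ[R] M)
    (z : F ⊗[R] Ext (ModuleCat.of R N) (ModuleCat.of R E) s) :
    zeta R M N E s (h.rTensor _ z) =
      (Ext.mk₀ (ModuleCat.ofHom (LinearMap.lcomp R N h))).comp (zeta R F N E s z) (zero_add s) := by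
  induction z with
  | zero => simp
  | add a b ha hb => rw [map_add, map_add, ha, hb, map_add, Ext.comp_add]
  | tmul a x =>
    rw [LinearMap.rTensor_tmul, zeta_tmul, zeta_tmul, Ext.mk₀_comp_mk₀_assoc]
    rfl

theorem zeta_free_bijective (n s : ℕ) : Function.Bijective (zeta R (Fin n → R) N E s) := by
  constructor
  · have H (z : (Fin n → R) ⊗[R] Ext (ModuleCat.of R N) (ModuleCat.of R E) s) :
        ∃ w : Fin n → Ext (ModuleCat.of R N) (ModuleCat.of R E) s,
        z = ∑ j, (Pi.single j (1 : R) : Fin n → R) ⊗ₜ w j := by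
      induction z with
      | zero => exact ⟨0, by simp⟩
      | add a b ha hb =>
        obtain ⟨u, rfl⟩ := ha
        obtain ⟨v, rfl⟩ := hb
        exact ⟨u + v, by simp [TensorProduct.tmul_add, Finset.sum_add_distrib]⟩
      | tmul a x =>
        refine ⟨fun j => a j • x, ?_⟩
        conv_lhs => rw [pi_eq_sum_univ' a]
        rw [TensorProduct.sum_tmul]
        refine Finset.sum_congr rfl fun j _ => ?_
        rw [TensorProduct.tmul_smul, ← TensorProduct.smul_tmul']
    rw [injective_iff_map_eq_zero]
    intro z hz
    obtain ⟨w, rfl⟩ := H z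
    rw [map_sum] at hz
    refine Finset.sum_eq_zero fun k _ => ?_
    have := congrArg (fun y => (Ext.mk₀ (ModuleCat.ofHom (coev R N k))).comp y (zero_add s)) hz
    simp only [zeta_tmul, Ext.comp_sum, Ext.mk₀_comp_mk₀_assoc, Ext.comp_zero] at this
    rw [Finset.sum_eq_single k] at this
    · have h1 : ModuleCat.ofHom (coev R N k) ≫ ModuleCat.ofHom (evAt (Pi.single k (1 : R))) =
          𝟙 (ModuleCat.of R N) := by ext; simp
      rw [h1, Ext.mk₀_id_comp] at this
      rw [this, TensorProduct.tmul_zero]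
    · intro j _ hj
      have h1 : ModuleCat.ofHom (coev R N k) ≫ ModuleCat.ofHom (evAt (Pi.single j (1 : R))) =
          0 := by ext; simp [hj.symm]
      rw [h1, Ext.mk₀_zero, Ext.zero_comp]
    · simp
  · intro y
    refine ⟨∑ j, (Pi.single j (1 : R) : Fin n → R) ⊗ₜ
      ((Ext.mk₀ (ModuleCat.ofHom (coev R N j))).comp y (zero_add s)), ?_⟩
    have h1 : ∑ j : Fin n, ModuleCat.ofHom (evAt (N := N) (Pi.single j (1 : R))) ≫
        ModuleCat.ofHom (coev R N j) = 𝟙 (ModuleCat.of R ((Fin n → R) →ₗ[R] N)) := by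
      rw [← ModuleCat.ofHom_id, ← sum_coev_evAt]
      ext1; simp
    conv_rhs => rw [← Ext.mk₀_id_comp y, ← h1, Ext.mk₀_sum, Ext.sum_comp]
    simp only [map_sum, zeta_tmul, Ext.mk₀_comp_mk₀_assoc]

theorem zeta_surjective [IsNoetherianRing R] {s : ℕ} (hE : FID R E)
    (hs : ∀ i, s < i → ExtVanish R N E i) [Module.Finite R M]
    (hM : ∀ i, 0 < i → ExtVanish R M N i) : Function.Surjective (zeta R M N E s) := by
  obtain ⟨n, f, hf, _⟩ := exists_free_cover R M
  have hS := (ses_of_surjective hf).hom (hM 1 one_pos)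
  intro y
  have h0 := ExtVanish.hom hE hs (s + 1) (by omega) _ (ExtVanish.syzygy hf hM)
  obtain ⟨x, hx⟩ := Ext.contravariant_sequence_exact₁ hS.sc_exact _ y (add_comm 1 s) (h0.zero _)
  obtain ⟨z, rfl⟩ := (zeta_free_bijective n s).2 x
  exact ⟨f.rTensor _ z, by rw [zeta_naturality]; exact hx⟩

theorem zeta_bijective [IsNoetherianRing R] {s : ℕ} (hE : FID R E)
    (hs : ∀ i, s < i → ExtVanish R N E i) [Module.Finite R M]
    (hM : ∀ i, 0 < i → ExtVanish R M N i) : Function.Bijective (zeta R M N E s) := by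
  refine ⟨?_, zeta_surjective hE hs hM⟩
  obtain ⟨n, f, hf, _⟩ := exists_free_cover R M
  have hS := (ses_of_surjective hf).hom (hM 1 one_pos)
  rw [injective_iff_map_eq_zero]
  intro z hz
  obtain ⟨z', rfl⟩ := LinearMap.rTensor_surjective _ hf z
  rw [zeta_naturality] at hz
  obtain ⟨x, hx⟩ := Ext.contravariant_sequence_exact₂ hS.sc_exact _ _ hz
  obtain ⟨t, rfl⟩ := zeta_surjective hE hs (ExtVanish.syzygy hf hM) x
  have h2 : zeta R (Fin n → R) N E s ((LinearMap.ker f).subtype.rTensor _ t) =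
      zeta R (Fin n → R) N E s z' := by rw [zeta_naturality]; exact hx
  rw [← (zeta_free_bijective n s).1 h2, ← LinearMap.comp_apply, ← LinearMap.rTensor_comp]
  rw [show f ∘ₗ (LinearMap.ker f).subtype = 0 by ext x; exact x.2]
  simp

end
end Semidual

end

section

namespace Semidual
open Abelian TensorProduct

section
variable {R M N E : Type} [CommRing R] [IsNoetherianRing R] [AddCommGroup M] [Module R M]
    [Module.Finite R M] [AddCommGroup N] [Module R N] [AddCommGroup E] [Module R E]

/-- `m ⊗ f ↦ (φ ↦ f (φ m))`. -/
noncomputable def homEval (R M N E : Type) [CommRing R] [AddCommGroup M] [Module R M]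
    [AddCommGroup N] [Module R N] [AddCommGroup E] [Module R E] :
    M ⊗[R] (N →ₗ[R] E) →ₗ[R] ((M →ₗ[R] N) →ₗ[R] E) :=
  TensorProduct.lift ((LinearMap.llcomp R (M →ₗ[R] N) N E).flip ∘ₗ LinearMap.applyₗ)

omit [IsNoetherianRing R] [Module.Finite R M] in
@[simp] theorem homEval_tmul (m : M) (f : N →ₗ[R] E) (φ : M →ₗ[R] N) :
    homEval R M N E (m ⊗ₜ f) φ = f (φ m) := rfl

theorem homEval_bijective (hE : FID R E) (hN : ∀ i, 0 < i → ExtVanish R N E i)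
    (hM : ∀ i, 0 < i → ExtVanish R M N i) : Function.Bijective (homEval R M N E) := by
  have h := zeta_bijective hE hN hM
  let e1 : (N →ₗ[R] E) ≃ₗ[R] Ext (ModuleCat.of R N) (ModuleCat.of R E) 0 :=
    (ModuleCat.homLinearEquiv (S := R) (M := ModuleCat.of R N) (N := ModuleCat.of R E)).symm.trans
      (Ext.linearEquiv₀ (R := R)).symm
  let e2 : ((M →ₗ[R] N) →ₗ[R] E) ≃ₗ[R] Ext (ModuleCat.of R (M →ₗ[R] N)) (ModuleCat.of R E) 0 :=
    (ModuleCat.homLinearEquiv (S := R) (M := ModuleCat.of R (M →ₗ[R] N))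
      (N := ModuleCat.of R E)).symm.trans (Ext.linearEquiv₀ (R := R)).symm
  have key : e2.toLinearMap ∘ₗ homEval R M N E =
      zeta R M N E 0 ∘ₗ (e1.lTensor M).toLinearMap := by
    apply TensorProduct.ext'
    intro m f
    simp only [LinearMap.comp_apply, LinearEquiv.coe_coe, LinearEquiv.lTensor_tmul, zeta_tmul]
    change Ext.mk₀ (ModuleCat.ofHom _) = Ext.comp _ (Ext.mk₀ (ModuleCat.ofHom f)) _
    rw [Ext.mk₀_comp_mk₀]
    rfl
  have h2 : Function.Bijective (e2.toLinearMap ∘ₗ homEval R M N E) := by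
    rw [key]
    exact h.comp (e1.lTensor M).bijective
  exact (Function.Bijective.of_comp_iff' e2.bijective _).1 h2

theorem dual_eval_bijective (hR : FID R R) (hM : ∀ i, 0 < i → ExtVanish R M R i) :
    Function.Bijective (Module.Dual.eval R M) := by
  have h := homEval_bijective hR (fun i hi => by
    obtain ⟨p, rfl⟩ : ∃ p, i = p + 1 := ⟨i - 1, by omega⟩
    exact ExtVanish.of_projective p) hM
  let e : M ≃ₗ[R] M ⊗[R] (R →ₗ[R] R) := (TensorProduct.rid R M).symm.trans
    ((LinearMap.ringLmapEquivSelf R R R).symm.lTensor M)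
  have : Module.Dual.eval R M = homEval R M R R ∘ₗ e.toLinearMap := by
    ext m φ; simp [e]
  rw [this]
  exact h.comp e.bijective

theorem ExtVanish.dual (hR : FID R R) (hM : ∀ i, 0 < i → ExtVanish R M R i) (i : ℕ) (hi : 0 < i) :
    ExtVanish R (M →ₗ[R] R) R i :=
  ExtVanish.hom hR (fun i hi => by
    obtain ⟨p, rfl⟩ : ∃ p, i = p + 1 := ⟨i - 1, by omega⟩
    exact ExtVanish.of_projective p) i hi M hM

end

section
variable {R C E : Type} [CommRing R] [IsNoetherianRing R] [AddCommGroup C] [Module R C]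
    [AddCommGroup E] [Module R E]

/-- Semidualizing modules, in terms of `ExtVanish`. -/
structure IsSD (R C : Type) [CommRing R] [AddCommGroup C] [Module R C] : Prop where
  fin : Module.Finite R C
  homothety : Function.Bijective (algebraMap R (Module.End R C))
  ext : ∀ i, 0 < i → ExtVanish R C C i

omit [IsNoetherianRing R] in
theorem isSD_iff : IsSemidualizing R C ↔ IsSD R C :=
  (isSemidualizing_iff R C).trans ⟨fun h => ⟨h.1, h.2.1, h.2.2⟩, fun h => ⟨h.1, h.2, h.3⟩⟩

/-- The homothety isomorphism. -/
noncomputable def IsSD.equiv (h : IsSD R C) : R ≃ₗ[R] (C →ₗ[R] C) :=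
  LinearEquiv.ofBijective (Algebra.linearMap R (Module.End R C)) h.homothety

omit [IsNoetherianRing R] in
theorem IsSD.subsingleton_of_tensor (h : IsSD R C) (X : Type) [AddCommGroup X] [Module R X]
    [Module.Finite R X] (hX : Subsingleton (C ⊗[R] X)) : Subsingleton X := by
  have := h.fin
  by_contra hne
  rw [not_subsingleton_iff_nontrivial] at hne
  obtain ⟨p, hp⟩ := Module.nonempty_support_of_nontrivial (R := R) (M := X)
  have hpC : p ∈ Module.support R C := by
    rw [Module.support_eq_zeroLocus, PrimeSpectrum.mem_zeroLocus]
    intro r hr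
    have : r = 0 := h.homothety.1 (by
      ext c
      simpa using (Module.mem_annihilator.1 hr) c)
    rw [this]
    exact p.asIdeal.zero_mem
  have hpT : p ∉ Module.support R (C ⊗[R] X) := by
    rw [Module.support_eq_empty]; simp
  rw [Module.mem_support_iff_nontrivial_residueField_tensorProduct] at hp hpC hpT
  apply hpT
  have : Nontrivial ((p.asIdeal.ResidueField ⊗[R] C) ⊗[p.asIdeal.ResidueField]
      (p.asIdeal.ResidueField ⊗[R] X)) := inferInstance
  exact (TensorProduct.AlgebraTensorModule.distribBaseChange R p.asIdeal.ResidueField C X).nontrivial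

theorem IsSD.extVanish (h : IsSD R C) [Module.Finite R E] (hE : FID R E) (i : ℕ) (hi : 0 < i) :
    ExtVanish R C E i := by
  have := h.fin
  obtain ⟨n, hn⟩ := id hE
  suffices H : ∀ d s, n ≤ s + d → ∀ i, s < i → ExtVanish R C E i from H n 0 (by omega) i hi
  intro d
  induction d with
  | zero => intro s hs i hi; exact hn C i (by omega)
  | succ d ih =>
    intro s hs i hi
    have h1 := ih (s + 1) (by omega)
    by_cases hsi : s + 1 < i
    · exact h1 i hsi
    obtain rfl : i = s + 1 := by omega
    have hz := zeta_bijective hE h1 h.ext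
    have hv : ExtVanish R (C →ₗ[R] C) E (s + 1) :=
      (ExtVanish.of_projective s).congr_left h.equiv
    have : Subsingleton (Ext (ModuleCat.of R (C →ₗ[R] C)) (ModuleCat.of R E) (s + 1)) := hv
    exact h.subsingleton_of_tensor _ hz.1.subsingleton

theorem IsSD.eval_bijective (h : IsSD R C) [Module.Finite R E] (hE : FID R E) :
    Function.Bijective (TensorProduct.lift (LinearMap.applyₗ (R := R) (M := C) (M₂ := E))) := by
  have := h.fin
  have h1 := homEval_bijective hE (h.extVanish hE) h.ext
  let e : ((C →ₗ[R] C) →ₗ[R] E) ≃ₗ[R] E :=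
    (h.equiv.symm.arrowCongr (LinearEquiv.refl R E)).trans (LinearMap.ringLmapEquivSelf R R E)
  have : TensorProduct.lift (LinearMap.applyₗ (R := R) (M := C) (M₂ := E)) =
      e.toLinearMap ∘ₗ homEval R C C E := by
    apply TensorProduct.ext'
    intro c f
    have h1 : h.equiv 1 = LinearMap.id := by
      change algebraMap R (Module.End R C) 1 = _
      rw [map_one]; rfl
    simp [e, h1]
  rw [this]
  exact e.bijective.comp h1

end
end Semidual

end

section

namespace Semidual
open Abelian TensorProduct

section
variable {A B N : Type} [CommRing A] [CommRing B] [Algebra A B] [AddCommGroup N] [Module A N]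
    [Module B N] [IsScalarTower A B N]

/-- Over a surjective `A → B`, `A`-linear maps of `B`-modules are `B`-linear. -/
def upgrade (hs : Function.Surjective (algebraMap A B)) {N N' : Type} [AddCommGroup N] [Module A N]
    [Module B N] [IsScalarTower A B N] [AddCommGroup N'] [Module A N']
    [Module B N'] [IsScalarTower A B N'] (φ : N →ₗ[A] N') : N →ₗ[B] N' where
  toFun := φ
  map_add' := φ.map_add
  map_smul' b n := by
    obtain ⟨a, rfl⟩ := hs b
    simp [algebraMap_smul]

@[simp] theorem upgrade_apply (hs : Function.Surjective (algebraMap A B)) {N N' : Type}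
    [AddCommGroup N] [Module A N] [Module B N] [IsScalarTower A B N] [AddCommGroup N'] [Module A N']
    [Module B N'] [IsScalarTower A B N'] (φ : N →ₗ[A] N') (n : N) : upgrade hs φ n = φ n := rfl

theorem SES.restrictScalars (A : Type) {B K F N : Type} [CommRing A] [CommRing B] [Algebra A B]
    [AddCommGroup N] [Module A N] [Module B N] [IsScalarTower A B N]
    [AddCommGroup K] [Module A K] [Module B K] [IsScalarTower A B K]
    [AddCommGroup F] [Module A F] [Module B F] [IsScalarTower A B F]
    {f : K →ₗ[B] F} {g : F →ₗ[B] N} (h : SES f g) :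
    SES (f.restrictScalars A) (g.restrictScalars A) where
  inj := h.inj
  exact := h.exact
  surj := h.surj

variable {x : A} (hs : Function.Surjective (algebraMap A B))
    (hk : RingHom.ker (algebraMap A B) = Ideal.span {x}) (hx : ∀ y : A, x * y = 0 → y = 0)

include hs hk hx in
theorem ses_mul : SES (LinearMap.lsmul A A x) (Algebra.linearMap A B) where
  inj := by
    rw [injective_iff_map_eq_zero]
    exact hx
  exact := by
    intro y
    have : Algebra.linearMap A B y = 0 ↔ y ∈ RingHom.ker (algebraMap A B) := Iff.rfl
    rw [this, hk, Ideal.mem_span_singleton']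
    exact ⟨fun ⟨a, ha⟩ => ⟨a, by simpa [mul_comm] using ha⟩, fun ⟨a, ha⟩ =>
      ⟨a, by simpa [mul_comm] using ha⟩⟩
  surj := hs

include hs hk hx in
theorem extVanish_free_quotient (κ X : Type) [AddCommGroup X] [Module A X] (i : ℕ) :
    ExtVanish A (κ →₀ B) X (i + 2) := by
  have h := ses_mul hs hk hx
  have h' : SES (Finsupp.mapRange.linearMap (α := κ) (LinearMap.lsmul A A x))
      (Finsupp.mapRange.linearMap (α := κ) (Algebra.linearMap A B)) := by
    refine ⟨Finsupp.mapRange_injective _ (map_zero _) h.inj, ?_,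
      Finsupp.mapRange_surjective _ (map_zero _) h.surj⟩
    intro v
    constructor
    · intro hv
      have hv' : ∀ k, ∃ a, LinearMap.lsmul A A x a = v k := fun k =>
        (h.exact (v k)).1 (by simpa using DFunLike.congr_fun hv k)
      choose w hw using hv'
      refine ⟨Finsupp.onFinset v.support w fun k hk => ?_, ?_⟩
      · rw [Finsupp.mem_support_iff, ← hw]
        intro h0
        exact hk (h.inj (by rw [h0, map_zero]))
      · ext k; simpa using hw k
    · rintro ⟨w, rfl⟩
      ext k
      simpa using h.exact.apply_apply_eq_zero (w k)
  exact ExtVanish.quot_left h' (ExtVanish.of_projective _) (ExtVanish.of_projective _)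

include hs hk hx in
theorem ExtVanish.of_quotient_regular (i : ℕ) : ∀ (N : Type) [AddCommGroup N] [Module A N]
    [Module B N] [IsScalarTower A B N], ExtVanish A N A (i + 2) → ExtVanish B N B (i + 1) := by
  have hxB : algebraMap A B x = 0 := by
    rw [← RingHom.mem_ker, hk]; exact Ideal.mem_span_singleton_self x
  induction i with
  | zero =>
    intro N _ _ _ _ hN
    let g : (N →₀ B) →ₗ[B] N := Finsupp.linearCombination B id
    have hg : Function.Surjective g := Finsupp.linearCombination_id_surjective B N
    have hSA := (ses_of_surjective hg).restrictScalars A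
    have hmul := ses_mul hs hk hx
    have hxk (M : Type) [AddCommGroup M] [Module A M] [Module B M] [IsScalarTower A B M] (m : M) :
        x • m = 0 := by rw [← algebraMap_smul B x m, hxB, zero_smul]
    refine of_extend (ses_of_surjective hg) (of_projective 0) fun φ => ?_
    obtain ⟨y, hy⟩ := Ext.contravariant_sequence_exact₁ hSA.sc_exact (ModuleCat.of A A)
      ((Ext.mk₀ (ModuleCat.ofHom (φ.restrictScalars A))).comp hmul.sc_exact.extClass (zero_add 1))
      (add_comm 1 1) (hN.zero _)
    obtain ⟨z, rfl⟩ := Ext.covariant_sequence_exact₁ _ hmul.sc_exact y (by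
      rw [show hmul.sc.f = x • 𝟙 (ModuleCat.of A A) from by ext; rfl,
        ← Ext.smul_eq_comp_mk₀]
      exact smul_left x (hxk _) y) (zero_add 1)
    obtain ⟨ψ', rfl⟩ := (Ext.mk₀_bijective _ _).2 z
    obtain ⟨ψ, rfl⟩ : ∃ ψ : (N →₀ B) →ₗ[A] B, ψ' = ModuleCat.ofHom ψ := ⟨ψ'.hom, rfl⟩
    refine ⟨upgrade hs ψ, ?_⟩
    obtain ⟨χ, hχ⟩ : ∃ χ : LinearMap.ker g →ₗ[A] B,
      χ = ψ ∘ₗ (LinearMap.ker g).subtype.restrictScalars A - φ.restrictScalars A := ⟨_, rfl⟩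
    have h0 : (Ext.mk₀ (ModuleCat.ofHom (X := LinearMap.ker g) (Y := B) χ)).comp hmul.sc_exact.extClass (zero_add 1) = 0 := by
      rw [Ext.mk₀_comp_mk₀_assoc] at hy
      have : ModuleCat.ofHom (X := LinearMap.ker g) (Y := B) χ =
        hSA.sc.f ≫ ModuleCat.ofHom ψ - ModuleCat.ofHom (φ.restrictScalars A) := by rw [hχ]; rfl
      rw [this, sub_eq_add_neg, Ext.mk₀_add, Ext.mk₀_neg, Ext.add_comp, Ext.neg_comp, hy,
        add_neg_cancel]
    obtain ⟨w, hw⟩ := Ext.covariant_sequence_exact₃ _ hmul.sc_exact _ (zero_add 1) h0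
    obtain ⟨w, rfl⟩ := (Ext.mk₀_bijective _ _).2 w
    have hw0 : w = 0 := by
      ext t
      refine hx _ ?_
      have := w.hom.map_smul x t
      rw [show x • t = 0 from hxk _ t, map_zero] at this
      exact this.symm
    rw [hw0, Ext.mk₀_zero, Ext.zero_comp, eq_comm, Ext.mk₀_eq_zero_iff] at hw
    ext t
    have : χ t = 0 := LinearMap.congr_fun (congrArg ModuleCat.Hom.hom hw) t
    rw [hχ] at this
    exact sub_eq_zero.1 this
  | succ i ih =>
    intro N _ _ _ _ hN
    let g : (N →₀ B) →ₗ[B] N := Finsupp.linearCombination B id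
    have hg : Function.Surjective g := Finsupp.linearCombination_id_surjective B N
    have hSA := (ses_of_surjective hg).restrictScalars A
    refine quot_left (ses_of_surjective hg) (ih _ ?_) (of_projective _)
    exact sub_left hSA (extVanish_free_quotient hs hk hx _ _ _) hN

end
end Semidual

end

section

namespace Semidual
open Abelian TensorProduct

theorem exists_injective_embedding (A X : Type) [CommRing A] [AddCommGroup X] [Module A X] :
    ∃ (J : Type) (_ : AddCommGroup J) (_ : Module A J)
      (_ : Module.Injective A J) (f : X →ₗ[A] J), Function.Injective f := by
  obtain ⟨p⟩ := EnoughInjectives.presentation (ModuleCat.of A X)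
  refine ⟨p.J, inferInstance, inferInstance,
    Module.injective_iff_injective_object A p.J |>.2 (by exact p.injective), p.f.hom, ?_⟩
  have := p.mono
  exact (ModuleCat.mono_iff_injective p.f).1 this

theorem ExtVanish.finsupp {A M : Type} [CommRing A] [AddCommGroup M] [Module A M] (κ : Type) (i : ℕ) :
    ∀ (X : Type) [AddCommGroup X] [Module A X], ExtVanish A M X (i + 1) →
      ExtVanish A (κ →₀ M) X (i + 1) := by
  induction i with
  | zero =>
    intro X _ _ h
    obtain ⟨J, _, _, _, f, hf⟩ := exists_injective_embedding A X
    refine of_lift (ses_of_injective hf) (of_injective 0) fun φ => ?_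
    have := fun k : κ => exists_lift (ses_of_injective hf) h (φ ∘ₗ Finsupp.lsingle k)
    choose ψ hψ using this
    refine ⟨Finsupp.lsum A ψ, ?_⟩
    ext k m : 2
    simpa using LinearMap.congr_fun (hψ k) m
  | succ i ih =>
    intro X _ _ h
    obtain ⟨J, _, _, _, f, hf⟩ := exists_injective_embedding A X
    exact sub_right (ses_of_injective hf) (ih _ (quot_right (ses_of_injective hf) (of_injective _) h))
      (of_injective _)

section change
variable {A B D X : Type} [CommRing A] [CommRing B] [Algebra A B] [AddCommGroup D] [Module A D]
    [Module B D] [IsScalarTower A B D] [AddCommGroup X] [Module A X]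

/-- Change of rings: if `D` represents `Hom_A(-, X)` on `B`-modules and `Ext_A(B, X)` vanishes in
positive degrees, then vanishing of `Ext_A(N, X)` implies vanishing of `Ext_B(N, D)`. -/
theorem ExtVanish.change (ε : D →ₗ[A] X) (hε : Function.Injective ε)
    (hU : ∀ (N : Type) [AddCommGroup N] [Module A N] [Module B N] [IsScalarTower A B N]
      (f : N →ₗ[A] X), ∃ g : N →ₗ[B] D, ∀ n, ε (g n) = f n)
    (hB : ∀ i, ExtVanish A B X (i + 1)) (i : ℕ) :
    ∀ (N : Type) [AddCommGroup N] [Module A N] [Module B N] [IsScalarTower A B N],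
      ExtVanish A N X (i + 1) → ExtVanish B N D (i + 1) := by
  induction i with
  | zero =>
    intro N _ _ _ _ hN
    let g : (N →₀ B) →ₗ[B] N := Finsupp.linearCombination B id
    have hg : Function.Surjective g := Finsupp.linearCombination_id_surjective B N
    have hSA := (ses_of_surjective hg).restrictScalars A
    refine of_extend (ses_of_surjective hg) (of_projective 0) fun φ => ?_
    obtain ⟨ψ, hψ⟩ := exists_extend hSA hN (ε ∘ₗ φ.restrictScalars A)
    obtain ⟨χ, hχ⟩ := hU _ ψ
    refine ⟨χ, ?_⟩
    ext t
    apply hε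
    simp only [LinearMap.comp_apply, hχ]
    exact LinearMap.congr_fun hψ t
  | succ i ih =>
    intro N _ _ _ _ hN
    let g : (N →₀ B) →ₗ[B] N := Finsupp.linearCombination B id
    have hg : Function.Surjective g := Finsupp.linearCombination_id_surjective B N
    have hSA := (ses_of_surjective hg).restrictScalars A
    exact quot_left (ses_of_surjective hg) (ih _ (sub_left hSA (ExtVanish.finsupp _ _ _ (hB i)) hN))
      (of_projective _)

theorem ExtVanish.change_bijective (hs : Function.Bijective (algebraMap A B)) (i : ℕ) 
    (N : Type) [AddCommGroup N] [Module A N] [Module B N] [IsScalarTower A B N]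
    (h : ExtVanish A N D (i + 1)) : ExtVanish B N D (i + 1) := by
  refine ExtVanish.change (A := A) LinearMap.id Function.injective_id (fun N _ _ _ _ f =>
    ⟨upgrade hs.2 f, fun n => rfl⟩) (fun i => ?_) i N h
  exact ExtVanish.congr_left (LinearEquiv.ofBijective (Algebra.linearMap A B) hs)
    (ExtVanish.of_projective i)
end change

/-- `RegChain K n I`: the ideal `I` is generated by a regular sequence of length `n` of elements
of `K`. -/
inductive RegChain {S : Type} [CommRing S] (K : Set S) : ℕ → Ideal S → Prop
  | nil : RegChain K 0 ⊥
  | snoc {n : ℕ} {I : Ideal S} (hI : RegChain K n I) (h : S) (hK : h ∈ K)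
      (hreg : ∀ y, h * y ∈ I → y ∈ I) : RegChain K (n + 1) (I ⊔ Ideal.span {h})

theorem RegChain.mono {S : Type} [CommRing S] {K K' : Set S} (hK : K ⊆ K') {n : ℕ} {I : Ideal S}
    (h : RegChain K n I) : RegChain K' n I := by
  induction h with
  | nil => exact .nil
  | snoc hI h hh hreg ih => exact .snoc ih h (hK hh) hreg

theorem RegChain.extVanish {S : Type} [CommRing S] {K : Set S} {n : ℕ} {I : Ideal S}
    (hI : RegChain K n I) : ∀ (A : Type) [CommRing A] [Algebra S A],
    Function.Surjective (algebraMap S A) → RingHom.ker (algebraMap S A) = I →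
    ∀ (N : Type) [AddCommGroup N] [Module S N] [Module A N] [IsScalarTower S A N] (i : ℕ),
      ExtVanish S N S (i + n + 1) → ExtVanish A N A (i + 1) := by
  induction hI with
  | nil =>
    intro A _ _ hs hk N _ _ _ _ i h
    have hb : Function.Bijective (algebraMap S A) :=
      ⟨(RingHom.injective_iff_ker_eq_bot _).2 hk, hs⟩
    refine ExtVanish.change_bijective hb i N ?_
    exact h.congr_right (LinearEquiv.ofBijective (Algebra.linearMap S A) hb)
  | @snoc n I hI h hh hreg ih =>
    intro A _ _ hs hk N _ _ _ _ i hN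
    let l : S ⧸ I →+* A := Ideal.Quotient.lift I (algebraMap S A) fun a ha => by
      rw [← RingHom.mem_ker, hk]; exact Ideal.mem_sup_left ha
    let _ : Algebra (S ⧸ I) A := l.toAlgebra
    let _ : Module (S ⧸ I) N := Module.compHom N l
    have hsc : IsScalarTower (S ⧸ I) A N := ⟨fun x y z => by
      rw [Algebra.smul_def, mul_smul]; rfl⟩
    have hsc' : IsScalarTower S (S ⧸ I) N := ⟨fun x y z => by
      rw [Algebra.smul_def, mul_smul]
      change algebraMap S A x • (y • z) = _
      rw [algebraMap_smul]⟩
    refine ExtVanish.of_quotient_regular (A := S ⧸ I) (x := Ideal.Quotient.mk I h) ?_ ?_ ?_ i N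
      (ih (S ⧸ I) Ideal.Quotient.mk_surjective (Ideal.mk_ker) N (i + 1) ?_)
    · intro a
      obtain ⟨s, rfl⟩ := hs a
      exact ⟨Ideal.Quotient.mk I s, rfl⟩
    · ext z
      obtain ⟨z, rfl⟩ := Ideal.Quotient.mk_surjective z
      have h1 : Ideal.Quotient.mk I z ∈ RingHom.ker (algebraMap (S ⧸ I) A) ↔
        z ∈ RingHom.ker (algebraMap S A) := Iff.rfl
      rw [h1, hk, ← Set.image_singleton, ← Ideal.map_span, ← Ideal.mem_comap,
        Ideal.comap_map_of_surjective _ Ideal.Quotient.mk_surjective, ← RingHom.ker_eq_comap_bot,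
        Ideal.mk_ker, sup_comm]
    · intro z
      obtain ⟨z, rfl⟩ := Ideal.Quotient.mk_surjective z
      rw [← map_mul, Ideal.Quotient.eq_zero_iff_mem, Ideal.Quotient.eq_zero_iff_mem]
      exact hreg z
    · convert hN using 1; ring

theorem FID.of_regChain {S : Type} [CommRing S] {K : Set S} {n : ℕ} {I : Ideal S}
    (hI : RegChain K n I) (hS : FID S S) (A : Type) [CommRing A] [Algebra S A]
    (hs : Function.Surjective (algebraMap S A)) (hk : RingHom.ker (algebraMap S A) = I) :
    FID A A := by
  obtain ⟨d, hd⟩ := hS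
  refine ⟨d, fun N _ _ i hi => ?_⟩
  obtain ⟨i, rfl⟩ := Nat.exists_eq_add_of_lt hi
  let _ : Module S N := Module.compHom N (algebraMap S A)
  have : IsScalarTower S A N := ⟨fun x y z => by rw [Algebra.smul_def, mul_smul]; rfl⟩
  exact hI.extVanish A hs hk N _ (hd N _ (by omega))

end Semidual

end

section

namespace Semidual
open Abelian TensorProduct

/-- Coinduced module along a surjection. -/
theorem exists_coinduced (A R X : Type) [CommRing A] [CommRing R] [Algebra A R] [AddCommGroup X]
    [Module A X] (hs : Function.Surjective (algebraMap A R)) :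
    ∃ (D : Type) (_ : AddCommGroup D) (_ : Module A D) (_ : Module R D)
      (_ : IsScalarTower A R D) (ε : D →ₗ[A] X), Function.Injective ε ∧
      ∀ (N : Type) [AddCommGroup N] [Module A N] [Module R N] [IsScalarTower A R N]
        (f : N →ₗ[A] X), ∃ g : N →ₗ[R] D, ∀ n, ε (g n) = f n := by
  let I := RingHom.ker (algebraMap A R)
  let D := Submodule.torsionBySet A X (I : Set A)
  let e : (A ⧸ I) ≃+* R := RingHom.quotientKerEquivOfSurjective hs
  have ht : Module.IsTorsionBySet A D (I : Set A) := Submodule.torsionBySet_isTorsionBySet _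
  let _ : Module (A ⧸ I) D := ht.module
  let _ : Module R D := Module.compHom D (e.symm : R →+* A ⧸ I)
  have hsm : ∀ (a : A) (d : D), algebraMap A R a • d = a • d := by
    intro a d
    change e.symm (algebraMap A R a) • d = a • d
    have : e (Ideal.Quotient.mk I a) = algebraMap A R a := rfl
    rw [← this, RingEquiv.symm_apply_apply]
    rfl
  have hT : IsScalarTower A R D := ⟨fun a r d => by
    rw [Algebra.smul_def, mul_smul, hsm]⟩
  refine ⟨D, inferInstance, inferInstance, inferInstance, hT, D.subtype,
    Subtype.val_injective, ?_⟩
  intro N _ _ _ _ f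
  have hf : ∀ n, f n ∈ D := fun n => by
    rw [Submodule.mem_torsionBySet_iff]
    rintro ⟨a, ha⟩
    change a • f n = 0
    rw [← map_smul, ← algebraMap_smul R a n, show algebraMap A R a = 0 from ha, zero_smul, map_zero]
  exact ⟨upgrade hs (f.codRestrict D hf), fun n => rfl⟩

variable {S R : Type} [CommRing S] [IsNoetherianRing S] [CommRing R] [Algebra S R]

theorem exists_canonical_aux {A : Type} [CommRing A] [IsNoetherianRing A] [Algebra A R]
    (hA : FID A A) (hs : Function.Surjective (algebraMap A R))
    (hR : ∀ i, 0 < i → ExtVanish A R A i) :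
    ∃ (D : Type) (_ : AddCommGroup D) (_ : Module R D), IsSD R D ∧ FID R D ∧
      ∀ (N : Type) [AddCommGroup N] [Module A N] [Module R N] [IsScalarTower A R N] (i : ℕ),
        ExtVanish A N A (i + 1) → ExtVanish R N D (i + 1) := by
  obtain ⟨D, _, _, _, _, ε, hε, hU⟩ := exists_coinduced A R A hs
  have hch : ∀ (N : Type) [AddCommGroup N] [Module A N] [Module R N] [IsScalarTower A R N] (i : ℕ),
        ExtVanish A N A (i + 1) → ExtVanish R N D (i + 1) := fun N _ _ _ _ i h =>
    ExtVanish.change ε hε hU (fun i => hR _ i.succ_pos) i N h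
  have : Module.Finite A R := Module.Finite.of_surjective (Algebra.linearMap A R) hs
  -- `D ≅ Hom_A(R, A)`
  let τ : (R →ₗ[A] A) →ₗ[A] A := LinearMap.applyₗ (1 : R)
  choose G hG using fun f : R →ₗ[A] A => hU R f
  let e : (R →ₗ[A] A) →ₗ[A] D :=
    { toFun := fun f => G f 1
      map_add' := fun f g => hε (by simp [hG])
      map_smul' := fun a f => hε (by simp [hG]) }
  have he : ∀ f, ε (e f) = f 1 := fun f => hG f 1
  have hbij : Function.Bijective e := by
    constructor
    · rw [injective_iff_map_eq_zero]
      intro f hf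
      have h1 : f 1 = 0 := by rw [← he, hf, map_zero]
      ext r
      obtain ⟨a, rfl⟩ := hs r
      rw [Algebra.algebraMap_eq_smul_one, map_smul, h1, smul_zero]; rfl
    · intro d
      refine ⟨ε ∘ₗ (LinearMap.toSpanSingleton R D d).restrictScalars A, hε ?_⟩
      rw [he]; simp
  let E : (R →ₗ[A] A) ≃ₗ[A] D := LinearEquiv.ofBijective e hbij
  have hDA : Module.Finite A D := Module.Finite.equiv E
  have hDR : Module.Finite R D := Module.Finite.of_restrictScalars_finite A R D
  have hDv : ∀ i, 0 < i → ExtVanish A D A i := fun i hi =>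
    (ExtVanish.dual hA hR i hi).congr_left E
  refine ⟨D, inferInstance, inferInstance, ⟨hDR, ?_, ?_⟩, ?_, hch⟩
  · have hb := dual_eval_bijective hA hR
    constructor
    · rw [injective_iff_map_eq_zero]
      intro r hr
      have : Module.Dual.eval A R r = 0 := by
        ext f
        have h1 := congrArg ε (LinearMap.congr_fun hr (e f))
        obtain ⟨a, rfl⟩ := hs r
        rw [Module.algebraMap_end_apply, algebraMap_smul, map_smul, he] at h1
        rw [Module.Dual.eval_apply, Algebra.algebraMap_eq_smul_one, map_smul, h1]
        simp
      exact hb.1 (by rw [this, map_zero])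
    · intro φ
      obtain ⟨r, hr⟩ := hb.2 (ε ∘ₗ φ.restrictScalars A ∘ₗ e)
      obtain ⟨a, rfl⟩ := hs r
      refine ⟨algebraMap A R a, ?_⟩
      ext d
      obtain ⟨f, rfl⟩ := hbij.2 d
      apply hε
      have h1 := LinearMap.congr_fun hr f
      rw [Module.algebraMap_end_apply, algebraMap_smul, map_smul, he]
      rw [Module.Dual.eval_apply, Algebra.algebraMap_eq_smul_one, map_smul] at h1
      exact h1
  · intro i hi
    obtain ⟨i, rfl⟩ := Nat.exists_eq_succ_of_ne_zero hi.ne'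
    exact hch D i (hDv _ hi)
  · obtain ⟨d, hd⟩ := hA
    refine ⟨d, fun N _ _ i hi => ?_⟩
    obtain ⟨i, rfl⟩ := Nat.exists_eq_add_of_lt hi
    let _ : Module A N := Module.compHom N (algebraMap A R)
    have : IsScalarTower A R N := ⟨fun x y z => by rw [Algebra.smul_def, mul_smul]; rfl⟩
    exact hch N _ (hd N _ (by omega))

/-- Existence of a dualizing module over a quotient `R` of `S` whose kernel contains a regular
sequence of length `c` and with `Ext_S^i(R, S) = 0` for `i > c`. -/
theorem exists_canonical {K : Set S} {c : ℕ} {I : Ideal S} (hS : FID S S) (hI : RegChain K c I)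
    (hs : Function.Surjective (algebraMap S R)) (hk : I ≤ RingHom.ker (algebraMap S R))
    (hR : ∀ i, c < i → ExtVanish S R S i) :
    ∃ (D : Type) (_ : AddCommGroup D) (_ : Module R D), IsSD R D ∧ FID R D ∧
      ∀ (N : Type) [AddCommGroup N] [Module S N] [Module R N] [IsScalarTower S R N] (i : ℕ),
        ExtVanish S N S (i + c + 1) → ExtVanish R N D (i + 1) := by
  have hv := hI.extVanish (S ⧸ I) Ideal.Quotient.mk_surjective Ideal.mk_ker
  let l : S ⧸ I →+* R := Ideal.Quotient.lift I (algebraMap S R) fun a ha => hk ha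
  let _ : Algebra (S ⧸ I) R := l.toAlgebra
  have : IsScalarTower S (S ⧸ I) R := IsScalarTower.of_algebraMap_eq fun x => rfl
  have hl : Function.Surjective (algebraMap (S ⧸ I) R) := fun r => by
    obtain ⟨s, rfl⟩ := hs r
    exact ⟨Ideal.Quotient.mk I s, rfl⟩
  obtain ⟨D, _, _, h1, h2, h3⟩ := exists_canonical_aux
    (FID.of_regChain hI hS (S ⧸ I) Ideal.Quotient.mk_surjective Ideal.mk_ker) hl
    (fun i hi => by
      obtain ⟨i, rfl⟩ := Nat.exists_eq_succ_of_ne_zero hi.ne'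
      exact hv R i (hR _ (by omega)))
  refine ⟨D, _, _, h1, h2, fun N _ _ _ _ i hN => ?_⟩
  let _ : Module (S ⧸ I) N := Module.compHom N l
  have hsc : IsScalarTower (S ⧸ I) R N := ⟨fun x y z => by
    rw [Algebra.smul_def, mul_smul]; rfl⟩
  have hsc' : IsScalarTower S (S ⧸ I) N := ⟨fun x y z => by
    rw [Algebra.smul_def, mul_smul]
    change algebraMap S R x • (y • z) = _
    rw [algebraMap_smul]⟩
  exact h3 N i (hv N i hN)

end Semidual

end

section

namespace Semidual
open Abelian TensorProduct Polynomial

theorem projective_of_extVanish {A P : Type} [CommRing A] [AddCommGroup P] [Module A P]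
    (h : ∀ (X : Type) [AddCommGroup X] [Module A X], ExtVanish A P X 1) : Module.Projective A P := by
  refine Module.Projective.of_lifting_property'' fun f hf => ?_
  exact ExtVanish.exists_lift (ses_of_surjective hf) (h _) LinearMap.id

section poly
variable {A P M : Type} [CommRing A] [AddCommGroup P] [Module A P] [AddCommGroup M] [Module A M]
    [Module A[X] M] [IsScalarTower A A[X] M]

/-- The extension of an `A`-linear map `P → M` to `P[X]`, for an `A[X]`-module `M`. -/
noncomputable def polyLift (h : P →ₗ[A] M) : PolynomialModule A P →ₗ[A[X]] M where
  toFun q := PolynomialModule.eval (X : A[X]) (PolynomialModule.map A[X] h q)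
  map_add' := by simp
  map_smul' p q := by
    rw [PolynomialModule.map_smul, PolynomialModule.eval_smul, Polynomial.eval_map_algebraMap,
      Polynomial.aeval_X_left, RingHom.id_apply]
    rfl

@[simp] theorem polyLift_single (h : P →ₗ[A] M) (i : ℕ) (p : P) :
    polyLift h (PolynomialModule.single A i p) = (X : A[X]) ^ i • h p := by
  simp [polyLift]

omit [Module A M] [IsScalarTower A A[X] M] in
theorem polyModule_hom_ext {f g : PolynomialModule A P →ₗ[A[X]] M}
    (h : ∀ p, f (PolynomialModule.single A 0 p) = g (PolynomialModule.single A 0 p)) : f = g := by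
  ext q
  induction q using PolynomialModule.induction_linear with
  | zero => simp
  | add p q hp hq => rw [map_add, map_add, hp, hq]
  | single i p =>
    have : PolynomialModule.single A i p =
        (monomial i (1 : A)) • PolynomialModule.single A 0 p := by simp
    rw [this, map_smul, map_smul, h]

instance polyModule_projective [Module.Projective A P] :
    Module.Projective A[X] (PolynomialModule A P) := by
  refine Module.Projective.of_lifting_property'' fun f hf => ?_
  obtain ⟨h, hh⟩ := Module.projective_lifting_property (f.restrictScalars A)
    (PolynomialModule.lsingle A 0 : P →ₗ[A] PolynomialModule A P) hf
  refine ⟨polyLift h, polyModule_hom_ext fun p => ?_⟩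
  have := LinearMap.congr_fun hh p
  rw [LinearMap.comp_apply, polyLift_single, pow_zero, one_smul]
  exact this

/-- The map `X - x` on `N[X]`. -/
noncomputable def charMap (A N : Type) [CommRing A] [AddCommGroup N] [Module A N] [Module A[X] N]
    [IsScalarTower A A[X] N] : PolynomialModule A N →ₗ[A[X]] PolynomialModule A N :=
  polyLift (PolynomialModule.lsingle A 1 -
    PolynomialModule.lsingle A 0 ∘ₗ (LinearMap.lsmul A[X] N X).restrictScalars A)

theorem charMap_single (i : ℕ) (m : M) : charMap A M (PolynomialModule.single A i m) =
    PolynomialModule.single A (i + 1) m - PolynomialModule.single A i ((X : A[X]) • m) := by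
  rw [charMap, polyLift_single, ← monomial_one_right_eq_X_pow]
  simp only [LinearMap.sub_apply, LinearMap.comp_apply, smul_sub]
  congr 1
  · exact (PolynomialModule.monomial_smul_single ..).trans (by rw [one_smul])
  · exact (PolynomialModule.monomial_smul_single ..).trans (by rw [one_smul]; rfl)

theorem charMap_coeff (q : PolynomialModule A M) (n : ℕ) :
    (charMap A M q).coeff (n + 1) = q.coeff n - (X : A[X]) • q.coeff (n + 1) := by
  induction q using PolynomialModule.induction_linear with
  | zero => simp
  | add p q hp hq =>
    simp only [map_add, PolynomialModule.coeff_add, Finsupp.add_apply, hp, hq, smul_add]; abel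
  | single i m =>
    rw [charMap_single]
    have : ∀ p q : PolynomialModule A M, (p - q).coeff = p.coeff - q.coeff := fun p q => rfl
    rw [this, Finsupp.sub_apply]
    simp [Finsupp.single_apply]

theorem ses_charMap : SES (charMap A M) (polyLift (LinearMap.id : M →ₗ[A] M)) where
  inj := by
    rw [injective_iff_map_eq_zero]
    intro q hq
    have h1 : ∀ n, q.coeff n = (X : A[X]) • q.coeff (n + 1) := fun n => by
      rw [← sub_eq_zero, ← charMap_coeff, hq]; rfl
    have h2 : ∀ j n, q.coeff n = (X : A[X]) ^ j • q.coeff (n + j) := fun j => by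
      induction j with
      | zero => simp
      | succ j ih => intro n; rw [ih, h1, ← mul_smul, ← pow_succ]; rfl
    obtain ⟨B, hB⟩ : ∃ B, ∀ n, B ≤ n → q.coeff n = 0 := by
      refine ⟨q.coeff.support.sup id + 1, fun n hn => ?_⟩
      by_contra h
      have := Finset.le_sup (f := id) (Finsupp.mem_support_iff.2 h)
      simp only [id] at this
      omega
    rw [← PolynomialModule.coeff_eq_zero]
    ext n
    rw [h2 B n, hB _ (by omega), smul_zero]; rfl
  exact := by
    have hz : ∀ q, polyLift (LinearMap.id : M →ₗ[A] M) (charMap A M q) = 0 := fun q => by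
      have : polyLift (LinearMap.id : M →ₗ[A] M) ∘ₗ charMap A M = 0 :=
        polyModule_hom_ext fun p => by simp [charMap_single]
      exact LinearMap.congr_fun this q
    have hs : ∀ i m, ∃ w, PolynomialModule.single A i m =
        PolynomialModule.single A 0 ((X : A[X]) ^ i • m) + charMap A M w := by
      intro i
      induction i with
      | zero => exact fun m => ⟨0, by simp⟩
      | succ i ih =>
        intro m
        obtain ⟨w, hw⟩ := ih ((X : A[X]) • m)
        refine ⟨w + PolynomialModule.single A i m, ?_⟩
        rw [map_add, charMap_single, ← add_assoc, pow_succ, mul_smul, ← hw]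
        abel
    have hq : ∀ q, ∃ w, q = PolynomialModule.single A 0 (polyLift (LinearMap.id : M →ₗ[A] M) q)
        + charMap A M w := by
      intro q
      induction q using PolynomialModule.induction_linear with
      | zero => exact ⟨0, by simp⟩
      | add p q hp hq =>
        obtain ⟨w, hw⟩ := hp
        obtain ⟨v, hv⟩ := hq
        refine ⟨w + v, ?_⟩
        conv_lhs => rw [hw, hv]
        rw [map_add, map_add, PolynomialModule.single_add]; abel
      | single i m => obtain ⟨w, hw⟩ := hs i m; exact ⟨w, by simpa using hw⟩
    intro q
    refine ⟨fun h => ?_, ?_⟩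
    · obtain ⟨w, hw⟩ := hq q
      exact ⟨w, by conv_rhs => rw [hw, h]
                   simp⟩
    · rintro ⟨w, rfl⟩; exact hz w
  surj := fun m => ⟨PolynomialModule.single A 0 m, by simp⟩

theorem ExtVanish.polynomial (d : ℕ) : ∀ (N : Type) [AddCommGroup N] [Module A N] [Module A[X] N]
    [IsScalarTower A A[X] N],
    (∀ (Y : Type) [AddCommGroup Y] [Module A Y], ExtVanish A N Y (d + 1)) →
    ∀ (Y : Type) [AddCommGroup Y] [Module A[X] Y] (i : ℕ), ExtVanish A[X] N Y (i + d + 2) := by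
  induction d with
  | zero =>
    intro N _ _ _ _ h Y _ _ i
    have := projective_of_extVanish h
    exact quot_left (ses_charMap (A := A) (M := N)) (of_projective _) (of_projective _)
  | succ d ih =>
    intro N _ _ _ _ h Y _ _ i
    let g : (N →₀ A[X]) →ₗ[A[X]] N := Finsupp.linearCombination A[X] id
    have hg : Function.Surjective g := Finsupp.linearCombination_id_surjective A[X] N
    have hSA := (ses_of_surjective hg).restrictScalars A
    refine quot_left (ses_of_surjective hg) (ih _ (fun Y _ _ => ?_) Y i) (of_projective _)
    exact sub_left hSA (of_projective _) (h Y)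
end poly

/-- Every Ext over `A` vanishes above degree `d`. -/
def GlDim (A : Type) [CommRing A] (d : ℕ) : Prop :=
  ∀ (N Y : Type) [AddCommGroup N] [Module A N] [AddCommGroup Y] [Module A Y] (i : ℕ),
    d < i → ExtVanish A N Y i

theorem GlDim.polynomial {A : Type} [CommRing A] {d : ℕ} (h : GlDim A d) : GlDim A[X] (d + 1) := by
  intro N Y _ _ _ _ i hi
  obtain ⟨i, rfl⟩ := Nat.exists_eq_add_of_lt hi
  let _ : Module A N := Module.compHom N (algebraMap A A[X])
  have : IsScalarTower A A[X] N := ⟨fun x y z => by rw [Algebra.smul_def, mul_smul]; rfl⟩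
  have := ExtVanish.polynomial (A := A) d N (fun Y _ _ => h N Y _ (by omega)) Y i
  convert this using 1; omega

theorem GlDim.of_ringEquiv {A B : Type} [CommRing A] [CommRing B] (e : A ≃+* B) {d : ℕ}
    (h : GlDim A d) : GlDim B d := by
  intro N Y _ _ _ _ i hi
  obtain ⟨i, rfl⟩ := Nat.exists_eq_add_of_lt hi
  let _ : Algebra A B := (e : A →+* B).toAlgebra
  let _ : Module A N := Module.compHom N (algebraMap A B)
  let _ : Module A Y := Module.compHom Y (algebraMap A B)
  have : IsScalarTower A B N := ⟨fun x y z => by rw [Algebra.smul_def, mul_smul]; rfl⟩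
  have : IsScalarTower A B Y := ⟨fun x y z => by rw [Algebra.smul_def, mul_smul]; rfl⟩
  exact ExtVanish.change_bijective (A := A) e.bijective _ N (h N Y _ (by omega))

theorem GlDim.field (k : Type) [Field k] : GlDim k 0 := by
  intro N Y _ _ _ _ i hi
  obtain ⟨i, rfl⟩ := Nat.exists_eq_succ_of_ne_zero hi.ne'
  exact ExtVanish.of_projective i

theorem exists_glDim_mvPolynomial (k σ : Type) [Field k] [Finite σ] :
    ∃ d, GlDim (MvPolynomial σ k) d := by
  have h : ∀ n, GlDim (MvPolynomial (Fin n) k) n := by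
    intro n
    induction n with
    | zero => exact (GlDim.field k).of_ringEquiv (MvPolynomial.isEmptyRingEquiv k (Fin 0)).symm
    | succ n ih => exact ih.polynomial.of_ringEquiv (MvPolynomial.finSuccEquiv k n).symm.toRingEquiv
  obtain ⟨n, ⟨e⟩⟩ := Finite.exists_equiv_fin σ
  exact ⟨n, (h n).of_ringEquiv (MvPolynomial.renameEquiv k e.symm).toRingEquiv⟩

theorem GlDim.fid {A : Type} [CommRing A] {d : ℕ} (h : GlDim A d) (E : Type) [AddCommGroup E]
    [Module A E] : FID A E := ⟨d, fun N _ _ i hi => h N E i hi⟩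

end Semidual

end

section

namespace Semidual
open Abelian TensorProduct Polynomial

theorem ExtVanish.of_sum_right {R M N E : Type} [CommRing R] [AddCommGroup M] [Module R M]
    [AddCommGroup N] [Module R N] [AddCommGroup E] [Module R E] {ι : Type} [Fintype ι]
    (a : ι → M →ₗ[R] N) (b : ι → N →ₗ[R] M)
    (hab : ∑ j, b j ∘ₗ a j = LinearMap.id) {i : ℕ} (h : ExtVanish R E N i) :
    ExtVanish R E M i := by
  refine subsingleton_of_forall_eq 0 fun x => ?_
  have h1 : ∑ j, ModuleCat.ofHom (a j) ≫ ModuleCat.ofHom (b j) = 𝟙 (ModuleCat.of R M) := by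
    ext1
    rw [← ModuleCat.ofHom_id, ← hab]
    simp
  rw [← Ext.comp_mk₀_id x, ← h1, Ext.mk₀_sum, Ext.comp_sum]
  refine Finset.sum_eq_zero fun j _ => ?_
  have h2 := h.zero (x.comp (Ext.mk₀ (ModuleCat.ofHom (a j))) (add_zero i))
  rw [← Ext.mk₀_comp_mk₀, ← Ext.comp_assoc_of_third_deg_zero, h2, Ext.zero_comp]

/-- Projective dimension at most `p`. -/
def PdLE (S X : Type) [CommRing S] [AddCommGroup X] [Module S X] (p : ℕ) : Prop :=
  ∀ (Y : Type) [AddCommGroup Y] [Module S Y] (i : ℕ), p < i → ExtVanish S X Y i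

section
variable {S : Type} [CommRing S]
variable {A B C M X : Type} [AddCommGroup A] [Module S A] [AddCommGroup B] [Module S B]
    [AddCommGroup C] [Module S C] [AddCommGroup M] [Module S M] [AddCommGroup X] [Module S X]

theorem PdLE.mono {p q : ℕ} (h : PdLE S X p) (hpq : p ≤ q) : PdLE S X q :=
  fun Y _ _ i hi => h Y i (by omega)

theorem PdLE.congr {p : ℕ} (e : A ≃ₗ[S] B) (h : PdLE S A p) : PdLE S B p :=
  fun Y _ _ i hi => (h Y i hi).congr_left e

theorem PdLE.of_projective [Module.Projective S X] (p : ℕ) : PdLE S X p := by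
  intro Y _ _ i hi
  obtain ⟨i, rfl⟩ := Nat.exists_eq_add_of_lt hi
  exact ExtVanish.of_projective _

theorem PdLE.of_subsingleton [Subsingleton X] (p : ℕ) : PdLE S X p :=
  fun _ _ _ i _ => ExtVanish.subsingleton_left i

theorem PdLE.quot {f : A →ₗ[S] B} {g : B →ₗ[S] C} (h : SES f g) {p : ℕ} (hA : PdLE S A p)
    (hB : PdLE S B (p + 1)) : PdLE S C (p + 1) := by
  intro Y _ _ i hi
  obtain ⟨i, rfl⟩ := Nat.exists_eq_add_of_lt hi
  exact ExtVanish.quot_left h (hA Y _ (by omega)) (hB Y _ (by omega))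

theorem PdLE.sub {f : A →ₗ[S] B} {g : B →ₗ[S] C} (h : SES f g) {p : ℕ} (hC : PdLE S C (p + 1))
    (hB : PdLE S B p) : PdLE S A p :=
  fun Y _ _ i hi => ExtVanish.sub_left h (hB Y i hi) (hC Y _ (by omega))

theorem ExtVanish.of_pdLE [IsNoetherianRing S] {g : ℕ} (hM : ∀ j < g, ExtVanish S M S j) (p : ℕ) :
    ∀ (X : Type) [AddCommGroup X] [Module S X] [Module.Finite S X], PdLE S X p →
      ∀ j, j + p < g → ExtVanish S M X j := by
  induction p with
  | zero =>
    intro X _ _ _ hX j hj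
    have := projective_of_extVanish (fun Y _ _ => hX Y 1 one_pos)
    obtain ⟨n, f, hf, _⟩ := exists_free_cover S X
    obtain ⟨s, hs⟩ := Module.projective_lifting_property f LinearMap.id hf
    refine ExtVanish.of_sum_right (ι := Fin n) (fun i => LinearMap.proj i ∘ₗ s)
      (fun i => LinearMap.toSpanSingleton S X (f (Pi.single i 1))) ?_ (hM j (by omega))
    ext x
    conv_rhs => rw [← hs]
    simp only [LinearMap.sum_apply, LinearMap.comp_apply, LinearMap.toSpanSingleton_apply,
      LinearMap.proj_apply]
    simp_rw [← map_smul, ← map_sum]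
    congr 1
    ext i
    simp [Finset.sum_apply, Pi.single_apply]
  | succ p ih =>
    intro X _ _ _ hX j hj
    obtain ⟨n, f, hf, _⟩ := exists_free_cover S X
    have hK := PdLE.sub (ses_of_surjective hf) hX (PdLE.of_projective p)
    exact ExtVanish.quot_right (ses_of_surjective hf)
      (ih _ (PdLE.of_projective p) j (by omega)) (ih _ hK (j + 1) (by omega))

/-- Grade of `J` at least `c`. -/
def Gr (J : Ideal S) (c : ℕ) : Prop := ∀ j < c, ExtVanish S (S ⧸ J) S j

theorem SES.quotient_mul {I : Ideal S} {h : S} (hreg : ∀ y, h * y ∈ I → y ∈ I) :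
    SES (LinearMap.lsmul S (S ⧸ I) h) (Submodule.factor (p := I) (p' := I ⊔ Ideal.span {h})
      le_sup_left) where
  inj := by
    rw [injective_iff_map_eq_zero]
    intro y
    obtain ⟨y, rfl⟩ := Ideal.Quotient.mk_surjective y
    intro hy
    have : Ideal.Quotient.mk I (h * y) = 0 := hy
    exact Ideal.Quotient.eq_zero_iff_mem.2 (hreg _ (Ideal.Quotient.eq_zero_iff_mem.1 this))
  exact := by
    intro y
    obtain ⟨y, rfl⟩ := Ideal.Quotient.mk_surjective y
    have h1 : Submodule.factor (p := I) (p' := I ⊔ Ideal.span {h}) le_sup_left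
      (Ideal.Quotient.mk I y) = Ideal.Quotient.mk (I ⊔ Ideal.span {h}) y := rfl
    rw [h1, Ideal.Quotient.eq_zero_iff_mem, Submodule.mem_sup]
    constructor
    · rintro ⟨a, ha, b, hb, rfl⟩
      obtain ⟨c, rfl⟩ := Ideal.mem_span_singleton.1 hb
      refine ⟨Ideal.Quotient.mk I c, ?_⟩
      change Ideal.Quotient.mk I (h * c) = _
      rw [map_add, Ideal.Quotient.eq_zero_iff_mem.2 ha, zero_add]
    · rintro ⟨c, hc⟩
      obtain ⟨c, rfl⟩ := Ideal.Quotient.mk_surjective c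
      have hc : Ideal.Quotient.mk I (h * c) = Ideal.Quotient.mk I y := hc
      rw [Ideal.Quotient.eq] at hc
      exact ⟨y - h * c, by simpa using I.neg_mem hc, h * c,
        Ideal.mul_mem_right _ _ (Ideal.mem_span_singleton_self h), by ring⟩
  surj := Submodule.factor_surjective _

theorem RegChain.pdLE {K : Set S} {n : ℕ} {I : Ideal S} (hI : RegChain K n I) :
    PdLE S (S ⧸ I) n := by
  induction hI with
  | nil => exact PdLE.congr (Submodule.quotEquivOfEqBot _ rfl).symm (PdLE.of_projective 0)
  | snoc hI h hh hreg ih => exact PdLE.quot (SES.quotient_mul hreg) ih (ih.mono (by omega))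

theorem RegChain.extVanish_base {K : Set S} {n : ℕ} {I : Ideal S} (hI : RegChain K n I) : ∀ (d : ℕ),
    (∀ a ∈ I, ∀ m : M, a • m = 0) → (∀ j < d, ExtVanish S M (S ⧸ I) j) →
    ∀ j < n + d, ExtVanish S M S j := by
  induction hI with
  | nil =>
    intro d _ h j hj
    exact (h j (by omega)).congr_right (Submodule.quotEquivOfEqBot _ rfl)
  | @snoc n I hI h hh hreg ih =>
    intro d hM hd j hj
    refine ih (d + 1) (fun a ha => hM a (Ideal.mem_sup_left ha)) (fun j hj => ?_) j (by omega)
    have hhM : ∀ m : M, h • m = 0 :=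
      hM h (Ideal.mem_sup_right (Ideal.mem_span_singleton_self h))
    have hs := SES.quotient_mul hreg
    refine subsingleton_of_forall_eq 0 fun x => ?_
    have hx : x.comp (Ext.mk₀ hs.sc.f) (add_zero j) = 0 := by
      rw [show hs.sc.f = h • 𝟙 (ModuleCat.of S (S ⧸ I)) from by ext; rfl,
        ← Ext.smul_eq_comp_mk₀]
      exact ExtVanish.smul_left h hhM x
    cases j with
    | zero =>
      obtain ⟨w, rfl⟩ := (Ext.mk₀_bijective _ _).2 x
      rw [Ext.mk₀_comp_mk₀, Ext.mk₀_eq_zero_iff] at hx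
      rw [Ext.mk₀_eq_zero_iff]
      ext m
      exact hs.inj ((LinearMap.congr_fun (congrArg ModuleCat.Hom.hom hx) m).trans (map_zero _).symm)
    | succ j =>
      obtain ⟨w, rfl⟩ := Ext.covariant_sequence_exact₁ _ hs.sc_exact x hx rfl
      rw [(hd j (by omega)).zero w, Ext.zero_comp]

theorem RegChain.gr {K : Set S} {n : ℕ} {I J : Ideal S} (hI : RegChain K n I) (h : I ≤ J) :
    Gr J n := fun j hj => hI.extVanish_base 0 (fun a ha m => by
      obtain ⟨m, rfl⟩ := Ideal.Quotient.mk_surjective m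
      change Ideal.Quotient.mk J (a * m) = 0
      exact Ideal.Quotient.eq_zero_iff_mem.2 (J.mul_mem_right _ (h ha))) (by simp) j (by omega)

theorem Gr.extVanish [Module.Finite S M] [IsNoetherianRing S] {K : Set S} {n : ℕ} {I : Ideal S}
    (hI : RegChain K n I) (hM : ∀ a ∈ I, ∀ m : M, a • m = 0) (j : ℕ) (hj : j < n) :
    ExtVanish S M S j := hI.extVanish_base 0 hM (by simp) j (by omega)

/-- Prime avoidance with elements taken from a subring. -/
theorem exists_regular_mem [IsNoetherianRing S] [Module.Finite S X] (K : Subring S) (N : Ideal S)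
    (hN : N ≤ Ideal.span (N ∩ K : Set S)) (h0 : ∀ x : X, (∀ a ∈ N, a • x = 0) → x = 0) :
    ∃ h ∈ N, h ∈ K ∧ ∀ x : X, h • x = 0 → x = 0 := by
  by_contra! hcon
  have hsub : ((N.comap K.subtype : Ideal K) : Set K) ⊆
      ⋃ P ∈ associatedPrimes S X, ((P.comap K.subtype : Ideal K) : Set K) := by
    intro a ha
    obtain ⟨x, hx, hx0⟩ := hcon a ha a.2
    have : (a : S) ∈ ⋃ p ∈ associatedPrimes S X, (p : Set S) := by
      rw [biUnion_associatedPrimes_eq_zero_divisors]; exact ⟨x, hx0, hx⟩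
    simpa using this
  obtain ⟨P, hP, hle⟩ := (Ideal.subset_union_prime_finite (associatedPrimes.finite S X)
    (f := fun P => P.comap K.subtype) 0 0 (fun P hP _ _ =>
      haveI := IsAssociatedPrime.isPrime hP
      Ideal.comap_isPrime _ _)).1 hsub
  obtain ⟨hPp, x, hx⟩ := isAssociatedPrime_iff.1 hP
  have hNP : N ≤ P := hN.trans (Ideal.span_le.2 fun a ha => by
    have : (⟨a, ha.2⟩ : K) ∈ N.comap K.subtype := ha.1
    exact hle this)
  have : x = 0 := h0 x fun a ha => by
    have := hNP ha
    rw [hx, Submodule.mem_colon_singleton] at this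
    simpa using this
  apply hPp.ne_top
  rw [hx, this, Ideal.eq_top_iff_one, Submodule.mem_colon_singleton]
  simp

theorem Gr.colon [IsNoetherianRing S] {N I : Ideal S} {c p : ℕ} (h : Gr N c) (hI : PdLE S (S ⧸ I) p)
    (hp : p < c) (x : S) (hx : ∀ a ∈ N, a * x ∈ I) : x ∈ I := by
  have h1 := ExtVanish.zero_iff.1 (ExtVanish.of_pdLE h p (S ⧸ I) hI 0 (by omega))
    (Submodule.liftQ N (LinearMap.toSpanSingleton S (S ⧸ I) (Ideal.Quotient.mk I x)) (by
      intro a ha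
      rw [LinearMap.mem_ker, LinearMap.toSpanSingleton_apply]
      exact Ideal.Quotient.eq_zero_iff_mem.2 (hx a ha)))
  have h2 := LinearMap.congr_fun h1 (Ideal.Quotient.mk N 1)
  have h3 : (1 : S) • Ideal.Quotient.mk I x = 0 := h2
  rw [one_smul] at h3
  exact Ideal.Quotient.eq_zero_iff_mem.1 h3

theorem Gr.exists_regChain [IsNoetherianRing S] (K : Subring S) {N : Ideal S}
    (hN : N ≤ Ideal.span (N ∩ K : Set S)) {c : ℕ} (h : Gr N c) :
    ∃ I, RegChain (K : Set S) c I ∧ I ≤ N := by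
  suffices ∀ n ≤ c, ∃ I, RegChain (K : Set S) n I ∧ I ≤ N from this c le_rfl
  intro n
  induction n with
  | zero => exact fun _ => ⟨⊥, .nil, bot_le⟩
  | succ n ih =>
    intro hn
    obtain ⟨I, hI, hIN⟩ := ih (by omega)
    obtain ⟨a, haN, haK, hreg⟩ := exists_regular_mem (X := S ⧸ I) K N hN (by
      intro x hx
      obtain ⟨x, rfl⟩ := Ideal.Quotient.mk_surjective x
      exact Ideal.Quotient.eq_zero_iff_mem.2 (h.colon hI.pdLE (by omega) x
        fun a ha => Ideal.Quotient.eq_zero_iff_mem.1 (hx a ha)))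
    refine ⟨_, .snoc hI a haK fun y hy => ?_, sup_le hIN (by simpa using haN)⟩
    exact Ideal.Quotient.eq_zero_iff_mem.1 (hreg (Ideal.Quotient.mk I y)
      (Ideal.Quotient.eq_zero_iff_mem.2 hy))

end
end Semidual

end

section

namespace Semidual
open Abelian TensorProduct Polynomial

theorem RegChain.le_span {S : Type} [CommRing S] {K : Set S} {n : ℕ} {I : Ideal S}
    (h : RegChain K n I) : I ≤ Ideal.span (I ∩ K : Set S) := by
  induction h with
  | nil => exact bot_le
  | snoc hI h hK hreg ih =>
    refine sup_le (ih.trans (Ideal.span_mono fun x hx => ⟨Ideal.mem_sup_left hx.1, hx.2⟩))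
      (Ideal.span_mono ?_)
    rintro _ rfl
    exact ⟨Ideal.mem_sup_right (Ideal.mem_span_singleton_self _), hK⟩

section
variable {S S₀ : Type} [CommRing S] [CommRing S₀] (e : S ≃+* S₀[X])

/-- The elements of `S` that do not involve the variable of the presentation `e`. -/
noncomputable def constants : Subring S := (e.symm.toRingHom.comp Polynomial.C).range

/-- The coefficient of `x` at the `j`-th power of the variable, as an element of `S`. -/
noncomputable def coeffAt (j : ℕ) (x : S) : S := e.symm (Polynomial.C ((e x).coeff j))

variable {e}

theorem coeffAt_add (j : ℕ) (x y : S) : coeffAt e j (x + y) = coeffAt e j x + coeffAt e j y := by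
  simp [coeffAt]

theorem coeffAt_const_mul {a : S} (ha : a ∈ constants e) (j : ℕ) (x : S) :
    coeffAt e j (a * x) = a * coeffAt e j x := by
  obtain ⟨a, rfl⟩ := ha
  simp [coeffAt]

theorem coeffAt_succ_var_mul (j : ℕ) (x : S) :
    coeffAt e (j + 1) (e.symm X * x) = coeffAt e j x := by
  simp [coeffAt]

theorem mem_of_coeffAt_mem {N : Ideal S} {x : S} (h : ∀ j, coeffAt e j x ∈ N) : x ∈ N := by
  have : x = ∑ j ∈ Finset.range ((e x).natDegree + 1), coeffAt e j x * (e.symm X) ^ j := by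
    apply e.injective
    rw [map_sum]
    simp only [coeffAt, map_mul, map_pow, e.apply_symm_apply]
    exact (e x).as_sum_range_C_mul_X_pow
  rw [this]
  exact N.sum_mem fun j _ => N.mul_mem_right _ (h j)

theorem coeffAt_mem {N : Ideal S} (hN : N ≤ Ideal.span (N ∩ constants e : Set S)) {x : S}
    (hx : x ∈ N) (j : ℕ) : coeffAt e j x ∈ N := by
  suffices ∀ b, coeffAt e j (b * x) ∈ N by simpa using this 1
  refine Submodule.span_induction (p := fun x _ => ∀ b, coeffAt e j (b * x) ∈ N)
    ?_ ?_ ?_ ?_ (hN hx)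
  · intro a ha b
    rw [mul_comm, coeffAt_const_mul ha.2]
    exact N.mul_mem_right _ ha.1
  · simp [coeffAt]
  · intro x y _ _ h1 h2 b
    rw [mul_add, coeffAt_add]
    exact N.add_mem (h1 b) (h2 b)
  · intro c x _ h1 b
    rw [smul_eq_mul, ← mul_assoc]
    exact h1 _

theorem colon_of_leading {N : Ideal S} (hN : N ≤ Ideal.span (N ∩ constants e : Set S)) {ι : Type}
    {f g : ι → S} (hf : ∀ i, f i ∈ constants e) (hg : ∀ i, g i ∈ constants e) {A : Set S}
    (hA : A ⊆ constants e) (h : ∀ x, (∀ a ∈ A, a * x ∈ N) → (∀ i, f i * x ∈ N) → x ∈ N) (x : S)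
    (hxA : ∀ a ∈ A, a * x ∈ N)
    (hx : ∀ i, (e.symm X * f i + g i) * x ∈ N) : x ∈ N := by
  refine mem_of_coeffAt_mem (e := e) fun j => ?_
  have hAj : ∀ j, ∀ a ∈ A, a * coeffAt e j x ∈ N := fun j a ha => by
    rw [← coeffAt_const_mul (hA ha)]
    exact coeffAt_mem hN (hxA a ha) j
  by_cases hj : (e x).natDegree < j
  · simp [coeffAt, Polynomial.coeff_eq_zero_of_natDegree_lt hj]
  obtain ⟨l, hl⟩ := Nat.exists_eq_add_of_le (not_lt.1 hj)
  induction l generalizing j with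
  | zero =>
    refine h _ (hAj j) fun i => ?_
    have h1 := coeffAt_mem hN (hx i) (j + 1)
    have h2 : coeffAt e (j + 1) x = 0 := by
      simp [coeffAt, Polynomial.coeff_eq_zero_of_natDegree_lt (show (e x).natDegree < j + 1 by omega)]
    rw [add_mul, coeffAt_add, mul_assoc, coeffAt_succ_var_mul, coeffAt_const_mul (hf i),
      coeffAt_const_mul (hg i), h2, mul_zero, add_zero] at h1
    exact h1
  | succ l ih =>
    refine h _ (hAj j) fun i => ?_
    have h1 := coeffAt_mem hN (hx i) (j + 1)
    rw [add_mul, coeffAt_add, mul_assoc, coeffAt_succ_var_mul, coeffAt_const_mul (hf i),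
      coeffAt_const_mul (hg i)] at h1
    have h2 := N.mul_mem_left (g i) (ih (j + 1) (by omega) (by omega))
    simpa using N.sub_mem h1 h2

/-- Two families in an algebra that are proportional and have no common annihilator span
isomorphic submodules. -/
theorem nonempty_range_equiv {R B : Type} [CommRing R] [CommRing B] [Algebra R B] {ι : Type}
    {f F : ι → B} (hfF : ∀ i j, f i * F j = f j * F i)
    (hf : ∀ x, (∀ i, f i * x = 0) → x = 0) (hF : ∀ x, (∀ i, F i * x = 0) → x = 0) :
    Nonempty (LinearMap.range (Finsupp.linearCombination R f) ≃ₗ[R]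
      LinearMap.range (Finsupp.linearCombination R F)) := by
  have hker : LinearMap.ker (Finsupp.linearCombination R f) =
      LinearMap.ker (Finsupp.linearCombination R F) := by
    have key : ∀ (a : ι →₀ R) (j : ι), f j * Finsupp.linearCombination R F a =
        F j * Finsupp.linearCombination R f a := by
      intro a j
      simp only [Finsupp.linearCombination_apply, Finsupp.sum, Finset.mul_sum, mul_smul_comm]
      refine Finset.sum_congr rfl fun i _ => ?_
      rw [hfF j i, mul_comm]
    ext a
    rw [LinearMap.mem_ker, LinearMap.mem_ker]
    exact ⟨fun h => hf _ fun i => by rw [key, h, mul_zero],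
      fun h => hF _ fun i => by rw [← key, h, mul_zero]⟩
  exact ⟨(LinearMap.quotKerEquivRange _).symm ≪≫ₗ Submodule.quotEquivOfEq _ _ hker ≪≫ₗ
    LinearMap.quotKerEquivRange _⟩

theorem SES.range_linearCombination {N J : Ideal S} {ι : Type} {f : ι → S}
    (hJ : J = N ⊔ Ideal.span (Set.range f)) :
    SES (LinearMap.range (Finsupp.linearCombination S fun i => Ideal.Quotient.mk N (f i))).subtype
      (Submodule.factor (p := N) (p' := J) (hJ ▸ le_sup_left)) where
  inj := Subtype.val_injective
  exact := by
    have h1 : LinearMap.range (Finsupp.linearCombination S fun i => Ideal.Quotient.mk N (f i)) =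
        Submodule.map (N.mkQ) J := by
      rw [hJ, Submodule.map_sup, Finsupp.range_linearCombination]
      have : Submodule.map N.mkQ N = ⊥ := by
        exact (Submodule.mkQ_map_self N)
      rw [this, bot_sup_eq, Ideal.span, Submodule.map_span, ← Set.range_comp]
      rfl
    rw [LinearMap.exact_iff, Submodule.range_subtype, h1]
    ext y
    obtain ⟨y, rfl⟩ := Submodule.mkQ_surjective N y
    rw [LinearMap.mem_ker, Submodule.mem_map]
    have h2 : Submodule.factor (p := N) (p' := J) (hJ ▸ le_sup_left) (N.mkQ y) = J.mkQ y := rfl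
    rw [h2, Submodule.mkQ_apply, Submodule.Quotient.mk_eq_zero]
    constructor
    · exact fun h => ⟨y, h, rfl⟩
    · rintro ⟨z, hz, hzy⟩
      rw [Submodule.mkQ_apply, Submodule.mkQ_apply, Submodule.Quotient.eq] at hzy
      have hzy : z - y ∈ J := by rw [hJ]; exact Ideal.mem_sup_left hzy
      simpa using J.sub_mem hz hzy
  surj := Submodule.factor_surjective _

/-- The inductive step for ladder determinantal ideals: passing from the pair `N ≤ C` to the
ideal `J` whose additional generators are obtained from those of `C` by one more variable. -/
theorem corner_step [IsNoetherianRing S] {N C J : Ideal S} {c : ℕ} {ι : Type} {f g : ι → S}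
    (hN : N ≤ Ideal.span (N ∩ constants e : Set S))
    (hf : ∀ i, f i ∈ constants e) (hg : ∀ i, g i ∈ constants e)
    (hC : C = N ⊔ Ideal.span (Set.range f))
    (hJ : J = N ⊔ Ideal.span (Set.range fun i => e.symm X * f i + g i))
    (hfg : ∀ i j, f i * (e.symm X * f j + g j) - f j * (e.symm X * f i + g i) ∈ N)
    (pN : PdLE S (S ⧸ N) c) (pC : PdLE S (S ⧸ C) (c + 1)) (gN : Gr N c) (gC : Gr C (c + 1)) :
    PdLE S (S ⧸ J) (c + 1) ∧ Gr J (c + 1) := by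
  have hcol : ∀ I : Ideal S, PdLE S (S ⧸ I) c →
      ∀ x, (∀ a ∈ (N ∩ constants e : Set S), a * x ∈ I) → (∀ i, f i * x ∈ I) → x ∈ I := by
    intro I hp x hxA hxf
    refine gC.colon hp (by omega) x fun a ha => ?_
    have : C ≤ Submodule.comap (LinearMap.mulRight S x) I := by
      rw [hC]
      refine sup_le (hN.trans (Ideal.span_le.2 hxA)) (Ideal.span_le.2 ?_)
      rintro _ ⟨i, rfl⟩
      exact hxf i
    exact this ha
  have hcolJ : ∀ I : Ideal S, I ≤ Ideal.span (I ∩ constants e : Set S) → PdLE S (S ⧸ I) c →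
      ∀ x, (∀ a ∈ (N ∩ constants e : Set S), a * x ∈ I) →
        (∀ i, (e.symm X * f i + g i) * x ∈ I) → x ∈ I := fun I hI hp x hxA hx =>
    colon_of_leading hI hf hg (A := (N ∩ constants e : Set S)) (fun a ha => ha.2)
      (hcol I hp) x hxA hx
  have hNJ : N ≤ J := hJ ▸ le_sup_left
  constructor
  · have h1 : ∀ {f : ι → S}, (∀ x, (∀ a ∈ (N ∩ constants e : Set S), a * x ∈ N) →
        (∀ i, f i * x ∈ N) → x ∈ N) → ∀ x : S ⧸ N,
          (∀ i, Ideal.Quotient.mk N (f i) * x = 0) → x = 0 := by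
      intro f h x hx
      obtain ⟨x, rfl⟩ := Ideal.Quotient.mk_surjective x
      exact Ideal.Quotient.eq_zero_iff_mem.2 (h x (fun a ha => N.mul_mem_right _ ha.1)
        fun i => Ideal.Quotient.eq_zero_iff_mem.1 (by rw [map_mul]; exact hx i))
    obtain ⟨E⟩ := nonempty_range_equiv (R := S) (B := S ⧸ N)
      (f := fun i => Ideal.Quotient.mk N (f i))
      (F := fun i => Ideal.Quotient.mk N (e.symm X * f i + g i))
      (fun i j => by
        rw [← map_mul, ← map_mul, Ideal.Quotient.eq]
        exact hfg i j)
      (h1 (hcol N pN)) (h1 (hcolJ N hN pN))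
    have h2 := PdLE.sub (SES.range_linearCombination hC) pC pN
    exact PdLE.quot (SES.range_linearCombination hJ) (h2.congr E) (pN.mono (by omega))
  · obtain ⟨I, hI, hIN⟩ := gN.exists_regChain _ hN
    obtain ⟨h, hhJ, -, hreg⟩ := exists_regular_mem (X := S ⧸ I) (⊤ : Subring S) J
      (by simp) (by
        intro x hx
        obtain ⟨x, rfl⟩ := Ideal.Quotient.mk_surjective x
        have hx : ∀ a ∈ J, a * x ∈ I := fun a ha => Ideal.Quotient.eq_zero_iff_mem.1 (hx a ha)
        refine Ideal.Quotient.eq_zero_iff_mem.2 (hcolJ I hI.le_span hI.pdLE x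
          (fun a ha => hx a (hNJ ha.1)) fun i => hx _ ?_)
        rw [hJ]
        exact Ideal.mem_sup_right (Ideal.subset_span ⟨i, rfl⟩))
    refine (RegChain.snoc (hI.mono (Set.subset_univ _)) h (Set.mem_univ _) fun y hy => ?_).gr
      (sup_le (hIN.trans hNJ) (by simpa using hhJ))
    exact Ideal.Quotient.eq_zero_iff_mem.1 (hreg (Ideal.Quotient.mk I y)
      (Ideal.Quotient.eq_zero_iff_mem.2 hy))

end
end Semidual

end

section

namespace Semidual
open Abelian TensorProduct Polynomial

section
variable {S : Type} [CommRing S]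

/-- The minor of the infinite matrix `x` with rows `ρ` and columns `γ`. -/
def minor (x : ℕ → ℕ → S) {t : ℕ} (ρ γ : Fin t → ℕ) : S :=
  (Matrix.of fun i j => x (ρ i) (γ j)).det

/-- The ideal of `t`-minors of the upper left `a × b` corner of `x`. -/
def rect (x : ℕ → ℕ → S) (t a b : ℕ) : Ideal S :=
  Ideal.span {d | ∃ ρ γ : Fin t → ℕ, (∀ i, ρ i < a) ∧ (∀ i, γ i < b) ∧ d = minor x ρ γ}

variable {x : ℕ → ℕ → S} {t a b : ℕ}

theorem minor_mem_rect {ρ γ : Fin t → ℕ} (hρ : ∀ i, ρ i < a) (hγ : ∀ i, γ i < b) :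
    minor x ρ γ ∈ rect x t a b := Ideal.subset_span ⟨ρ, γ, hρ, hγ, rfl⟩

theorem minor_transpose (ρ γ : Fin t → ℕ) : minor (fun i j => x j i) γ ρ = minor x ρ γ := by
  rw [minor, ← Matrix.det_transpose]
  rfl

theorem rect_transpose : rect (fun i j => x j i) t b a = rect x t a b := by
  refine congrArg Ideal.span (Set.ext fun d => ?_)
  constructor
  · rintro ⟨ρ, γ, h1, h2, rfl⟩
    exact ⟨γ, ρ, h2, h1, minor_transpose _ _⟩
  · rintro ⟨ρ, γ, h1, h2, rfl⟩
    exact ⟨γ, ρ, h2, h1, (minor_transpose _ _).symm⟩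

theorem rect_mono {a' b' : ℕ} (ha : a ≤ a') (hb : b ≤ b') : rect x t a b ≤ rect x t a' b' := by
  refine Ideal.span_mono ?_
  rintro _ ⟨ρ, γ, h1, h2, rfl⟩
  exact ⟨ρ, γ, fun i => (h1 i).trans_le ha, fun i => (h2 i).trans_le hb, rfl⟩

theorem rect_zero : rect x 0 a b = ⊤ := by
  rw [Ideal.eq_top_iff_one]
  exact Ideal.subset_span ⟨Fin.elim0, Fin.elim0, by simp, by simp, by simp [minor]⟩

theorem minor_eq_zero_of_rows {ρ γ : Fin t → ℕ} (h : ¬ Function.Injective ρ) :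
    minor x ρ γ = 0 := by
  simp only [Function.Injective, not_forall] at h
  obtain ⟨i, j, hij, hne⟩ := h
  exact Matrix.det_zero_of_row_eq hne (by ext; simp [hij])

theorem minor_eq_zero_of_cols {ρ γ : Fin t → ℕ} (h : ¬ Function.Injective γ) :
    minor x ρ γ = 0 := by
  rw [← minor_transpose]
  exact minor_eq_zero_of_rows h

theorem rect_eq_bot_of_rows (h : a < t) : rect x t a b = ⊥ := by
  rw [rect, Ideal.span_eq_bot]
  rintro _ ⟨ρ, γ, h1, h2, rfl⟩
  refine minor_eq_zero_of_rows fun hinj => ?_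
  have := Fintype.card_le_of_injective (fun i => (⟨ρ i, h1 i⟩ : Fin a))
    fun i j hij => hinj (by simpa using hij)
  simp at this
  omega

theorem rect_eq_bot_of_cols (h : b < t) : rect x t a b = ⊥ := by
  rw [← rect_transpose]
  exact rect_eq_bot_of_rows h

theorem rect_succ_cols : rect x (t + 1) a (b + 1) ≤ rect x t a b := by
  refine Ideal.span_le.2 ?_
  rintro _ ⟨ρ, γ, h1, h2, rfl⟩
  by_cases hinj : Function.Injective γ
  swap
  · rw [minor_eq_zero_of_cols hinj]
    exact zero_mem _
  obtain ⟨j, hj⟩ : ∃ j, ∀ l, l ≠ j → γ l < b := by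
    by_cases h : ∃ j, γ j = b
    · obtain ⟨j, hj⟩ := h
      refine ⟨j, fun l hl => ?_⟩
      have := h2 l
      have : γ l ≠ γ j := fun h => hl (hinj h)
      omega
    · refine ⟨0, fun l _ => ?_⟩
      have := h2 l
      have : γ l ≠ b := fun h' => h ⟨l, h'⟩
      omega
  rw [minor, Matrix.det_succ_column _ j]
  refine Ideal.sum_mem _ fun i _ => Ideal.mul_mem_left _ _ ?_
  exact minor_mem_rect (ρ := fun l => ρ (i.succAbove l)) (γ := fun l => γ (j.succAbove l))
    (fun l => h1 _) (fun l => hj _ (Fin.succAbove_ne _ _))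

theorem rect_succ_rows : rect x (t + 1) (a + 1) b ≤ rect x t a b := by
  rw [← rect_transpose, ← rect_transpose (x := x) (t := t)]
  exact rect_succ_cols

theorem minor_comp_swap_rows (ρ γ : Fin t → ℕ) (σ : Equiv.Perm (Fin t)) :
    minor x (ρ ∘ σ) γ = (Equiv.Perm.sign σ : S) * minor x ρ γ := by
  rw [minor, minor, ← Matrix.det_permute]
  rfl

theorem minor_mem_iff_rows {I : Ideal S} (ρ γ : Fin t → ℕ) (σ : Equiv.Perm (Fin t)) :
    minor x (ρ ∘ σ) γ ∈ I ↔ minor x ρ γ ∈ I := by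
  rw [minor_comp_swap_rows]
  rcases Int.units_eq_one_or (Equiv.Perm.sign σ) with h | h <;> simp [h]

theorem minor_mem_iff_cols {I : Ideal S} (ρ γ : Fin t → ℕ) (σ : Equiv.Perm (Fin t)) :
    minor x ρ (γ ∘ σ) ∈ I ↔ minor x ρ γ ∈ I := by
  rw [← minor_transpose, ← minor_transpose ρ γ]
  exact minor_mem_iff_rows _ _ _

/-- A sequence bounded by `a`, or a permutation of one starting with `a`. -/
theorem exists_perm_cons {ρ : Fin (t + 1) → ℕ} (hinj : Function.Injective ρ)
    (h : ∀ i, ρ i < a + 1) :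
    (∀ i, ρ i < a) ∨ ∃ (σ : Equiv.Perm (Fin (t + 1))) (ρ' : Fin t → ℕ), (∀ i, ρ' i < a) ∧
      ρ ∘ σ = Fin.cons a ρ' := by
  by_cases h' : ∃ i, ρ i = a
  · obtain ⟨i, hi⟩ := h'
    refine Or.inr ⟨Equiv.swap 0 i, fun l => ρ (Equiv.swap 0 i l.succ), fun l => ?_, ?_⟩
    · have h1 := h (Equiv.swap 0 i l.succ)
      have h2 : Equiv.swap 0 i l.succ ≠ i := by
        intro h
        rw [Equiv.swap_apply_eq_iff, Equiv.swap_apply_right] at h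
        exact Fin.succ_ne_zero _ h
      have h3 : ρ (Equiv.swap 0 i l.succ) ≠ ρ i := fun h => h2 (hinj h)
      change ρ (Equiv.swap 0 i l.succ) < a
      omega
    · funext l
      refine Fin.cases ?_ (fun l => ?_) l <;> simp [hi]
  · refine Or.inl fun i => ?_
    have := h i
    have : ρ i ≠ a := fun h => h' ⟨i, h⟩
    omega

/-- Pairs of sequences indexing the minors of the `a × b` corner. -/
def Pairs (t a b : ℕ) : Type :=
  {p : (Fin t → ℕ) × (Fin t → ℕ) // (∀ i, p.1 i < a) ∧ ∀ i, p.2 i < b}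

theorem rect_eq_span_range :
    rect x t a b = Ideal.span (Set.range fun p : Pairs t a b => minor x p.1.1 p.1.2) := by
  refine congrArg Ideal.span (Set.ext fun d => ?_)
  constructor
  · rintro ⟨ρ, γ, h1, h2, rfl⟩
    exact ⟨⟨(ρ, γ), h1, h2⟩, rfl⟩
  · rintro ⟨p, rfl⟩
    exact ⟨_, _, p.2.1, p.2.2, rfl⟩

/-- The minor through the corner entry `(a, b)`. -/
def cornerMinor (x : ℕ → ℕ → S) (a b : ℕ) {t : ℕ} (ρ γ : Fin t → ℕ) : S :=
  minor x (Fin.cons a ρ : Fin (t + 1) → ℕ) (Fin.cons b γ : Fin (t + 1) → ℕ)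

theorem rect_succ_sup {N : Ideal S} (h1 : rect x (t + 1) a (b + 1) ≤ N)
    (h2 : rect x (t + 1) (a + 1) b ≤ N) :
    N ⊔ rect x (t + 1) (a + 1) (b + 1) =
      N ⊔ Ideal.span (Set.range fun p : Pairs t a b => cornerMinor x a b p.1.1 p.1.2) := by
  apply le_antisymm
  · refine sup_le le_sup_left (Ideal.span_le.2 ?_)
    rintro _ ⟨ρ, γ, hρ, hγ, rfl⟩
    by_cases i1 : Function.Injective ρ
    swap
    · rw [minor_eq_zero_of_rows i1]; exact zero_mem _
    by_cases i2 : Function.Injective γ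
    swap
    · rw [minor_eq_zero_of_cols i2]; exact zero_mem _
    rcases exists_perm_cons i1 hρ with h | ⟨σ, ρ', hρ', e1⟩
    · exact Ideal.mem_sup_left (h1 (minor_mem_rect h hγ))
    rcases exists_perm_cons i2 hγ with h | ⟨τ, γ', hγ', e2⟩
    · exact Ideal.mem_sup_left (h2 (minor_mem_rect hρ h))
    rw [SetLike.mem_coe, ← minor_mem_iff_rows _ _ σ, ← minor_mem_iff_cols _ _ τ, e1, e2]
    exact Ideal.mem_sup_right (Ideal.subset_span ⟨⟨(ρ', γ'), hρ', hγ'⟩, rfl⟩)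
  · refine sup_le le_sup_left (Ideal.span_le.2 ?_)
    rintro _ ⟨p, rfl⟩
    refine Ideal.mem_sup_right (minor_mem_rect ?_ ?_)
    · intro i
      refine Fin.cases ?_ (fun i => ?_) i
      · simp
      · simpa using (p.2.1 i).trans (Nat.lt_succ_self a)
    · intro i
      refine Fin.cases ?_ (fun i => ?_) i
      · simp
      · simpa using (p.2.2 i).trans (Nat.lt_succ_self b)

/-- The part of `cornerMinor` not involving the corner entry. -/
def cornerRest (x : ℕ → ℕ → S) (a b : ℕ) {t : ℕ} (ρ γ : Fin t → ℕ) : S :=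
  ∑ j : Fin t, (-1) ^ (j + 1 : ℕ) * x a (γ j) *
    minor x ρ (fun l => (Fin.cons b γ : Fin (t + 1) → ℕ) (j.succ.succAbove l))

theorem cornerMinor_eq (p b : ℕ) {t : ℕ} (ρ γ : Fin t → ℕ) :
    cornerMinor x p b ρ γ = x p b * minor x ρ γ + cornerRest x p b ρ γ := by
  rw [cornerMinor, minor, Matrix.det_succ_row_zero, Fin.sum_univ_succ, cornerRest]
  congr 1
  simp [minor]
  rfl

theorem minor_cons_column (b : ℕ) (ρ : Fin (t + 1) → ℕ) (γ : Fin t → ℕ) :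
    minor x ρ (Fin.cons b γ : Fin (t + 1) → ℕ) =
      ∑ s : Fin (t + 1), (-1) ^ (s : ℕ) * x (ρ s) b * minor x (fun l => ρ (s.succAbove l)) γ := by
  rw [minor, Matrix.det_succ_column_zero]
  rfl

theorem cornerMinor_proportional {N : Ideal S} (h1 : rect x (t + 1) a (b + 1) ≤ N)
    (h2 : rect x (t + 1) (a + 1) b ≤ N) (p q : Pairs t a b) :
    minor x p.1.1 p.1.2 * cornerMinor x a b q.1.1 q.1.2 -
      minor x q.1.1 q.1.2 * cornerMinor x a b p.1.1 p.1.2 ∈ N := by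
  obtain ⟨⟨ρ', γ'⟩, hρ', hγ'⟩ := p
  obtain ⟨⟨ρ, γ⟩, hρ, hγ⟩ := q
  dsimp only at *
  have hcons : ∀ {c d : ℕ} {τ : Fin t → ℕ}, c < d → (∀ i, τ i < d) →
      ∀ i, (Fin.cons c τ : Fin (t + 1) → ℕ) i < d := fun hc hτ i =>
    Fin.cases hc (fun i => by simpa using hτ i) i
  set R : Fin (t + 1) → ℕ := Fin.cons a ρ with hR
  let D : Fin (t + 1) → S := fun s => minor x (fun l => R (s.succAbove l)) γ
  let d : Fin t → S := fun j =>
    minor x ρ' (fun l => (Fin.cons b γ' : Fin (t + 1) → ℕ) (j.succ.succAbove l))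
  have hB : ∀ p, x p b * minor x ρ' γ' =
      cornerMinor x p b ρ' γ' - ∑ j : Fin t, (-1) ^ (j + 1 : ℕ) * x p (γ' j) * d j := by
    intro p
    rw [cornerMinor_eq, cornerRest]
    ring
  have hF : minor x ρ' γ' * cornerMinor x a b ρ γ =
      ∑ s : Fin (t + 1), (-1) ^ (s : ℕ) * D s * cornerMinor x (R s) b ρ' γ' -
        ∑ j : Fin t, (-1) ^ (j + 1 : ℕ) * d j * minor x R (Fin.cons (γ' j) γ : Fin (t + 1) → ℕ) := by
    simp_rw [minor_cons_column, Finset.mul_sum]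
    rw [Finset.sum_comm, ← Finset.sum_sub_distrib, cornerMinor, minor_cons_column, Finset.mul_sum]
    refine Finset.sum_congr rfl fun s _ => ?_
    have : minor x ρ' γ' * ((-1) ^ (s : ℕ) * x (R s) b * D s) =
        (-1) ^ (s : ℕ) * D s * (x (R s) b * minor x ρ' γ') := by ring
    change minor x ρ' γ' * ((-1) ^ (s : ℕ) * x (R s) b * D s) = _
    rw [this, hB, mul_sub, Finset.mul_sum]
    congr 1
    refine Finset.sum_congr rfl fun j _ => ?_
    change _ = (-1) ^ (j + 1 : ℕ) * d j * ((-1) ^ (s : ℕ) * x (R s) (γ' j) * D s)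
    ring
  have h0 : D 0 = minor x ρ γ := by simp [D, hR]
  rw [hF, Fin.sum_univ_succ, h0]
  have e : ∀ u v w z : S, u + v - w - z = (u - z) + v - w := fun _ _ _ _ => by ring
  rw [e]
  refine N.sub_mem (N.add_mem ?_ ?_) ?_
  · simp [hR]
  · refine N.sum_mem fun s _ => N.mul_mem_left _ (h1 ?_)
    exact minor_mem_rect (hcons (by simpa [hR] using hρ s) hρ')
      (hcons (Nat.lt_succ_self b) fun i => (hγ' i).trans (Nat.lt_succ_self b))
  · refine N.sum_mem fun j _ => N.mul_mem_left _ (h2 ?_)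
    exact minor_mem_rect (hcons (Nat.lt_succ_self a) fun i => (hρ i).trans (Nat.lt_succ_self a))
      (hcons (hγ' j) hγ)

end
end Semidual

end

section

namespace Semidual
open Abelian TensorProduct Polynomial

theorem minor_mem_subring {S : Type} [CommRing S] {x : ℕ → ℕ → S} (K : Subring S) {t : ℕ}
    {ρ γ : Fin t → ℕ} (h : ∀ i j, x (ρ i) (γ j) ∈ K) : minor x ρ γ ∈ K := by
  rw [minor, Matrix.det_apply]
  exact K.sum_mem fun σ _ => by
    rw [Units.smul_def]
    exact K.zsmul_mem (K.prod_mem fun i _ => h _ _) _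

theorem rect_le_span {S : Type} [CommRing S] {x : ℕ → ℕ → S} (K : Subring S) {t a b : ℕ}
    (h : ∀ i j, i < a → j < b → x i j ∈ K) :
    rect x t a b ≤ Ideal.span (rect x t a b ∩ K : Set S) := by
  refine Ideal.span_le.2 ?_
  rintro _ ⟨ρ, γ, h1, h2, rfl⟩
  exact Ideal.subset_span ⟨minor_mem_rect h1 h2, minor_mem_subring K fun i j => h _ _ (h1 i) (h2 j)⟩

section
variable (k : Type) [Field k] (m n : ℕ)

/-- The generic `m × n` matrix, extended by zero. -/
noncomputable def gen (i j : ℕ) : MvPolynomial (Fin m × Fin n) k :=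
  if h : i < m ∧ j < n then MvPolynomial.X (⟨i, h.1⟩, ⟨j, h.2⟩) else 0

variable {m n}

theorem exists_gen_equiv {a b : ℕ} (ha : a < m) (hb : b < n) :
    ∃ (S₀ : Type) (_ : CommRing S₀) (e : MvPolynomial (Fin m × Fin n) k ≃+* S₀[X]),
      e.symm X = gen k m n a b ∧ ∀ i j, (i ≠ a ∨ j ≠ b) → gen k m n i j ∈ constants e := by
  let y : Fin m × Fin n := (⟨a, ha⟩, ⟨b, hb⟩)
  let e := (MvPolynomial.renameEquiv k (Equiv.optionSubtypeNe y).symm).trans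
    (MvPolynomial.optionEquivLeft k {z // z ≠ y})
  refine ⟨_, _, e.toRingEquiv, ?_, ?_⟩
  · change e.symm X = _
    rw [AlgEquiv.symm_apply_eq]
    simp [e, gen, ha, hb, y]
  · intro i j hij
    rw [gen]
    split_ifs with h
    · refine ⟨MvPolynomial.X ⟨(⟨i, h.1⟩, ⟨j, h.2⟩), by simpa [y, imp_iff_not_or] using hij⟩, ?_⟩
      change e.symm (C _) = _
      rw [AlgEquiv.symm_apply_eq]
      have : (⟨i, h.1⟩, ⟨j, h.2⟩) ≠ y := by simpa [y, imp_iff_not_or] using hij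
      simp [e, Equiv.optionSubtypeNe_symm_of_ne this]
    · exact zero_mem _

end

section
variable {S : Type} [CommRing S]

theorem corner_rect [IsNoetherianRing S] {S₀ : Type} [CommRing S₀] {e : S ≃+* S₀[X]}
    {x : ℕ → ℕ → S} {a b s c : ℕ} {O : Ideal S} (he : e.symm X = x a b)
    (hconst : ∀ i j, (i ≠ a ∨ j ≠ b) → x i j ∈ constants e)
    (hO : O ≤ Ideal.span (O ∩ constants e : Set S))
    (hN1 : rect x (s + 1) a (b + 1) ≤ O ⊔ rect x (s + 1) (a + 1) b)
    (pN : PdLE S (S ⧸ O ⊔ rect x (s + 1) (a + 1) b) c)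
    (pC : PdLE S (S ⧸ O ⊔ rect x s a b) (c + 1))
    (gN : Gr (O ⊔ rect x (s + 1) (a + 1) b) c) (gC : Gr (O ⊔ rect x s a b) (c + 1)) :
    PdLE S (S ⧸ O ⊔ rect x (s + 1) (a + 1) (b + 1)) (c + 1) ∧
      Gr (O ⊔ rect x (s + 1) (a + 1) (b + 1)) (c + 1) := by
  have hN2 : rect x (s + 1) (a + 1) b ≤ O ⊔ rect x (s + 1) (a + 1) b := le_sup_right
  have hNC : rect x (s + 1) (a + 1) b ≤ rect x s a b := rect_succ_rows
  refine corner_step (e := e) (ι := Pairs s a b) (f := fun p => minor x p.1.1 p.1.2)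
    (g := fun p => cornerRest x a b p.1.1 p.1.2) ?_ ?_ ?_ ?_ ?_ ?_ pN pC gN gC
  · refine sup_le (hO.trans (Ideal.span_mono fun z hz => ⟨Ideal.mem_sup_left hz.1, hz.2⟩))
      ((rect_le_span (constants e) fun i j _ hj => hconst i j (Or.inr hj.ne)).trans
        (Ideal.span_mono fun z hz => ⟨Ideal.mem_sup_right hz.1, hz.2⟩))
  · exact fun p => minor_mem_subring _ fun a b => hconst _ _ (Or.inl (p.2.1 a).ne)
  · intro p
    refine Subring.sum_mem _ fun j _ => Subring.mul_mem _ (Subring.mul_mem _ ?_ ?_) ?_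
    · exact Subring.pow_mem _ (Subring.neg_mem _ (Subring.one_mem _)) _
    · exact hconst _ _ (Or.inr (p.2.2 j).ne)
    · exact minor_mem_subring _ fun a b => hconst _ _ (Or.inl (p.2.1 a).ne)
  · rw [← rect_eq_span_range, sup_assoc, sup_eq_right.2 hNC]
  · rw [he]
    have := rect_succ_sup hN1 hN2
    have h1 : rect x (s + 1) (a + 1) b ≤ rect x (s + 1) (a + 1) (b + 1) :=
      rect_mono le_rfl (Nat.le_succ _)
    rw [sup_assoc, sup_eq_right.2 h1] at this
    rw [this]
    simp only [cornerMinor_eq]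
  · intro p q
    rw [he, ← cornerMinor_eq, ← cornerMinor_eq]
    exact cornerMinor_proportional hN1 hN2 p q

/-- The ladder ideal with one block of minors for each row `i` with `0 < μ i`. -/
def ladder (x : ℕ → ℕ → S) (μ t : ℕ → ℕ) : Ideal S :=
  ⨆ i, ⨆ _ : 0 < μ i, rect x (t i) (i + t i) (μ i + t i - 1)

/-- The blocks of a ladder ideal other than the one in row `i`. -/
def ladderOff (x : ℕ → ℕ → S) (μ t : ℕ → ℕ) (i : ℕ) : Ideal S :=
  ⨆ j, ⨆ _ : j ≠ i ∧ 0 < μ j, rect x (t j) (j + t j) (μ j + t j - 1)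

theorem ladder_update (x : ℕ → ℕ → S) (μ t : ℕ → ℕ) (i a b : ℕ) :
    ladder x (Function.update μ i a) (Function.update t i b) =
      ladderOff x μ t i ⊔ ⨆ _ : 0 < a, rect x b (i + b) (a + b - 1) := by
  apply le_antisymm
  · refine iSup_le fun j => iSup_le fun hj => ?_
    by_cases h : j = i
    · subst h
      simp only [Function.update_self] at hj ⊢
      exact le_sup_of_le_right (le_iSup_of_le hj le_rfl)
    · simp only [Function.update_of_ne h] at hj ⊢
      exact le_sup_of_le_left (le_iSup₂_of_le j ⟨h, hj⟩ le_rfl)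
  · refine sup_le (iSup_le fun j => iSup_le fun hj => ?_) (iSup_le fun ha => ?_)
    · refine le_iSup_of_le j ?_
      simp only [Function.update_of_ne hj.1]
      exact le_iSup_of_le hj.2 le_rfl
    · refine le_iSup_of_le i ?_
      simp only [Function.update_self]
      exact le_iSup_of_le ha le_rfl

theorem sum_update_add (f : ℕ → ℕ) {i L : ℕ} (hi : i < L) (b : ℕ) :
    ∑ j ∈ Finset.range L, Function.update f i b j + f i = ∑ j ∈ Finset.range L, f j + b := by
  rw [Finset.sum_update_of_mem (Finset.mem_range.2 hi),
    Finset.sum_eq_add_sum_sdiff_singleton_of_mem (Finset.mem_range.2 hi) f]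
  ring

end

/-- Admissible data for a ladder ideal of an `m × n` matrix. -/
structure IsLadder (m n L : ℕ) (μ t : ℕ → ℕ) : Prop where
  anti : Antitone μ
  bound : ∀ i, L ≤ i → μ i = 0
  step : ∀ i, 0 < μ (i + 1) → t (i + 1) ≤ t i ∧ t i ≤ t (i + 1) + 1
  fit : ∀ i, 0 < μ i → i + t i ≤ m ∧ μ i + t i ≤ n + 1

theorem IsLadder.le {m n L : ℕ} {μ t : ℕ → ℕ} (h : IsLadder m n L μ t) {i j : ℕ} (hij : i ≤ j)
    (hj : 0 < μ j) : t j ≤ t i := by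
  induction j, hij using Nat.le_induction with
  | base => exact le_rfl
  | succ j hij ih => exact (h.step j hj).1.trans (ih (hj.trans_le (h.anti (Nat.le_succ j))))

theorem ladder_perfect (k : Type) [Field k] (m n L M : ℕ) (μ t : ℕ → ℕ) (h : IsLadder m n L μ t)
    (hM : ∑ i ∈ Finset.range L, (μ i + t i) = M) :
    PdLE (MvPolynomial (Fin m × Fin n) k) (_ ⧸ ladder (gen k m n) μ t)
      (∑ i ∈ Finset.range L, μ i) ∧
    Gr (ladder (gen k m n) μ t) (∑ i ∈ Finset.range L, μ i) := by
  induction M using Nat.strong_induction_on generalizing μ t with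
  | _ M ih =>
  set x := gen k m n with hx
  by_cases h0 : 0 < μ 0
  swap
  · have hμ : ∀ i, μ i = 0 := fun i => by have := h.anti (Nat.zero_le i); omega
    have h1 : ladder x μ t = ⊥ := by simp [ladder, hμ]
    have h2 : ∑ i ∈ Finset.range L, μ i = 0 := by simp [hμ]
    rw [h2, h1]
    exact ⟨PdLE.congr (Submodule.quotEquivOfEqBot _ rfl).symm (PdLE.of_projective 0),
      fun j hj => by omega⟩
  obtain ⟨i, hi, hti, hnext⟩ : ∃ i, 0 < μ i ∧ t i = t 0 ∧ (0 < μ (i + 1) → t (i + 1) ≠ t 0) := by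
    by_contra! hcon
    have : ∀ i, 0 < μ i ∧ t i = t 0 := by
      intro i
      induction i with
      | zero => exact ⟨h0, rfl⟩
      | succ i ih => exact hcon i ih.1 ih.2
    have h1 := (this L).1
    rw [h.bound L le_rfl] at h1
    omega
  have hiL : i < L := by
    by_contra hL
    have := h.bound i (by omega)
    omega
  have hprev : ∀ j ≤ i, t j = t 0 := fun j hj =>
    le_antisymm (h.le (Nat.zero_le j) (hi.trans_le (h.anti hj))) (hti ▸ h.le hj hi)
  have hnext' : 0 < μ (i + 1) → t i = t (i + 1) + 1 := fun hp => by
    have h1 := h.step i hp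
    have h2 := hnext hp
    omega
  have hself : ladder x μ t = ladderOff x μ t i ⊔ rect x (t i) (i + t i) (μ i + t i - 1) := by
    have := ladder_update x μ t i (μ i) (t i)
    simpa [hi] using this
  rcases Nat.eq_zero_or_pos (t i) with ht0 | htpos
  · have h1 : ladder x μ t = ⊤ := by
      rw [hself, ht0, rect_zero, sup_top_eq]
    rw [h1]
    exact ⟨PdLE.of_subsingleton _, fun j hj => ExtVanish.subsingleton_left j⟩
  obtain ⟨s, hs⟩ : ∃ s, t i = s + 1 := ⟨t i - 1, by omega⟩
  obtain ⟨ν, hν⟩ : ∃ ν, μ i = ν + 1 := ⟨μ i - 1, by omega⟩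
  have hC : IsLadder m n L μ (Function.update t i s) := by
    refine ⟨h.anti, h.bound, fun j hj => ?_, fun j hj => ?_⟩
    · have h1 := h.step j hj
      by_cases h2 : j = i
      · subst h2
        have := hnext' hj
        rw [Function.update_self, Function.update_of_ne (by omega)]
        omega
      · by_cases h3 : j + 1 = i
        · subst h3
          have := hprev j (by omega)
          rw [Function.update_self, Function.update_of_ne (by omega)]
          omega
        · rwa [Function.update_of_ne h2, Function.update_of_ne h3]
    · have h1 := h.fit j hj
      by_cases h2 : j = i
      · subst h2
        rw [Function.update_self]
        omega
      · rwa [Function.update_of_ne h2]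
  have hsumC := sum_update_add t hiL s
  have hCeq : ladder x μ (Function.update t i s) =
      ladderOff x μ t i ⊔ rect x s (i + s) (ν + s) := by
    have h1 := ladder_update x μ t i (μ i) s
    have h2 : ν + 1 + s - 1 = ν + s := by omega
    rw [Function.update_eq_self, hν, h2] at h1
    simpa using h1
  have hself' : ladder x μ t = ladderOff x μ t i ⊔ rect x (s + 1) (i + s + 1) (ν + s + 1) := by
    rw [hself, hs, hν, show ν + 1 + (s + 1) - 1 = ν + s + 1 by omega, ← add_assoc]
  simp only [Finset.sum_add_distrib] at hM
  have ihC := ih (∑ j ∈ Finset.range L, (μ j + Function.update t i s j))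
    (by rw [Finset.sum_add_distrib]; omega) μ (Function.update t i s) hC rfl
  rw [hCeq] at ihC
  by_cases hcor : 0 < μ (i + 1) ∧ μ (i + 1) = μ i
  · have hti' := hnext' hcor.1
    have h1 : rect x s (i + s + 1) (ν + s) ≤ ladderOff x μ t i := by
      refine le_iSup₂_of_le (i + 1) ⟨by omega, hcor.1⟩ ?_
      rw [show t (i + 1) = s by omega, show μ (i + 1) = ν + 1 by omega]
      exact rect_mono (by omega) (by omega)
    rw [hself', sup_eq_left.2 (rect_succ_cols.trans h1)]
    rwa [sup_eq_left.2 ((rect_mono (by omega) le_rfl).trans h1)] at ihC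
  have hle : μ (i + 1) ≤ ν := by
    have := h.anti (Nat.le_succ i)
    simp only [Nat.succ_eq_add_one] at this
    by_contra hcon
    exact hcor ⟨by omega, by omega⟩
  have hN : IsLadder m n L (Function.update μ i ν) t := by
    have hpos : ∀ j, 0 < Function.update μ i ν j → 0 < μ j := by
      intro j hj
      by_cases h2 : j = i
      · rwa [h2]
      · rwa [Function.update_of_ne h2] at hj
    refine ⟨antitone_nat_of_succ_le fun j => ?_, fun j hj => ?_, fun j hj => h.step j (hpos _ hj),
      fun j hj => ?_⟩
    · have h1 := h.anti (Nat.le_succ j)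
      simp only [Nat.succ_eq_add_one] at h1
      by_cases h2 : j = i
      · subst h2
        rw [Function.update_self, Function.update_of_ne (by omega)]
        exact hle
      · by_cases h3 : j + 1 = i
        · subst h3
          rw [Function.update_self, Function.update_of_ne (by omega)]
          omega
        · rwa [Function.update_of_ne h2, Function.update_of_ne h3]
    · rw [Function.update_of_ne (by omega)]
      exact h.bound j hj
    · have h1 := h.fit j (hpos j hj)
      by_cases h2 : j = i
      · subst h2
        rw [Function.update_self]
        omega
      · rwa [Function.update_of_ne h2]
  have hsumN := sum_update_add μ hiL ν
  have hNeq : ladder x (Function.update μ i ν) t =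
      ladderOff x μ t i ⊔ rect x (s + 1) (i + s + 1) (ν + s) := by
    have h1 := ladder_update x μ t i ν (s + 1)
    rw [← hs, Function.update_eq_self, hs] at h1
    rw [h1]
    rcases Nat.eq_zero_or_pos ν with h0 | h0
    · have h2 : rect x (s + 1) (i + s + 1) s = ⊥ := rect_eq_bot_of_cols (by omega)
      simp [h0, h2]
    · simp only [h0, iSup_pos]
      congr 1
  have ihN := ih (∑ j ∈ Finset.range L, (Function.update μ i ν j + t j))
    (by rw [Finset.sum_add_distrib]; omega) (Function.update μ i ν) t hN rfl
  rw [hNeq] at ihN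
  have hsum : ∑ j ∈ Finset.range L, μ j = ∑ j ∈ Finset.range L, Function.update μ i ν j + 1 := by
    omega
  rw [hsum] at ihC ⊢
  rw [hself']
  have hfit := h.fit i hi
  obtain ⟨S₀, _, e, he, hconst⟩ := exists_gen_equiv k (m := m) (n := n) (a := i + s) (b := ν + s)
    (by omega) (by omega)
  rw [← hx] at he hconst
  have hN1 : rect x (s + 1) (i + s) (ν + s + 1) ≤
      ladderOff x μ t i ⊔ rect x (s + 1) (i + s + 1) (ν + s) := by
    rcases Nat.eq_zero_or_pos i with hi0 | hi0
    · rw [rect_eq_bot_of_rows (by omega)]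
      exact bot_le
    · refine le_sup_of_le_left (le_iSup₂_of_le (i - 1) ⟨by omega, hi.trans_le (h.anti (by omega))⟩ ?_)
      have h1 := hprev (i - 1) (by omega)
      have h2 := h.anti (show i - 1 ≤ i by omega)
      rw [show t (i - 1) = s + 1 by omega]
      exact rect_mono (by omega) (by omega)
  refine corner_rect (O := ladderOff x μ t i) he hconst ?_ hN1 ihN.1 ihC.1 ihN.2 ihC.2
  refine iSup₂_le fun j hj => ?_
  have hle : rect x (t j) (j + t j) (μ j + t j - 1) ≤ ladderOff x μ t i :=
    le_iSup₂ (f := fun j (_ : j ≠ i ∧ 0 < μ j) => rect x (t j) (j + t j) (μ j + t j - 1)) j hj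
  refine (rect_le_span (constants e) ?_).trans (Ideal.span_mono fun z hz => ⟨hle hz.1, hz.2⟩)
  intro u v hu hv
  rcases lt_or_gt_of_ne hj.1 with hji | hji
  · have := hprev j hji.le
    exact hconst u v (Or.inl (by omega))
  · have h1 : 0 < μ (i + 1) := hj.2.trans_le (h.anti hji)
    have h2 := hnext' h1
    have h3 : t j ≤ t (i + 1) := h.le hji hj.2
    have h4 : μ j ≤ μ (i + 1) := h.anti hji
    exact hconst u v (Or.inr (by omega))

end Semidual

end

section

namespace Semidual
open Abelian TensorProduct Polynomial

theorem minorsIdeal_eq_rect (k : Type) [Field k] (m n t : ℕ) :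
    minorsIdeal k m n t = rect (gen k m n) t m n := by
  refine congrArg Ideal.span (Set.ext fun d => ?_)
  constructor
  · rintro ⟨ρ, γ, rfl⟩
    refine ⟨fun i => ρ i, fun i => γ i, fun i => (ρ i).2, fun i => (γ i).2, ?_⟩
    simp [minor, gen]
  · rintro ⟨ρ, γ, h1, h2, rfl⟩
    refine ⟨fun i => ⟨ρ i, h1 i⟩, fun i => ⟨γ i, h2 i⟩, ?_⟩
    simp [minor, gen, h1, h2]

/-- Determinantal ideals of the generic matrix are perfect of the expected grade. -/
theorem minors_perfect (k : Type) [Field k] (m n r : ℕ) (hm : r < m) (hn : r < n) :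
    PdLE (MvPolynomial (Fin m × Fin n) k) (DetRing k m n (r + 1)) ((m - r) * (n - r)) ∧
    Gr (minorsIdeal k m n (r + 1)) ((m - r) * (n - r)) := by
  have h := ladder_perfect k m n (m - r) _ (fun i => if i < m - r then n - r else 0)
    (fun _ => r + 1) (by
      refine ⟨fun i j hij => ?_, fun i hi => if_neg (by omega), fun i hi => by omega,
        fun i hi => ?_⟩
      · split_ifs <;> omega
      · split_ifs at hi ⊢ <;> omega) rfl
  have h1 : ladder (gen k m n) (fun i => if i < m - r then n - r else 0) (fun _ => r + 1) =
      minorsIdeal k m n (r + 1) := by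
    rw [minorsIdeal_eq_rect]
    apply le_antisymm
    · refine iSup₂_le fun i (hi : 0 < if i < m - r then n - r else 0) => rect_mono ?_ ?_ <;>
        dsimp only <;> split_ifs at hi ⊢ <;> omega
    · refine le_iSup₂_of_le (m - r - 1) (by dsimp only; rw [if_pos (by omega)]; omega)
        (rect_mono (by dsimp only; omega) ?_)
      dsimp only
      rw [if_pos (by omega)]
      omega
  have h2 : ∑ i ∈ Finset.range (m - r), (if i < m - r then n - r else 0) =
      (m - r) * (n - r) := by
    rw [Finset.sum_congr rfl fun i hi => if_pos (Finset.mem_range.1 hi)]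
    simp
  rw [h1, h2] at h
  exact h

theorem minors_columns_pdLE (k : Type) [Field k] (m n l : ℕ) (hm : 1 < m) (hn : l < n) :
    PdLE (MvPolynomial (Fin m × Fin n) k)
      (_ ⧸ minorsIdeal k m n 2 ⊔ rect (gen k m n) 1 m l) ((m - 1) * (n - 1) + l) := by
  have h := ladder_perfect k m n m _
    (fun i => if i < m - 1 then n - 1 else if i < m then l else 0)
    (fun i => if i < m - 1 then 2 else 1) (by
      refine ⟨fun i j hij => ?_, fun i hi => ?_, fun i hi => ?_, fun i hi => ?_⟩
      · split_ifs <;> omega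
      · split_ifs <;> omega
      · split_ifs <;> omega
      · split_ifs at hi ⊢ <;> omega) rfl
  have h1 : ladder (gen k m n) (fun i => if i < m - 1 then n - 1 else if i < m then l else 0)
      (fun i => if i < m - 1 then 2 else 1) =
      minorsIdeal k m n 2 ⊔ rect (gen k m n) 1 m l := by
    rw [minorsIdeal_eq_rect]
    apply le_antisymm
    · refine iSup₂_le fun i hi => ?_
      by_cases h : i < m - 1
      · simp only [if_pos h]
        exact le_sup_of_le_left (rect_mono (by omega) (by omega))
      · simp only [if_neg h] at hi ⊢
        split_ifs at hi ⊢
        · exact le_sup_of_le_right (rect_mono (by omega) (by omega))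
        · omega
    · refine sup_le ?_ ?_
      · by_cases h2 : n < 2
        · rw [rect_eq_bot_of_cols h2]
          exact bot_le
        refine le_iSup₂_of_le (m - 2) (by dsimp only; rw [if_pos (by omega)]; omega) ?_
        simp only [if_pos (show m - 2 < m - 1 by omega)]
        exact rect_mono (by omega) (by omega)
      · by_cases h2 : l < 1
        · rw [rect_eq_bot_of_cols h2]
          exact bot_le
        refine le_iSup₂_of_le (m - 1) (by dsimp only; rw [if_neg (by omega), if_pos (by omega)]; omega) ?_
        simp only [if_neg (show ¬ m - 1 < m - 1 by omega), if_pos (show m - 1 < m by omega)]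
        exact rect_mono (by omega) (by omega)
  have h2 : ∑ i ∈ Finset.range m, (if i < m - 1 then n - 1 else if i < m then l else 0) =
      (m - 1) * (n - 1) + l := by
    obtain ⟨m, rfl⟩ : ∃ m', m = m' + 1 := ⟨m - 1, by omega⟩
    rw [Finset.sum_range_succ, Nat.add_sub_cancel,
      Finset.sum_congr rfl fun i hi => if_pos (Finset.mem_range.1 hi)]
    simp
  rw [h1, h2] at h
  exact h.1

end Semidual

end

section

namespace Semidual
open Abelian TensorProduct

section
variable {R C : Type} [CommRing R] [AddCommGroup C] [Module R C]

theorem IsSD.congr {C' : Type} [AddCommGroup C'] [Module R C'] (h : IsSD R C) (e : C ≃ₗ[R] C') :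
    IsSD R C' where
  fin := have := h.fin; Module.Finite.equiv e
  homothety := by
    have : (algebraMap R (Module.End R C') : R → Module.End R C') =
        e.conj ∘ algebraMap R (Module.End R C) := by
      ext r x
      simp [LinearEquiv.conj_apply]
    rw [this]
    exact e.conj.bijective.comp h.homothety
  ext := fun i hi => ((h.ext i hi).congr_left e).congr_right e

/-- Over a Noetherian ring a semidualizing module maps nontrivially to every nonzero module. -/
theorem IsSD.exists_hom_ne_zero [IsNoetherianRing R] (h : IsSD R C) (X : Type) [AddCommGroup X]
    [Module R X] [Nontrivial X] : ∃ f : C →ₗ[R] X, f ≠ 0 := by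
  have := h.fin
  obtain ⟨x, hx⟩ := exists_ne (0 : X)
  obtain ⟨I, hI, -⟩ := exists_le_isAssociatedPrime_of_isNoetherianRing R x hx
  obtain ⟨hI', y, hy⟩ := (isAssociatedPrime_iff (R := R)).1 hI
  let p : PrimeSpectrum R := ⟨I, hI'⟩
  have hpC : p ∈ Module.support R C := by
    rw [Module.support_eq_zeroLocus, PrimeSpectrum.mem_zeroLocus]
    intro r hr
    have : r = 0 := h.homothety.1 (by
      ext c
      simpa using (Module.mem_annihilator.1 hr) c)
    rw [this]
    exact p.asIdeal.zero_mem
  rw [Module.mem_support_iff_nontrivial_residueField_tensorProduct] at hpC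
  obtain ⟨z, hz⟩ := exists_ne (0 : p.asIdeal.ResidueField ⊗[R] C)
  obtain ⟨f, hf⟩ := Module.Projective.exists_dual_ne_zero p.asIdeal.ResidueField hz
  let g : C →ₗ[R] p.asIdeal.ResidueField :=
    (f.restrictScalars R) ∘ₗ TensorProduct.mk R p.asIdeal.ResidueField C 1
  have hg : g ≠ 0 := by
    intro hg0
    apply hf
    have : f = 0 := by
      apply TensorProduct.AlgebraTensorModule.ext
      intro a c
      have h1 : f ((1 : p.asIdeal.ResidueField) ⊗ₜ[R] c) = 0 := LinearMap.congr_fun hg0 c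
      have h2 : a ⊗ₜ[R] c = a • ((1 : p.asIdeal.ResidueField) ⊗ₜ[R] c) := by
        rw [TensorProduct.smul_tmul', smul_eq_mul, mul_one]
      rw [h2, map_smul, h1, smul_zero, LinearMap.zero_apply]
    rw [this, LinearMap.zero_apply]
  obtain ⟨s, hs⟩ := Module.Finite.fg_top (R := R) (M := C)
  obtain ⟨b, hb⟩ := IsLocalization.exist_integer_multiples (nonZeroDivisors (R ⧸ I)) s
    (fun c => (g c : p.asIdeal.ResidueField))
  obtain ⟨r, hr⟩ := Ideal.Quotient.mk_surjective (b : R ⧸ I)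
  let ι : (R ⧸ I) →ₗ[R] p.asIdeal.ResidueField :=
    (IsScalarTower.toAlgHom R (R ⧸ I) p.asIdeal.ResidueField).toLinearMap
  have hι : Function.Injective ι := IsFractionRing.injective (R ⧸ I) p.asIdeal.ResidueField
  have hbr : ∀ y : p.asIdeal.ResidueField, r • y = (b : R ⧸ I) • y := by
    intro y
    rw [← hr, ← Ideal.Quotient.algebraMap_eq, algebraMap_smul]
  have hrange : ∀ c, (r • g) c ∈ LinearMap.range ι := by
    intro c
    have hc : c ∈ Submodule.span R (s : Set C) := hs ▸ Submodule.mem_top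
    have hle : Submodule.span R (s : Set C) ≤ (LinearMap.range ι).comap (r • g) := by
      rw [Submodule.span_le]
      intro c hc
      obtain ⟨a, ha⟩ := hb c hc
      refine ⟨a, ?_⟩
      rw [LinearMap.smul_apply, hbr]
      exact ha
    exact hle hc
  let e := LinearEquiv.ofInjective ι hι
  let g' : C →ₗ[R] R ⧸ I := e.symm.toLinearMap ∘ₗ (r • g).codRestrict _ hrange
  have hg' : g' ≠ 0 := by
    intro h0
    apply hg
    ext c
    have h1 : (r • g).codRestrict _ hrange c = 0 := by
      apply e.symm.injective
      rw [map_zero]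
      exact LinearMap.congr_fun h0 c
    have h2 : r • g c = 0 := congrArg Subtype.val h1
    rw [hbr, Algebra.smul_def, mul_eq_zero] at h2
    rcases h2 with h2 | h2
    · exfalso
      exact nonZeroDivisors.coe_ne_zero b (hι (h2.trans (map_zero ι).symm))
    · exact h2
  have hk : I ≤ LinearMap.ker (LinearMap.toSpanSingleton R X y) := by
    intro a ha
    rw [hy, Submodule.mem_colon_singleton] at ha
    simpa using ha
  let q : (R ⧸ I) →ₗ[R] X := I.liftQ (LinearMap.toSpanSingleton R X y) hk
  have hq : Function.Injective q := by
    rw [← LinearMap.ker_eq_bot]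
    apply Submodule.ker_liftQ_eq_bot
    intro a ha
    rw [hy, Submodule.mem_colon_singleton]
    simpa using ha
  refine ⟨q ∘ₗ g', fun h0 => hg' ?_⟩
  ext c
  apply hq
  exact (LinearMap.congr_fun h0 c).trans (map_zero q).symm


theorem IsSD.exists_smul (h : IsSD R C) (f : C →ₗ[R] C) :
    ∃ r : R, ∀ c, f c = r • c := by
  obtain ⟨r, hr⟩ := h.homothety.2 f
  exact ⟨r, fun c => by rw [← hr]; rfl⟩

theorem IsSD.eq_zero_of_smul (h : IsSD R C) {r : R} (hr : ∀ c : C, r • c = 0) : r = 0 :=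
  h.homothety.1 (by ext c; simpa using hr c)

theorem IsSD.regular [IsNoetherianRing R] (h : IsSD R C) {s : R} (hs : ∀ x, s * x = 0 → x = 0)
    (y : C) (hy : s • y = 0) : y = 0 := by
  by_contra hne
  let K : Submodule R C := LinearMap.ker (LinearMap.lsmul R C s)
  have : Nontrivial K := ⟨⟨⟨y, hy⟩, 0, fun h => hne (congrArg Subtype.val h)⟩⟩
  obtain ⟨f, hf⟩ := h.exists_hom_ne_zero K
  obtain ⟨r, hr⟩ := h.exists_smul (K.subtype ∘ₗ f)
  have hr0 : r = 0 := by
    apply hs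
    apply h.eq_zero_of_smul
    intro c
    rw [mul_smul, ← hr]
    exact (f c).2
  apply hf
  ext c
  have := hr c
  rw [hr0, zero_smul] at this
  exact this

theorem IsSD.regular_quotient [IsNoetherianRing R] (h : IsSD R C) {d s : R}
    (hd : ∀ x, d * x = 0 → x = 0) (hs : ∀ x, d ∣ s * x → d ∣ x) (y : C)
    (hy : ∃ z, s • y = d • z) : ∃ z, y = d • z := by
  have := h.fin
  let μ : C →ₗ[R] C := LinearMap.lsmul R C d
  have hμ : Function.Injective μ := by
    rw [injective_iff_map_eq_zero]
    exact fun z hz => h.regular hd z hz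
  have hses := ses_of_injective hμ
  by_contra hne
  let K : Submodule R (C ⧸ LinearMap.range μ) := LinearMap.ker (LinearMap.lsmul R _ s)
  have : Nontrivial K := by
    obtain ⟨z, hz⟩ := hy
    refine ⟨⟨⟨(LinearMap.range μ).mkQ y, ?_⟩, 0, fun h => hne ?_⟩⟩
    · change s • (LinearMap.range μ).mkQ y = 0
      rw [← map_smul, hz]
      exact (Submodule.Quotient.mk_eq_zero _).2 ⟨z, rfl⟩
    · obtain ⟨w, hw⟩ := (Submodule.Quotient.mk_eq_zero _).1 (congrArg Subtype.val h)
      exact ⟨w, hw.symm⟩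
  obtain ⟨f, hf⟩ := h.exists_hom_ne_zero K
  obtain ⟨ψ, hψ⟩ := ExtVanish.exists_lift hses (h.ext 1 one_pos) (K.subtype ∘ₗ f)
  obtain ⟨r, hr⟩ := h.exists_smul ψ
  have hfr : ∀ c, (f c : C ⧸ LinearMap.range μ) = (LinearMap.range μ).mkQ (r • c) := by
    intro c
    rw [← hr]
    exact (LinearMap.congr_fun hψ c).symm
  have hrange : ∀ c, ((s * r) • LinearMap.id (R := R) (M := C)) c ∈ LinearMap.range μ := by
    intro c
    have h1 : s • (f c : C ⧸ LinearMap.range μ) = 0 := (f c).2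
    rw [hfr, ← map_smul, ← mul_smul] at h1
    exact (Submodule.Quotient.mk_eq_zero _).1 h1
  let e := LinearEquiv.ofInjective μ hμ
  obtain ⟨t, ht⟩ := h.exists_smul (e.symm.toLinearMap ∘ₗ
    ((s * r) • LinearMap.id (R := R) (M := C)).codRestrict _ hrange)
  have hdr : d ∣ s * r := by
    refine ⟨t, sub_eq_zero.1 (h.eq_zero_of_smul fun c => ?_)⟩
    rw [sub_smul, mul_smul d, ← ht c, sub_eq_zero]
    have h1 : e (e.symm (((s * r) • LinearMap.id (R := R) (M := C)).codRestrict _ hrange c)) =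
      ((s * r) • LinearMap.id (R := R) (M := C)).codRestrict _ hrange c := e.apply_symm_apply _
    exact (congrArg Subtype.val h1).symm
  obtain ⟨w, hw⟩ := hs r hdr
  apply hf
  ext c
  rw [hfr, hw, mul_smul]
  exact (Submodule.Quotient.mk_eq_zero _).2 ⟨w • c, rfl⟩
end
end Semidual

end

section

namespace Semidual
open Abelian TensorProduct

/-- A domain `R` inside a domain `T` with an element `d = u v` such that `u` and `v` are primes
of `T`, together with specializations of `T` that are constant on `R`. -/
structure Frame (k R T A B : Type) [Field k] [CommRing R] [CommRing T] [CommRing A] [CommRing B]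
    [Algebra k T] [Algebra k A] [Algebra k B] [Algebra R T] (d : R) (u v u' v' : T)
    (α : T →ₐ[k] A) (β : T →ₐ[k] B) : Prop where
  inj : Function.Injective (algebraMap R T)
  prime_left : Prime u
  prime_right : Prime v
  not_dvd : ¬ u ∣ v
  not_dvd' : ¬ v ∣ u
  map_d : algebraMap R T d = u * v
  not_dvd_left : ¬ u ∣ u'
  mem_left : ∃ s, algebraMap R T s = u' * v
  not_dvd_right : ¬ v ∣ v'
  mem_right : ∃ s, algebraMap R T s = u * v'
  contract : ∀ x y, algebraMap R T x ∣ algebraMap R T y → x ∣ y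
  const_left : ∀ x, ∃ c : k, α (algebraMap R T x) = algebraMap k A c
  const_right : ∀ x, ∃ c : k, β (algebraMap R T x) = algebraMap k B c
  not_isUnit_left : ¬ IsUnit (α u)
  not_isUnit_right : ¬ IsUnit (β v)
  linearIndependent_left : ∀ a b : k, a • α u + b • α u' = 0 → a = 0 ∧ b = 0
  linearIndependent_right : ∀ a b : k, a • β v + b • β v' = 0 → a = 0 ∧ b = 0

namespace Frame
variable {k R T A B : Type} [Field k] [CommRing R] [CommRing T] [CommRing A] [CommRing B]
    [IsDomain R] [IsDomain T] [IsDomain A] [IsDomain B]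
    [Algebra k T] [Algebra k A] [Algebra k B] [Algebra R T] {d : R} {u v u' v' : T}
    {α : T →ₐ[k] A} {β : T →ₐ[k] B}

omit [IsDomain R] [IsDomain T] [IsDomain A] [IsDomain B] in
theorem symm (F : Frame k R T A B d u v u' v' α β) : Frame k R T B A d v u v' u' β α where
  inj := F.inj
  prime_left := F.prime_right
  prime_right := F.prime_left
  not_dvd := F.not_dvd'
  not_dvd' := F.not_dvd
  map_d := F.map_d.trans (mul_comm _ _)
  not_dvd_left := F.not_dvd_right
  mem_left := let ⟨s, hs⟩ := F.mem_right; ⟨s, hs.trans (mul_comm _ _)⟩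
  not_dvd_right := F.not_dvd_left
  mem_right := let ⟨s, hs⟩ := F.mem_left; ⟨s, hs.trans (mul_comm _ _)⟩
  contract := F.contract
  const_left := F.const_right
  const_right := F.const_left
  not_isUnit_left := F.not_isUnit_right
  not_isUnit_right := F.not_isUnit_left
  linearIndependent_left := F.linearIndependent_right
  linearIndependent_right := F.linearIndependent_left

omit [IsDomain R] [IsDomain A] [IsDomain B] in
theorem d_ne_zero (F : Frame k R T A B d u v u' v' α β) : d ≠ 0 := by
  intro h
  have := F.map_d
  rw [h, map_zero] at this
  exact mul_ne_zero F.prime_left.ne_zero F.prime_right.ne_zero this.symm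

omit [IsDomain R] [IsDomain T] [IsDomain A] [IsDomain B] in
theorem dvd_of_dvd (F : Frame k R T A B d u v u' v' α β) {x : R}
    (hu : u ∣ algebraMap R T x) (hv : v ∣ algebraMap R T x) : d ∣ x := by
  apply F.contract
  rw [F.map_d]
  obtain ⟨y, hy⟩ := hu
  rw [hy] at hv ⊢
  exact mul_dvd_mul_left _ ((F.prime_right.dvd_or_dvd hv).resolve_left F.not_dvd')

omit [IsDomain R] [IsDomain T] [IsDomain A] [IsDomain B] in
theorem regular_of_not_dvd (F : Frame k R T A B d u v u' v' α β) {s : R}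
    (hu : ¬ u ∣ algebraMap R T s) (hv : ¬ v ∣ algebraMap R T s) (x : R) (hx : d ∣ s * x) :
    d ∣ x := by
  have h : u * v ∣ algebraMap R T s * algebraMap R T x := by
    rw [← F.map_d, ← map_mul]; exact map_dvd _ hx
  exact F.dvd_of_dvd ((F.prime_left.dvd_or_dvd ((dvd_mul_right u v).trans h)).resolve_left hu)
    ((F.prime_right.dvd_or_dvd ((dvd_mul_left v u).trans h)).resolve_left hv)

omit [IsDomain A] [IsDomain B] in
/-- `u` defines a discrete valuation on `R`. -/
theorem exists_not_dvd (F : Frame k R T A B d u v u' v' α β) (a : ℕ) :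
    ∀ f g : R, u ^ a ∣ algebraMap R T g → ¬ u ^ (a + 1) ∣ algebraMap R T f →
      ∃ s, ¬ u ∣ algebraMap R T s ∧ f ∣ s * g := by
  induction a with
  | zero =>
    intro f g _ hf
    exact ⟨f, by simpa using hf, dvd_mul_right f g⟩
  | succ a ih =>
    intro f g hg hf
    by_cases huf : u ∣ algebraMap R T f
    · obtain ⟨s, hs⟩ := F.mem_left
      have hsv : v ∣ algebraMap R T s := hs ▸ dvd_mul_left v u'
      have key : ∀ x, u ∣ algebraMap R T x → ∃ y, s * x = d * y ∧
          u * algebraMap R T y = u' * algebraMap R T x := by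
        intro x hx
        obtain ⟨y, hy⟩ : d ∣ s * x := F.dvd_of_dvd (by rw [map_mul]; exact hx.mul_left _)
          (by rw [map_mul]; exact hsv.mul_right _)
        refine ⟨y, hy, mul_right_cancel₀ F.prime_right.ne_zero ?_⟩
        have := congrArg (algebraMap R T) hy
        rw [map_mul, map_mul, hs, F.map_d] at this
        linear_combination -this
      have hs0 : s ≠ 0 := by
        intro h
        rw [h, map_zero] at hs
        rcases mul_eq_zero.1 hs.symm with h | h
        · exact F.not_dvd_left (h ▸ dvd_zero u)
        · exact F.prime_right.ne_zero h
      obtain ⟨f', hf1, hf2⟩ := key f huf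
      obtain ⟨g', hg1, hg2⟩ := key g ((dvd_pow_self u a.succ_ne_zero).trans hg)
      obtain ⟨t, ht, w, hw⟩ := ih f' g' (by
          have : u * u ^ a ∣ u * algebraMap R T g' := by
            rw [hg2, ← pow_succ']; exact hg.mul_left _
          exact (mul_dvd_mul_iff_left F.prime_left.ne_zero).1 this) (by
          intro h
          apply hf
          have : u ^ (a + 1 + 1) ∣ u' * algebraMap R T f := by
            rw [← hf2, pow_succ']; exact mul_dvd_mul_left _ h
          exact F.prime_left.pow_dvd_of_dvd_mul_left _ F.not_dvd_left this)
      refine ⟨t, ht, w, mul_left_cancel₀ hs0 ?_⟩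
      linear_combination t * hg1 + d * hw - w * hf1
    · exact ⟨f, huf, dvd_mul_right f g⟩

omit [IsDomain A] [IsDomain B] in
theorem exists_pow [IsNoetherianRing R] (F : Frame k R T A B d u v u' v' α β) (J : Ideal R)
    (hJ : IsSD R J) {M : ℕ} (hM : d ^ M ∈ J) :
    ∃ a b, ∀ f, f ∈ J ↔ u ^ a ∣ algebraMap R T f ∧ v ^ b ∣ algebraMap R T f := by
  have key : ∀ (p q : T), Prime p → ¬ p ∣ q → algebraMap R T d = p * q →
      ∃ a, (∀ f ∈ J, p ^ a ∣ algebraMap R T f) ∧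
        ∃ f ∈ J, ¬ p ^ (a + 1) ∣ algebraMap R T f := by
    intro p q hp hpq hd
    classical
    by_contra! hcon
    have : ∀ a, ∀ f ∈ J, p ^ a ∣ algebraMap R T f := by
      intro a
      induction a with
      | zero => simp
      | succ a ih => exact hcon a ih
    have h1 := this (M + 1) _ hM
    rw [map_pow, hd, mul_pow, pow_succ,
      mul_dvd_mul_iff_left (pow_ne_zero _ hp.ne_zero)] at h1
    exact hpq (hp.dvd_of_dvd_pow h1)
  obtain ⟨a, ha, f₁, hf₁, hf₁'⟩ := key u v F.prime_left F.not_dvd F.map_d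
  obtain ⟨b, hb, f₂, hf₂, hf₂'⟩ := key v u F.prime_right F.not_dvd'
    (F.map_d.trans (mul_comm _ _))
  refine ⟨a, b, fun f => ⟨fun hf => ⟨ha f hf, hb f hf⟩, fun ⟨hfa, hfb⟩ => ?_⟩⟩
  have step : ∀ g, u ^ a ∣ algebraMap R T g → v ^ b ∣ algebraMap R T g → d * g ∈ J → g ∈ J := by
    intro g hga hgb hdg
    obtain ⟨s₁, hs₁, w₁, hw₁⟩ := F.exists_not_dvd a f₁ g hga hf₁'
    obtain ⟨s₂, hs₂, w₂, hw₂⟩ := F.symm.exists_not_dvd b f₂ g hgb hf₂'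
    have h1 : s₁ * g ∈ J := hw₁ ▸ J.mul_mem_right _ hf₁
    have h2 : s₂ * g ∈ J := hw₂ ▸ J.mul_mem_right _ hf₂
    obtain ⟨s, hsu, hsv, hs⟩ : ∃ s, ¬ u ∣ algebraMap R T s ∧ ¬ v ∣ algebraMap R T s ∧
        s * g ∈ J := by
      by_cases h3 : v ∣ algebraMap R T s₁
      · by_cases h4 : u ∣ algebraMap R T s₂
        · refine ⟨s₁ + s₂, ?_, ?_, by rw [add_mul]; exact J.add_mem h1 h2⟩
          · rwa [map_add, dvd_add_left h4]
          · rwa [map_add, dvd_add_right h3]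
        · exact ⟨s₂, h4, hs₂, h2⟩
      · exact ⟨s₁, hs₁, h3, h1⟩
    obtain ⟨z, hz⟩ := hJ.regular_quotient (d := d) (s := s)
      (fun x hx => (mul_eq_zero.1 hx).resolve_left F.d_ne_zero) (F.regular_of_not_dvd hsu hsv)
      ⟨d * g, hdg⟩ ⟨⟨s * g, hs⟩, Subtype.ext (by simp only [SetLike.val_smul, smul_eq_mul]; ring)⟩
    have : d * g = d * z := congrArg Subtype.val hz
    rw [mul_left_cancel₀ F.d_ne_zero this]
    exact z.2
  have hN : ∀ N, d ^ N * f ∈ J → f ∈ J := by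
    intro N
    induction N with
    | zero => simp
    | succ N ih =>
      intro h
      apply ih
      apply step
      · rw [map_mul]; exact hfa.mul_left _
      · rw [map_mul]; exact hfb.mul_left _
      · rwa [pow_succ', mul_assoc] at h
  exact hN M (J.mul_mem_right _ hM)

end Frame
end Semidual

end

section

namespace Semidual
open Abelian TensorProduct

/-- The fractional ideal of all `x` with `u ^ i * x ∈ R`. -/
def fracIdeal (R : Type) {T : Type} [CommRing R] [CommRing T] [Algebra R T] (u : T) (i : ℕ) :
    Submodule R T :=
  (LinearMap.range (Algebra.linearMap R T)).comap (LinearMap.mulLeft R (u ^ i))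

theorem mem_fracIdeal {R T : Type} [CommRing R] [CommRing T] [Algebra R T] {u : T} {i : ℕ}
    {x : T} : x ∈ fracIdeal R u i ↔ ∃ f, algebraMap R T f = u ^ i * x := Iff.rfl

namespace Frame
variable {k R T A B : Type} [Field k] [CommRing R] [CommRing T] [CommRing A] [CommRing B]
    [IsDomain R] [IsDomain T] [IsDomain A] [IsDomain B]
    [Algebra k T] [Algebra k A] [Algebra k B] [Algebra R T] {d : R} {u v u' v' : T}
    {α : T →ₐ[k] A} {β : T →ₐ[k] B}

omit [IsDomain A] [IsDomain B] [IsDomain R] in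
theorem nonempty_equiv (F : Frame k R T A B d u v u' v' α β) (J : Ideal R) (b i : ℕ)
    (hJ : ∀ f, f ∈ J ↔ u ^ (b + i) ∣ algebraMap R T f ∧ v ^ b ∣ algebraMap R T f) :
    Nonempty (J ≃ₗ[R] fracIdeal R u i) := by
  have h0 : u ^ (b + i) * v ^ b ≠ 0 :=
    mul_ne_zero (pow_ne_zero _ F.prime_left.ne_zero) (pow_ne_zero _ F.prime_right.ne_zero)
  have h1 : Function.Injective (LinearMap.mulLeft R (u ^ (b + i) * v ^ b)) :=
    fun x y h => mul_left_cancel₀ h0 h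
  have h2 : Submodule.map (Algebra.linearMap R T) J =
      (fracIdeal R u i).map (LinearMap.mulLeft R (u ^ (b + i) * v ^ b)) := by
    ext x
    constructor
    · rintro ⟨f, hf, rfl⟩
      obtain ⟨⟨w, hw⟩, hv⟩ := (hJ f).1 hf
      rw [hw] at hv
      obtain ⟨y, rfl⟩ := F.prime_right.pow_dvd_of_dvd_mul_left b
        (fun h => F.not_dvd' (F.prime_right.dvd_of_dvd_pow h)) hv
      refine ⟨y, ?_, by simp [hw]⟩
      have h3 : algebraMap R T f = algebraMap R T (d ^ b) * (u ^ i * y) := by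
        rw [hw, map_pow, F.map_d]; ring
      obtain ⟨z, rfl⟩ := F.contract (d ^ b) f ⟨_, h3⟩
      refine ⟨z, ?_⟩
      rw [map_mul] at h3
      exact mul_left_cancel₀ (by rw [map_pow, F.map_d]; exact pow_ne_zero _ (mul_ne_zero
        F.prime_left.ne_zero F.prime_right.ne_zero)) h3
    · rintro ⟨y, ⟨f, hf⟩, rfl⟩
      have hf' : algebraMap R T f = u ^ i * y := hf
      have h3 : algebraMap R T (d ^ b * f) = u ^ (b + i) * v ^ b * y := by
        rw [map_mul, map_pow, F.map_d, hf']; ring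
      refine ⟨d ^ b * f, (hJ _).2 ⟨?_, ?_⟩, h3⟩
      · rw [h3, mul_assoc]; exact dvd_mul_right _ _
      · rw [h3]; exact (dvd_mul_left _ _).mul_right _
  exact ⟨((Submodule.equivMapOfInjective (Algebra.linearMap R T) F.inj J).trans
    (LinearEquiv.ofEq _ _ h2)).trans (Submodule.equivMapOfInjective _ h1 _).symm⟩

omit [IsDomain A] [IsDomain B] in
theorem exists_equiv [IsNoetherianRing R] (F : Frame k R T A B d u v u' v' α β) (J : Ideal R)
    (hJ : IsSD R J) {M : ℕ} (hM : d ^ M ∈ J) :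
    ∃ i, Nonempty (J ≃ₗ[R] fracIdeal R u i) ∨ Nonempty (J ≃ₗ[R] fracIdeal R v i) := by
  obtain ⟨a, b, h⟩ := F.exists_pow J hJ hM
  rcases le_total a b with hab | hab
  · obtain ⟨i, rfl⟩ := Nat.exists_eq_add_of_le hab
    exact ⟨i, Or.inr (F.symm.nonempty_equiv J a i fun f => (h f).trans and_comm)⟩
  · obtain ⟨i, rfl⟩ := Nat.exists_eq_add_of_le hab
    exact ⟨i, Or.inl (F.nonempty_equiv J b i h)⟩

omit [IsDomain R] [IsDomain T] [IsDomain B] in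
theorem left_eq_zero (F : Frame k R T A B d u v u' v' α β) {i : ℕ} (hi : 0 < i) {x : T}
    (hx : x ∈ fracIdeal R u i) : α x = 0 := by
  obtain ⟨f, hf⟩ := mem_fracIdeal.1 hx
  obtain ⟨c, hc⟩ := F.const_left f
  rw [hf, map_mul, map_pow] at hc
  by_cases h : c = 0
  · rw [h, map_zero] at hc
    refine (mul_eq_zero.1 hc).resolve_left (pow_ne_zero _ fun h0 => ?_)
    exact one_ne_zero (F.linearIndependent_left 1 0 (by rw [h0, smul_zero, zero_smul, add_zero])).1
  · exfalso
    have h1 : IsUnit (α u ^ i * α x) := hc ▸ (IsUnit.mk0 c h).map (algebraMap k A)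
    exact F.not_isUnit_left ((isUnit_pow_iff hi.ne').1 (isUnit_of_mul_isUnit_left h1))

omit [IsDomain R] [IsDomain T] [IsDomain A] [IsDomain B] in
theorem pow_mul_pow_mem (F : Frame k R T A B d u v u' v' α β) (a b : ℕ) :
    v ^ a * v' ^ b ∈ fracIdeal R u (a + b) := by
  obtain ⟨s, hs⟩ := F.mem_right
  exact ⟨d ^ a * s ^ b, by
    simp only [Algebra.linearMap_apply, map_mul, map_pow, F.map_d, hs, LinearMap.mulLeft_apply]
    ring⟩

omit [IsDomain R] [IsDomain A] [IsDomain B] in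
/-- Homomorphisms out of `fracIdeal R u i` are multiplications by elements of `T`. -/
theorem exists_mul (F : Frame k R T A B d u v u' v' α β) {i : ℕ} {N : Submodule R T}
    (ψ : fracIdeal R u i →ₗ[R] N) : ∃ q : T, ∀ x, (ψ x : T) = q * x := by
  have comm : ∀ x y : fracIdeal R u i, (x : T) * ψ y = y * ψ x := by
    intro x y
    obtain ⟨f, hf⟩ := mem_fracIdeal.1 x.2
    obtain ⟨g, hg⟩ := mem_fracIdeal.1 y.2
    have h1 : f • y = g • x := by
      apply Subtype.ext
      simp only [SetLike.val_smul, Algebra.smul_def, hf, hg]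
      ring
    have h2 := congrArg Subtype.val (congrArg ψ h1)
    simp only [map_smul, SetLike.val_smul, Algebra.smul_def, hf, hg, mul_assoc] at h2
    exact mul_left_cancel₀ (pow_ne_zero i F.prime_left.ne_zero) h2
  have hv : v ^ i ∈ fracIdeal R u i := by simpa using F.pow_mul_pow_mem i 0
  have hv' : v' ^ i ∈ fracIdeal R u i := by
    have := F.pow_mul_pow_mem 0 i
    rwa [pow_zero, one_mul, zero_add] at this
  obtain ⟨q, hq⟩ : v ^ i ∣ ψ ⟨v ^ i, hv⟩ := by
    refine F.prime_right.pow_dvd_of_dvd_mul_left i (a := v' ^ i)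
      (fun h => F.not_dvd_right (F.prime_right.dvd_of_dvd_pow h)) ?_
    exact ⟨_, comm ⟨v' ^ i, hv'⟩ ⟨v ^ i, hv⟩⟩
  refine ⟨q, fun x => mul_left_cancel₀ (pow_ne_zero i F.prime_right.ne_zero) ?_⟩
  rw [← comm x ⟨v ^ i, hv⟩, hq]
  ring

omit [IsDomain R] [IsDomain T] [IsDomain A] in
theorem _root_.Semidual.eq_zero_of_surjective {M N : Submodule R T} (γ : T →+* A)
    (h : ∀ (ψ : M →ₗ[R] N) x, γ (ψ x) = 0)
    (hs : Function.Surjective (TensorProduct.lift (LinearMap.applyₗ (R := R) (M := M) (M₂ := N))))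
    {y : T} (hy : y ∈ N) : γ y = 0 := by
  obtain ⟨z, hz⟩ := hs ⟨y, hy⟩
  suffices H : γ (TensorProduct.lift (LinearMap.applyₗ (R := R) (M := M) (M₂ := N)) z : N) = 0 by
    rwa [hz] at H
  clear hz
  induction z using TensorProduct.induction_on with
  | zero => simp
  | tmul x ψ => exact h ψ x
  | add x y hx hy => rw [map_add, Submodule.coe_add, map_add, hx, hy, add_zero]

omit [IsDomain R] [IsDomain A] in
theorem not_surjective_of_lt (F : Frame k R T A B d u v u' v' α β) {i e : ℕ} (h : e < i)
    (hs : Function.Surjective (TensorProduct.lift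
      (LinearMap.applyₗ (R := R) (M := fracIdeal R u i) (M₂ := fracIdeal R u e)))) : False := by
  obtain ⟨j, rfl⟩ := Nat.exists_eq_add_of_lt h
  have hv : β v ≠ 0 := fun h0 => one_ne_zero
    (F.linearIndependent_right 1 0 (by rw [h0, smul_zero, zero_smul, add_zero])).1
  have hmem : v ^ e ∈ fracIdeal R u e := by simpa using F.pow_mul_pow_mem e 0
  refine pow_ne_zero e hv ?_
  rw [← map_pow]
  refine eq_zero_of_surjective β.toRingHom (fun ψ x => ?_) hs hmem
  obtain ⟨q, hq⟩ := F.exists_mul ψ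
  have hq' : q ∈ fracIdeal R v (j + 1) := by
    have h1 : v ^ (e + j + 1) ∈ fracIdeal R u (e + j + 1) := by
      simpa using F.pow_mul_pow_mem (e + j + 1) 0
    obtain ⟨f, hf⟩ := mem_fracIdeal.1 (ψ ⟨_, h1⟩).2
    have hf' : algebraMap R T f = algebraMap R T (d ^ e) * (v ^ (j + 1) * q) := by
      rw [hf, hq, map_pow, F.map_d]; ring
    obtain ⟨g, rfl⟩ := F.contract _ _ ⟨_, hf'⟩
    rw [map_mul] at hf'
    exact ⟨g, mul_left_cancel₀ (by rw [map_pow, F.map_d]; exact pow_ne_zero _ (mul_ne_zero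
        F.prime_left.ne_zero F.prime_right.ne_zero)) hf'⟩
  change β (ψ x) = 0
  rw [hq, map_mul, F.symm.left_eq_zero j.succ_pos hq', zero_mul]

omit [IsDomain R] [IsDomain B] in
theorem not_surjective (F : Frame k R T A B d u v u' v' α β) {i e : ℕ} (h : 0 < i)
    (hs : Function.Surjective (TensorProduct.lift
      (LinearMap.applyₗ (R := R) (M := fracIdeal R u i) (M₂ := fracIdeal R v e)))) : False := by
  have hu : α u ≠ 0 := fun h0 => one_ne_zero
    (F.linearIndependent_left 1 0 (by rw [h0, smul_zero, zero_smul, add_zero])).1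
  have hmem : u ^ e ∈ fracIdeal R v e := by simpa using F.symm.pow_mul_pow_mem e 0
  refine pow_ne_zero e hu ?_
  rw [← map_pow]
  refine eq_zero_of_surjective α.toRingHom (fun ψ x => ?_) hs hmem
  obtain ⟨q, hq⟩ := F.exists_mul ψ
  change α (ψ x) = 0
  rw [hq, map_mul, F.left_eq_zero h x.2, mul_zero]

omit [IsDomain R] [IsDomain T] [IsDomain A] in
theorem exists_dual (F : Frame k R T A B d u v u' v' α β) (p : ℕ) :
    ∃ f : B →ₗ[k] k, f (β (v ^ (p + 1))) ≠ 0 ∧ f (β (v ^ p * v')) = 0 := by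
  have hv : β v ≠ 0 := fun h0 => one_ne_zero
    (F.linearIndependent_right 1 0 (by rw [h0, smul_zero, zero_smul, add_zero])).1
  obtain ⟨f, hf, hf'⟩ := Submodule.exists_le_ker_of_notMem
    (p := Submodule.span k {β (v ^ p * v')}) (v := β (v ^ (p + 1))) (by
      rw [Submodule.mem_span_singleton]
      rintro ⟨a, ha⟩
      have h1 : β v ^ p * ((-1 : k) • β v + a • β v') = 0 := by
        rw [map_mul, map_pow, map_pow, pow_succ] at ha
        rw [mul_add, mul_smul_comm, mul_smul_comm, ha, neg_one_smul, neg_add_cancel]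
      have h2 := F.linearIndependent_right _ _ ((mul_eq_zero.1 h1).resolve_left (pow_ne_zero _ hv))
      exact neg_ne_zero.2 one_ne_zero h2.1)
  exact ⟨f, hf, hf' (Submodule.mem_span_singleton_self _)⟩

omit [IsDomain R] [IsDomain T] [IsDomain A] in
theorem not_injective (F : Frame k R T A B d u v u' v' α β) {i e : ℕ} (hi : 0 < i) (h : i < e)
    (hs : Function.Injective (TensorProduct.lift
      (LinearMap.applyₗ (R := R) (M := fracIdeal R u i) (M₂ := fracIdeal R u e)))) : False := by
  obtain ⟨p, rfl⟩ := Nat.exists_eq_add_of_lt hi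
  obtain ⟨l, rfl⟩ := Nat.exists_eq_add_of_lt h
  rw [zero_add] at *
  have hv : β v ≠ 0 := fun h0 => one_ne_zero
    (F.linearIndependent_right 1 0 (by rw [h0, smul_zero, zero_smul, add_zero])).1
  have hv' : β v' ≠ 0 := fun h0 => one_ne_zero
    (F.linearIndependent_right 0 1 (by rw [h0, smul_zero, zero_smul, add_zero])).2
  have m1 : v ^ (p + 1) ∈ fracIdeal R u (p + 1) := by simpa using F.pow_mul_pow_mem (p + 1) 0
  have m2 : v ^ p * v' ∈ fracIdeal R u (p + 1) := by simpa using F.pow_mul_pow_mem p 1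
  have hmul : ∀ q ∈ fracIdeal R u (l + 1), ∀ x ∈ fracIdeal R u (p + 1),
      LinearMap.mulLeft R q x ∈ fracIdeal R u (p + 1 + l + 1) := by
    rintro q ⟨a, ha⟩ x ⟨b, hb⟩
    refine ⟨a * b, ?_⟩
    simp only [Algebra.linearMap_apply, LinearMap.mulLeft_apply, map_mul] at ha hb ⊢
    rw [ha, hb]; ring
  let ψ₁ : fracIdeal R u (p + 1) →ₗ[R] fracIdeal R u (p + 1 + l + 1) :=
    (LinearMap.mulLeft R (v ^ l * v')).restrict (hmul _ (by simpa using F.pow_mul_pow_mem l 1))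
  let ψ₂ : fracIdeal R u (p + 1) →ₗ[R] fracIdeal R u (p + 1 + l + 1) :=
    (LinearMap.mulLeft R (v ^ (l + 1))).restrict
      (hmul _ (by simpa using F.pow_mul_pow_mem (l + 1) 0))
  obtain ⟨f, hf, hf'⟩ := F.exists_dual p
  obtain ⟨g, hg⟩ := Module.Projective.exists_dual_ne_zero k
    (x := β ((v ^ l * v') * v ^ (p + 1))) (by
      rw [map_mul, map_mul, map_pow, map_pow]
      exact mul_ne_zero (mul_ne_zero (pow_ne_zero _ hv) hv') (pow_ne_zero _ hv))
  let _ : Module R B := Module.compHom B (β.toRingHom.comp (algebraMap R T))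
  have smul_def : ∀ (r : R) (b : B), r • b = β (algebraMap R T r) * b := fun _ _ => rfl
  have lin : ∀ (f : B →ₗ[k] k) (r : R) (x : T), algebraMap k B (f (β (r • x))) =
      r • algebraMap k B (f (β x)) := by
    intro f r x
    obtain ⟨c, hc⟩ := F.const_right r
    rw [smul_def, Algebra.smul_def, map_mul, hc, ← Algebra.smul_def, map_smul, smul_eq_mul,
      map_mul]
  let Φ : fracIdeal R u (p + 1) ⊗[R] (fracIdeal R u (p + 1) →ₗ[R] fracIdeal R u (p + 1 + l + 1))
      →ₗ[R] B := TensorProduct.lift (LinearMap.mk₂ R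
    (fun x ψ => algebraMap k B (f (β x)) * algebraMap k B (g (β (ψ ⟨_, m1⟩))))
    (fun x y ψ => by simp [add_mul])
    (fun r x ψ => by
      rw [SetLike.val_smul, lin, smul_def, smul_def, mul_assoc])
    (fun x ψ χ => by simp [mul_add])
    (fun r x ψ => by
      rw [LinearMap.smul_apply, SetLike.val_smul, lin, smul_def, smul_def, mul_left_comm]))
  have hz : (⟨_, m1⟩ : fracIdeal R u (p + 1)) ⊗ₜ[R] ψ₁ -
      (⟨_, m2⟩ : fracIdeal R u (p + 1)) ⊗ₜ[R] ψ₂ = 0 := by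
    apply hs
    rw [map_zero, map_sub, TensorProduct.lift.tmul, TensorProduct.lift.tmul, sub_eq_zero]
    apply Subtype.ext
    change (v ^ l * v') * v ^ (p + 1) = v ^ (l + 1) * (v ^ p * v')
    ring
  have h1 := congrArg Φ hz
  rw [map_zero, map_sub, sub_eq_zero] at h1
  have h2 : algebraMap k B (f (β (v ^ (p + 1)))) *
      algebraMap k B (g (β ((v ^ l * v') * v ^ (p + 1)))) =
      algebraMap k B (f (β (v ^ p * v'))) *
      algebraMap k B (g (β (v ^ (l + 1) * v ^ (p + 1)))) := h1
  rw [hf', map_zero, zero_mul, ← map_mul] at h2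
  exact mul_ne_zero hf hg ((map_eq_zero_iff _ (algebraMap k B).injective).1 h2)

omit [IsDomain R] [IsDomain T] [IsDomain A] [IsDomain B] in
theorem nonempty_equiv_self (F : Frame k R T A B d u v u' v' α β) :
    Nonempty (fracIdeal R u 0 ≃ₗ[R] R) := by
  have : fracIdeal R u 0 = LinearMap.range (Algebra.linearMap R T) := by
    ext x
    simp [fracIdeal]
  exact ⟨(LinearEquiv.ofEq _ _ this).trans (LinearEquiv.ofInjective _ F.inj).symm⟩

omit [IsDomain R] in
/-- Two semidualizing fractional ideals, the second of finite injective dimension. -/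
theorem equiv_of_equiv [IsNoetherianRing R] (F : Frame k R T A B d u v u' v' α β) {i : ℕ}
    {C E : Type} [AddCommGroup C] [Module R C] [AddCommGroup E] [Module R E] (hC : IsSD R C)
    (hE : IsSD R E) (hE' : FID R E) (e : C ≃ₗ[R] fracIdeal R u i)
    (h : ∃ j, Nonempty (E ≃ₗ[R] fracIdeal R u j) ∨ Nonempty (E ≃ₗ[R] fracIdeal R v j)) :
    Nonempty (C ≃ₗ[R] R) ∨ Nonempty (C ≃ₗ[R] E) := by
  rcases Nat.eq_zero_or_pos i with rfl | hi
  · exact Or.inl (F.nonempty_equiv_self.map e.trans)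
  have key : ∀ N : Submodule R T, (E ≃ₗ[R] N) → Function.Bijective (TensorProduct.lift
      (LinearMap.applyₗ (R := R) (M := fracIdeal R u i) (M₂ := N))) := by
    intro N f
    have := (hE.congr f).fin
    exact (hC.congr e).eval_bijective (hE'.imp fun n hn K _ _ i hi => (hn K i hi).congr_right f)
  obtain ⟨j, ⟨⟨f⟩⟩ | ⟨⟨f⟩⟩⟩ := h
  · have := key _ f
    rcases lt_trichotomy i j with hij | rfl | hij
    · exact (F.not_injective hi hij this.1).elim
    · exact Or.inr ⟨e.trans f.symm⟩
    · exact (F.not_surjective_of_lt hij this.2).elim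
  · exact (F.not_surjective hi (key _ f).2).elim

/-- The classification of semidualizing modules over a frame. -/
theorem equiv_or_equiv [IsNoetherianRing R] (F : Frame k R T A B d u v u' v' α β)
    (hF : ∀ (C : Type) [AddCommGroup C] [Module R C], IsSD R C →
      ∃ (J : Ideal R) (M : ℕ), d ^ M ∈ J ∧ Nonempty (C ≃ₗ[R] J))
    {C E : Type} [AddCommGroup C] [Module R C] [AddCommGroup E] [Module R E] (hC : IsSD R C)
    (hE : IsSD R E) (hE' : FID R E) : Nonempty (C ≃ₗ[R] R) ∨ Nonempty (C ≃ₗ[R] E) := by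
  have key : ∀ (C : Type) [AddCommGroup C] [Module R C], IsSD R C →
      ∃ j, Nonempty (C ≃ₗ[R] fracIdeal R u j) ∨ Nonempty (C ≃ₗ[R] fracIdeal R v j) := by
    intro C _ _ hC
    obtain ⟨J, M, hM, ⟨e⟩⟩ := hF C hC
    obtain ⟨i, h⟩ := F.exists_equiv J (hC.congr e) hM
    exact ⟨i, h.imp (Nonempty.map e.trans) (Nonempty.map e.trans)⟩
  obtain ⟨i, ⟨⟨e⟩⟩ | ⟨⟨e⟩⟩⟩ := key C hC
  · exact F.equiv_of_equiv hC hE hE' e (key E hE)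
  · obtain ⟨j, hj⟩ := key E hE
    exact F.symm.equiv_of_equiv hC hE hE' e ⟨j, hj.symm⟩
end Frame
end Semidual

end

section

namespace Semidual
open Abelian TensorProduct

section
variable {R : Type} [CommRing R] [IsNoetherianRing R] (S : Submonoid R)

omit [IsNoetherianRing R] in
theorem SES.localize {M N P : Type} [AddCommGroup M] [Module R M] [AddCommGroup N] [Module R N]
    [AddCommGroup P] [Module R P] {f : M →ₗ[R] N} {g : N →ₗ[R] P} (h : SES f g) :
    SES (LocalizedModule.map S f) (LocalizedModule.map S g) where
  inj := LocalizedModule.map_injective S f h.inj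
  exact := LocalizedModule.map_exact S f g h.exact
  surj := LocalizedModule.map_surjective S g h.surj

omit [IsNoetherianRing R] in
theorem localized_hom_ext {M : Type} [AddCommGroup M] [Module R M] {N : Type} [AddCommGroup N]
    [Module (Localization S) N] {f g : LocalizedModule S M →ₗ[Localization S] N}
    (h : ∀ m, f (LocalizedModule.mkLinearMap S M m) = g (LocalizedModule.mkLinearMap S M m)) :
    f = g := by
  ext x
  induction x using LocalizedModule.induction_on with
  | h m s =>
    have : LocalizedModule.mk m s = Localization.mk (1 : R) s • LocalizedModule.mkLinearMap S M m := by
      rw [LocalizedModule.mkLinearMap_apply, LocalizedModule.mk_smul_mk, one_smul, mul_one]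
    rw [this, map_smul, map_smul, h]

/-- Homomorphisms between localizations of finite modules are fractions of homomorphisms. -/
theorem exists_lift_localized {M N : Type} [AddCommGroup M] [Module R M] [Module.Finite R M]
    [AddCommGroup N] [Module R N]
    (f : LocalizedModule S M →ₗ[Localization S] LocalizedModule S N) :
    ∃ (g : M →ₗ[R] N) (s : S), LocalizedModule.map S g = (s : R) • f := by
  have := Module.finitePresentation_of_finite R M
  obtain ⟨g, s, h⟩ := Module.FinitePresentation.exists_lift_of_isLocalizedModule S
    (LocalizedModule.mkLinearMap S N) (f.restrictScalars R ∘ₗ LocalizedModule.mkLinearMap S M)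
  refine ⟨g, s, localized_hom_ext S fun m => ?_⟩
  have h1 := LinearMap.congr_fun h m
  have h2 : LocalizedModule.map S g (LocalizedModule.mkLinearMap S M m) =
      LocalizedModule.mkLinearMap S N (g m) := by simp
  rw [h2]
  exact h1

theorem ExtVanish.localize {N : Type} [AddCommGroup N] [Module R N] (i : ℕ) :
    ∀ (M : Type) [AddCommGroup M] [Module R M] [Module.Finite R M], ExtVanish R M N (i + 1) →
    ExtVanish (Localization S) (LocalizedModule S M) (LocalizedModule S N) (i + 1) := by
  induction i with
  | zero =>
    intro M _ _ _ h
    obtain ⟨n, f, hf, _⟩ := exists_free_cover R M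
    have hs := ses_of_surjective hf
    have hfree : Module.Projective (Localization S) (LocalizedModule S (Fin n → R)) := inferInstance
    refine ExtVanish.of_extend (hs.localize S) (ExtVanish.of_projective 0) fun φ => ?_
    obtain ⟨g, s, hg⟩ := exists_lift_localized S φ
    obtain ⟨ψ, hψ⟩ := ExtVanish.exists_extend hs h g
    refine ⟨Localization.mk 1 s • LocalizedModule.map S ψ, localized_hom_ext S fun m => ?_⟩
    have h1 := LinearMap.congr_fun hg (LocalizedModule.mkLinearMap S _ m)
    have h2 : LocalizedModule.map S ψ (LocalizedModule.map S (LinearMap.ker f).subtype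
      (LocalizedModule.mkLinearMap S _ m)) = LocalizedModule.map S g
        (LocalizedModule.mkLinearMap S _ m) := by
      simp [← hψ]
    rw [LinearMap.comp_apply, LinearMap.smul_apply, h2, h1, LinearMap.smul_apply]
    rw [← algebraMap_smul (Localization S) (s : R), ← Localization.mk_one_eq_algebraMap, ← mul_smul,
      Localization.mk_mul, mul_one, one_mul, Localization.mk_self, one_smul]
  | succ i ih =>
    intro M _ _ _ h
    obtain ⟨n, f, hf, _⟩ := exists_free_cover R M
    have hs := ses_of_surjective hf
    exact ExtVanish.quot_left (hs.localize S)
      (ih _ (ExtVanish.sub_left hs (ExtVanish.of_projective _) h)) (ExtVanish.of_projective _)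

omit [IsNoetherianRing R] in
theorem mkLinearMap_injective {M : Type} [AddCommGroup M] [Module R M]
    (h : ∀ s ∈ S, ∀ m : M, s • m = 0 → m = 0) :
    Function.Injective (LocalizedModule.mkLinearMap S M) := by
  rw [injective_iff_map_eq_zero]
  intro m hm
  obtain ⟨s, hs⟩ := (IsLocalizedModule.eq_zero_iff S (LocalizedModule.mkLinearMap S M)).1 hm
  exact h s s.2 m hs

theorem IsSD.localize [IsDomain R] (hS : (0 : R) ∉ S) {C : Type} [AddCommGroup C] [Module R C]
    (h : IsSD R C) : IsSD (Localization S) (LocalizedModule S C) := by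
  have := h.fin
  have hinj := mkLinearMap_injective S (M := C) fun s hs m hm =>
    h.regular (fun x hx => (mul_eq_zero.1 hx).resolve_left fun h0 => hS (h0 ▸ hs)) m hm
  refine ⟨inferInstance, ⟨?_, fun f => ?_⟩, fun i hi => ?_⟩
  · rw [injective_iff_map_eq_zero]
    intro x hx
    obtain ⟨r, s, rfl⟩ := IsLocalization.exists_mk'_eq S x
    rw [IsLocalization.mk'_eq_zero_iff]
    refine ⟨1, ?_⟩
    rw [OneMemClass.coe_one, one_mul]
    refine h.eq_zero_of_smul fun c => hinj ?_
    rw [map_zero, map_smul, ← algebraMap_smul (Localization S) r, ← IsLocalization.mk'_spec _ r s,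
      mul_comm, mul_smul]
    have h1 := LinearMap.congr_fun hx (LocalizedModule.mkLinearMap S C c)
    rw [Module.algebraMap_end_apply] at h1
    rw [h1, LinearMap.zero_apply, smul_zero]
  · obtain ⟨g, s, hg⟩ := exists_lift_localized S f
    obtain ⟨r, hr⟩ := h.exists_smul g
    refine ⟨IsLocalization.mk' _ r s, localized_hom_ext S fun c => ?_⟩
    have h1 := LinearMap.congr_fun hg (LocalizedModule.mkLinearMap S C c)
    have h2 : LocalizedModule.map S g (LocalizedModule.mkLinearMap S C c) =
        r • LocalizedModule.mkLinearMap S C c := by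
      rw [← map_smul, ← hr]; simp
    rw [h2, LinearMap.smul_apply] at h1
    have h3 : (s : R) • (IsLocalization.mk' (Localization S) r s •
        LocalizedModule.mkLinearMap S C c) = r • LocalizedModule.mkLinearMap S C c := by
      rw [← algebraMap_smul (Localization S) (s : R), ← mul_smul, IsLocalization.mk'_spec',
        algebraMap_smul]
    exact IsLocalizedModule.smul_injective (LocalizedModule.mkLinearMap S C) s (h3.trans h1)
  · obtain ⟨i, rfl⟩ := Nat.exists_eq_add_of_lt hi
    rw [zero_add]
    exact ExtVanish.localize S i C (h.ext (i + 1) (by omega))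

/-- If a localization is a factorial ring of finite injective dimension then every
semidualizing module is isomorphic to an ideal meeting the multiplicative set. -/
theorem IsSD.exists_ideal [IsDomain R] (hS : (0 : R) ∉ S)
    [UniqueFactorizationMonoid (Localization S)] [IsDomain (Localization S)]
    (hW : FID (Localization S) (Localization S)) {C : Type} [AddCommGroup C] [Module R C]
    (h : IsSD R C) : ∃ (J : Ideal R) (s : S), (s : R) ∈ J ∧ Nonempty (C ≃ₗ[R] J) := by
  have := h.fin
  have hL := h.localize S hS
  have hinj := mkLinearMap_injective S (M := C) fun s hs m hm =>
    h.regular (fun x hx => (mul_eq_zero.1 hx).resolve_left fun h0 => hS (h0 ▸ hs)) m hm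
  have hinjR : Function.Injective (algebraMap R (Localization S)) :=
    IsLocalization.injective (M := S) _ fun s hs => mem_nonZeroDivisors_of_ne_zero
      fun h0 => hS (h0 ▸ hs)
  have hnoeth : IsNoetherianRing (Localization S) := IsLocalization.isNoetherianRing S _ inferInstance
  have hinv : Module.Invertible (Localization S) (LocalizedModule S C) :=
    Module.Invertible.left (LinearEquiv.ofBijective _ (hL.eval_bijective hW))
  obtain ⟨e⟩ := Module.Invertible.free_iff_linearEquiv.1
    (inferInstance : Module.Free (Localization S) (LocalizedModule S C))
  let j : C →ₗ[R] Localization S := e.toLinearMap.restrictScalars R ∘ₗ LocalizedModule.mkLinearMap S C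
  have hj : Function.Injective j := e.injective.comp hinj
  obtain ⟨gs, hgs⟩ := Module.Finite.fg_top (R := R) (M := C)
  obtain ⟨b, hb⟩ := IsLocalization.exist_integer_multiples S gs j
  let ι : R →ₗ[R] Localization S := Algebra.linearMap R (Localization S)
  have hrange : ∀ c, ((b : R) • j) c ∈ LinearMap.range ι := by
    intro c
    have hle : Submodule.span R (gs : Set C) ≤ (LinearMap.range ι).comap ((b : R) • j) := by
      rw [Submodule.span_le]
      intro c hc
      exact hb c hc
    exact hle (hgs ▸ Submodule.mem_top)
  let E := LinearEquiv.ofInjective ι hinjR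
  let g : C →ₗ[R] R := E.symm.toLinearMap ∘ₗ ((b : R) • j).codRestrict _ hrange
  have hg : ∀ c, algebraMap R (Localization S) (g c) = (b : R) • j c := fun c =>
    congrArg Subtype.val (E.apply_symm_apply (((b : R) • j).codRestrict _ hrange c))
  have hginj : Function.Injective g := by
    rw [injective_iff_map_eq_zero]
    intro c hc
    have h1 := hg c
    rw [hc, map_zero, ← map_smul] at h1
    have h2 : (b : R) • c = 0 := hj (by rw [← h1, map_zero])
    exact h.regular (fun x hx => (mul_eq_zero.1 hx).resolve_left fun h0 => hS (h0 ▸ b.2)) c h2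
  obtain ⟨x, hx⟩ := e.surjective 1
  obtain ⟨⟨c, s⟩, hcs⟩ := IsLocalizedModule.surj S (LocalizedModule.mkLinearMap S C) x
  refine ⟨LinearMap.range g, b * s, ⟨c, hinjR ?_⟩, ⟨LinearEquiv.ofInjective g hginj⟩⟩
  rw [hg]
  have h1 : j c = algebraMap R (Localization S) s := by
    have h2 : (s : R) • x = LocalizedModule.mkLinearMap S C c := hcs
    change e _ = _
    rw [← h2, ← algebraMap_smul (Localization S) (s : R), map_smul, hx, smul_eq_mul, mul_one]
  rw [h1, Submonoid.coe_mul, map_mul, Algebra.smul_def]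

end
end Semidual

end

section

namespace Semidual
open Abelian TensorProduct

theorem det_mul_eq_zero_of_lt {S : Type} [CommRing S] {r : ℕ} (Y : Matrix (Fin (r + 1)) (Fin r) S)
    (Z : Matrix (Fin r) (Fin (r + 1)) S) : (Y * Z).det = 0 := by
  let Y' : Matrix (Fin (r + 1)) (Fin (r + 1)) S := Matrix.of fun i => Fin.cons 0 (Y i)
  let Z' : Matrix (Fin (r + 1)) (Fin (r + 1)) S :=
    Matrix.of fun i j => Fin.cons (α := fun _ => S) 0 (fun l => Z l j) i
  have h : Y * Z = Y' * Z' := by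
    ext i j
    simp [Matrix.mul_apply, Fin.sum_univ_succ, Y', Z']
  rw [h, Matrix.det_mul, Matrix.det_eq_zero_of_column_eq_zero 0 (fun i => by simp [Y']), zero_mul]

/-- A matrix whose minors of size `r + 1` vanish factors through an invertible submatrix of
size `r`. -/
theorem eq_mul_of_minors_eq_zero {S : Type} [CommRing S] {m n r : ℕ} (M : Matrix (Fin m) (Fin n) S)
    (hM : ∀ (ρ : Fin (r + 1) → Fin m) (γ : Fin (r + 1) → Fin n), (M.submatrix ρ γ).det = 0)
    (ρ : Fin r → Fin m) (γ : Fin r → Fin n) (hu : IsUnit (M.submatrix ρ γ).det) :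
    M = M.submatrix id γ * (M.submatrix ρ γ)⁻¹ * M.submatrix ρ id := by
  let _ := Matrix.invertibleOfIsUnitDet _ hu
  ext i j
  let e : Fin r ⊕ Unit ≃ Fin (r + 1) :=
    (Equiv.sumCongr (Equiv.refl _) (Equiv.ofUnique Unit (Fin 1))).trans finSumFinEquiv
  have h1 : (Matrix.fromBlocks (M.submatrix ρ γ) (M.submatrix ρ fun _ : Unit => j)
      (M.submatrix (fun _ : Unit => i) γ) (M.submatrix (fun _ => i) fun _ => j)).det = 0 := by
    rw [← hM (Sum.elim ρ (fun _ => i) ∘ e.symm) (Sum.elim γ (fun _ => j) ∘ e.symm),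
      ← Matrix.det_submatrix_equiv_self e.symm]
    congr 1
    ext a b
    simp only [Matrix.submatrix_apply, Function.comp]
    rcases e.symm a with a | a <;> rcases e.symm b with b | b <;> rfl
  rw [Matrix.det_fromBlocks₁₁] at h1
  have h2 := (hu.mul_right_eq_zero).1 h1
  rw [Matrix.det_unique] at h2
  have h3 := sub_eq_zero.1 h2
  rw [Matrix.invOf_eq_nonsing_inv] at h3
  simpa [Matrix.mul_apply] using h3

section Generic

variable (k : Type) [Field k] (m n r : ℕ)

/-- The coordinate ring of pairs of an `m × r` and an `r × n` matrix. -/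
abbrev PairRing : Type := MvPolynomial ((Fin m × Fin r) ⊕ (Fin r × Fin n)) k

/-- The generic `m × r` matrix. -/
noncomputable def leftMat : Matrix (Fin m) (Fin r) (PairRing k m n r) :=
  Matrix.of fun i l => MvPolynomial.X (Sum.inl (i, l))

/-- The generic `r × n` matrix. -/
noncomputable def rightMat : Matrix (Fin r) (Fin n) (PairRing k m n r) :=
  Matrix.of fun l j => MvPolynomial.X (Sum.inr (l, j))

/-- The class of the generic matrix in the determinantal ring. -/
noncomputable def detMat (t : ℕ) : Matrix (Fin m) (Fin n) (DetRing k m n t) :=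
  Matrix.of fun i j => Ideal.Quotient.mk _ (MvPolynomial.X (i, j))

variable {k m n}

theorem detMat_minor {t : ℕ} {ι : Type} [Fintype ι] [DecidableEq ι] (ρ : ι → Fin m)
    (γ : ι → Fin n) : ((detMat k m n t).submatrix ρ γ).det =
      Ideal.Quotient.mk (minorsIdeal k m n t)
        (Matrix.of fun i j => MvPolynomial.X (ρ i, γ j)).det := by
  rw [RingHom.map_det]
  rfl

theorem detMat_minor_eq_zero {t : ℕ} (ρ : Fin t → Fin m) (γ : Fin t → Fin n) :
    ((detMat k m n t).submatrix ρ γ).det = 0 := by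
  rw [detMat_minor]
  exact Ideal.Quotient.eq_zero_iff_mem.2 (Ideal.subset_span ⟨ρ, γ, rfl⟩)

/-- A matrix over a `k`-algebra all of whose minors of size `t` vanish is a point of the
determinantal ring. -/
noncomputable def detLift {A : Type} [CommRing A] [Algebra k A] {t : ℕ} (M : Matrix (Fin m) (Fin n) A)
    (hM : ∀ (ρ : Fin t → Fin m) (γ : Fin t → Fin n), (M.submatrix ρ γ).det = 0) :
    DetRing k m n t →ₐ[k] A :=
  Ideal.Quotient.liftₐ _ (MvPolynomial.aeval fun p => M p.1 p.2) (by
    intro a ha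
    have : minorsIdeal k m n t ≤
        RingHom.ker (MvPolynomial.aeval (R := k) fun p : Fin m × Fin n => M p.1 p.2) := by
      refine Ideal.span_le.2 ?_
      rintro _ ⟨ρ, γ, rfl⟩
      rw [SetLike.mem_coe, RingHom.mem_ker, AlgHom.map_det, ← hM ρ γ]
      congr 1
      ext i j
      simp
    exact this ha)

@[simp] theorem detLift_detMat {A : Type} [CommRing A] [Algebra k A] {t : ℕ}
    (M : Matrix (Fin m) (Fin n) A)
    (hM : ∀ (ρ : Fin t → Fin m) (γ : Fin t → Fin n), (M.submatrix ρ γ).det = 0) (i j) :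
    detLift (k := k) M hM (detMat k m n t i j) = M i j := by
  simp only [detLift, detMat, Matrix.of_apply]
  exact MvPolynomial.aeval_X _ _

theorem detRing_hom_ext {A : Type} [CommRing A] [Algebra k A] {t : ℕ}
    {f g : DetRing k m n t →ₐ[k] A}
    (h : ∀ i j, f (detMat k m n t i j) = g (detMat k m n t i j)) : f = g := by
  apply Ideal.Quotient.algHom_ext
  apply MvPolynomial.algHom_ext
  rintro ⟨i, j⟩
  exact h i j

/-- The multiplication map on pairs of matrices. -/
noncomputable def toPair (k : Type) [Field k] (m n r : ℕ) :
    DetRing k m n (r + 1) →ₐ[k] PairRing k m n r :=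
  detLift (leftMat k m n r * rightMat k m n r) fun ρ γ => by
    rw [Matrix.submatrix_mul _ _ _ id _ Function.bijective_id]
    exact det_mul_eq_zero_of_lt _ _

theorem toPair_minor {ι : Type} [Fintype ι] [DecidableEq ι] (ρ : ι → Fin m) (γ : ι → Fin n) :
    toPair k m n r (((detMat k m n (r + 1)).submatrix ρ γ).det) =
      ((leftMat k m n r).submatrix ρ id * (rightMat k m n r).submatrix id γ).det := by
  rw [AlgHom.map_det, ← Matrix.submatrix_mul _ _ _ id _ Function.bijective_id]
  congr 1
  ext i j
  simp [toPair]

variable {r}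

/-- The point of the pair ring with values in matrices `Y` and `Z`. -/
noncomputable def pairLift {A : Type} [CommRing A] [Algebra k A] (Y : Matrix (Fin m) (Fin r) A)
    (Z : Matrix (Fin r) (Fin n) A) : PairRing k m n r →ₐ[k] A :=
  MvPolynomial.aeval (Sum.elim (fun p => Y p.1 p.2) fun p => Z p.1 p.2)

@[simp] theorem pairLift_left {A : Type} [CommRing A] [Algebra k A] (Y : Matrix (Fin m) (Fin r) A)
    (Z : Matrix (Fin r) (Fin n) A) (i l) : pairLift (k := k) Y Z (leftMat k m n r i l) = Y i l := by
  simp [pairLift, leftMat]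

@[simp] theorem pairLift_right {A : Type} [CommRing A] [Algebra k A] (Y : Matrix (Fin m) (Fin r) A)
    (Z : Matrix (Fin r) (Fin n) A) (l j) : pairLift (k := k) Y Z (rightMat k m n r l j) = Z l j := by
  simp [pairLift, rightMat]

theorem pairLift_toPair {A : Type} [CommRing A] [Algebra k A] (Y : Matrix (Fin m) (Fin r) A)
    (Z : Matrix (Fin r) (Fin n) A) (i j) :
    pairLift (k := k) Y Z (toPair k m n r (detMat k m n (r + 1) i j)) = (Y * Z) i j := by
  simp [toPair, Matrix.mul_apply]

/-- After inverting a minor of size `r`, the multiplication map has a left inverse. -/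
theorem exists_pow_mul_of_toPair_dvd (ρ : Fin r → Fin m) (γ : Fin r → Fin n)
    {d f : DetRing k m n (r + 1)} (h : toPair k m n r d ∣ toPair k m n r f) :
    ∃ N, d ∣ ((detMat k m n (r + 1)).submatrix ρ γ).det ^ N * f := by
  set δ := ((detMat k m n (r + 1)).submatrix ρ γ).det with hδ
  let L := Localization.Away δ
  let M : Matrix (Fin m) (Fin n) L := (detMat k m n (r + 1)).map (algebraMap _ L)
  have hM : ∀ (ρ : Fin (r + 1) → Fin m) (γ : Fin (r + 1) → Fin n), (M.submatrix ρ γ).det = 0 := by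
    intro ρ γ
    rw [Matrix.submatrix_map, ← RingHom.mapMatrix_apply, ← RingHom.map_det, detMat_minor_eq_zero,
      map_zero]
  have hu : IsUnit (M.submatrix ρ γ).det := by
    rw [Matrix.submatrix_map, ← RingHom.mapMatrix_apply, ← RingHom.map_det]
    exact IsLocalization.Away.algebraMap_isUnit δ
  have key := eq_mul_of_minors_eq_zero M hM ρ γ hu
  let θ : PairRing k m n r →ₐ[k] L :=
    pairLift (M.submatrix id γ * (M.submatrix ρ γ)⁻¹) (M.submatrix ρ id)
  have hθ : ∀ x, θ (toPair k m n r x) = algebraMap _ L x := by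
    intro x
    refine DFunLike.congr_fun (f := θ.comp (toPair k m n r)) (g := IsScalarTower.toAlgHom k _ L)
      (detRing_hom_ext fun i j => ?_) x
    rw [AlgHom.comp_apply, pairLift_toPair, ← key]
    rfl
  obtain ⟨q, hq⟩ := h
  have h1 : algebraMap _ L f = algebraMap _ L d * θ q := by
    rw [← hθ, ← hθ, hq, map_mul]
  obtain ⟨a, g, hg⟩ := IsLocalization.Away.surj δ (θ q)
  have h2 : algebraMap _ L (δ ^ a * f) = algebraMap _ L (d * g) := by
    rw [map_mul, map_mul, h1, ← hg, map_pow]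
    ring
  obtain ⟨⟨_, b, rfl⟩, hb⟩ := IsLocalization.exists_of_eq (M := Submonoid.powers δ) h2
  refine ⟨b + a, δ ^ b * g, ?_⟩
  dsimp only at hb
  rw [pow_add, mul_assoc, hb]
  ring

end Generic

end Semidual

end

section

namespace Semidual
open Abelian TensorProduct

theorem Gr.mem_of_pow_mul_mem {S : Type} [CommRing S] [IsNoetherianRing S] {G : Set S}
    {I : Ideal S} {c p : ℕ} (h : Gr (Ideal.span G) c) (hI : PdLE S (S ⧸ I) p) (hp : p < c) (x : S)
    (hx : ∀ a ∈ G, ∃ N, a ^ N * x ∈ I) : x ∈ I := by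
  let K : Ideal S := Submodule.comap (LinearMap.toSpanSingleton S S x) I
  have hK : Ideal.span G ≤ K.radical := Ideal.span_le.2 fun a ha => hx a ha
  obtain ⟨N, hN⟩ := Ideal.exists_pow_le_of_le_radical_of_fg hK (IsNoetherian.noetherian _)
  have key : ∀ N y, (∀ a ∈ Ideal.span G ^ N, a * y ∈ I) → y ∈ I := by
    intro N
    induction N with
    | zero => exact fun y hy => by simpa using hy 1 (by simp)
    | succ N ih =>
      refine fun y hy => ih y fun a ha => h.colon hI hp _ fun b hb => ?_
      rw [← mul_assoc]
      exact hy _ (by rw [pow_succ']; exact Ideal.mul_mem_mul hb ha)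
  exact key N x fun a ha => hN ha

section Generic

variable {k : Type} [Field k] {m n r : ℕ}

theorem toPair_mem_of_dvd (h0 : 0 < r) (hm : r ≤ m) (hn : r ≤ n)
    {I : Ideal (MvPolynomial (Fin m × Fin n) k)} {p : ℕ}
    (hI : PdLE (MvPolynomial (Fin m × Fin n) k) (_ ⧸ I) p) (hp : p < (m - r + 1) * (n - r + 1))
    (d f : MvPolynomial (Fin m × Fin n) k) (h : minorsIdeal k m n (r + 1) ⊔ Ideal.span {d} ≤ I)
    (hd : toPair k m n r (Ideal.Quotient.mk _ d) ∣ toPair k m n r (Ideal.Quotient.mk _ f)) :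
    f ∈ I := by
  have h1 := (minors_perfect k m n (r - 1) (by omega) (by omega)).2
  rw [show r - 1 + 1 = r by omega, show m - (r - 1) = m - r + 1 by omega,
    show n - (r - 1) = n - r + 1 by omega] at h1
  refine Gr.mem_of_pow_mul_mem h1 hI hp f ?_
  rintro _ ⟨ρ, γ, rfl⟩
  obtain ⟨N, g, hg⟩ := exists_pow_mul_of_toPair_dvd ρ γ hd
  obtain ⟨g, rfl⟩ := Ideal.Quotient.mk_surjective g
  refine ⟨N, ?_⟩
  rw [detMat_minor, ← map_pow, ← map_mul, ← map_mul, Ideal.Quotient.eq] at hg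
  have h2 := I.add_mem (h (Ideal.mem_sup_left hg))
    (I.mul_mem_right g (h (Ideal.mem_sup_right (Ideal.mem_span_singleton_self d))))
  rwa [sub_add_cancel] at h2

theorem toPair_injective (h0 : 0 < r) (hm : r < m) (hn : r < n) :
    Function.Injective (toPair k m n r) := by
  rw [injective_iff_map_eq_zero]
  intro f hf
  obtain ⟨f, rfl⟩ := Ideal.Quotient.mk_surjective f
  refine Ideal.Quotient.eq_zero_iff_mem.2 (toPair_mem_of_dvd h0 hm.le hn.le
    (minors_perfect k m n r hm hn).1 ?_ 0 f ?_ ?_)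
  · nlinarith
  · simp
  · rw [hf]
    exact dvd_zero _

theorem isDomain_detRing (h0 : 0 < r) (hm : r < m) (hn : r < n) :
    IsDomain (DetRing k m n (r + 1)) :=
  (toPair_injective h0 hm hn).isDomain (toPair k m n r).toRingHom

theorem dvd_of_toPair_dvd (h0 : 0 < r) (hm : r < m) (hn : r < n) {d f : DetRing k m n (r + 1)}
    (h : toPair k m n r d ∣ toPair k m n r f) : d ∣ f := by
  have := isDomain_detRing (k := k) h0 hm hn
  obtain ⟨f, rfl⟩ := Ideal.Quotient.mk_surjective f
  obtain ⟨d, rfl⟩ := Ideal.Quotient.mk_surjective d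
  by_cases hd : Ideal.Quotient.mk (minorsIdeal k m n (r + 1)) d = 0
  · rw [hd, map_zero, zero_dvd_iff] at h
    rw [toPair_injective h0 hm hn (h.trans (map_zero _).symm)]
    exact dvd_zero _
  have hs := SES.quotient_mul (I := minorsIdeal k m n (r + 1)) (h := d) fun y hy => by
    rw [← Ideal.Quotient.eq_zero_iff_mem] at hy ⊢
    rw [map_mul] at hy
    exact (mul_eq_zero.1 hy).resolve_left hd
  have hpd := (minors_perfect k m n r hm hn).1
  have hmem := toPair_mem_of_dvd h0 hm.le hn.le
    (PdLE.quot hs hpd (hpd.mono (Nat.le_succ _))) (by nlinarith [Nat.sub_pos_of_lt hm, Nat.sub_pos_of_lt hn]) d f le_rfl h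
  obtain ⟨a, ha, b, hb, rfl⟩ := Submodule.mem_sup.1 hmem
  rw [map_add, Ideal.Quotient.eq_zero_iff_mem.2 ha, zero_add]
  exact map_dvd _ (Ideal.mem_span_singleton.1 hb)

end Generic
end Semidual

end

section

namespace Semidual
open Abelian TensorProduct

theorem det_dvd_det_submatrix {S : Type} [CommRing S] {r : ℕ} (M : Matrix (Fin r) (Fin r) S)
    (ρ γ : Fin r → Fin r) : M.det ∣ (M.submatrix ρ γ).det := by
  have h : M.submatrix ρ γ =
      (1 : Matrix (Fin r) (Fin r) S).submatrix ρ id * M * (1 : Matrix _ _ S).submatrix id γ := by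
    ext i j
    simp [Matrix.mul_apply, Matrix.one_apply]
  rw [h, Matrix.det_mul, Matrix.det_mul]
  exact Dvd.intro_left _ (by rw [mul_right_comm])

theorem prime_det_mvPolynomialX (k : Type) [Field k] (r : ℕ) (h0 : 0 < r) :
    Prime (Matrix.mvPolynomialX (Fin r) (Fin r) k).det := by
  rcases Nat.lt_or_ge 1 r with h1 | h1
  · have h2 : minorsIdeal k r r r = Ideal.span {(Matrix.mvPolynomialX (Fin r) (Fin r) k).det} := by
      apply le_antisymm
      · refine Ideal.span_le.2 ?_
        rintro _ ⟨ρ, γ, rfl⟩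
        exact Ideal.mem_span_singleton.2 (det_dvd_det_submatrix (Matrix.mvPolynomialX _ _ k) ρ γ)
      · exact Ideal.span_mono (Set.singleton_subset_iff.2 ⟨id, id, rfl⟩)
    have h3 := isDomain_detRing (k := k) (m := r) (n := r) (r := r - 1) (by omega) (by omega)
      (by omega)
    rw [show r - 1 + 1 = r by omega] at h3
    rw [← Ideal.span_singleton_prime (Matrix.det_mvPolynomialX_ne_zero _ _), ← h2,
      ← Ideal.Quotient.isDomain_iff_prime]
    exact h3
  · obtain rfl : r = 1 := by omega
    rw [Matrix.det_unique]
    exact MvPolynomial.X_prime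

theorem prime_rename {k σ τ : Type} [Field k] {f : σ → τ} (hf : Function.Injective f)
    {p : MvPolynomial σ k} (hp : Prime p) : Prime (MvPolynomial.rename f p) := by
  have h : MvPolynomial.rename f p =
      MvPolynomial.rename ((↑) : Set.range f → τ)
        (MvPolynomial.renameEquiv k (Equiv.ofInjective f hf) p) := by
    rw [MvPolynomial.renameEquiv_apply, MvPolynomial.rename_rename]
    rfl
  rw [h, MvPolynomial.prime_rename_iff]
  exact (MulEquiv.prime_iff (MvPolynomial.renameEquiv k (Equiv.ofInjective f hf)).toMulEquiv).2 hp

section Generic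

variable {k : Type} [Field k] {m n r : ℕ}

theorem prime_left_minor (h0 : 0 < r) {ρ : Fin r → Fin m} (hρ : Function.Injective ρ) :
    Prime ((leftMat k m n r).submatrix ρ id).det := by
  convert prime_rename (f := fun p : Fin r × Fin r =>
    (Sum.inl (ρ p.1, p.2) : (Fin m × Fin r) ⊕ (Fin r × Fin n))) (fun p q h => by
      simp only [Sum.inl.injEq, Prod.mk.injEq] at h
      exact Prod.ext (hρ h.1) h.2) (prime_det_mvPolynomialX k r h0)
  rw [AlgHom.map_det]
  congr 1
  ext i j
  simp [leftMat]

theorem prime_right_minor (h0 : 0 < r) {γ : Fin r → Fin n} (hγ : Function.Injective γ) :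
    Prime ((rightMat k m n r).submatrix id γ).det := by
  convert prime_rename (f := fun p : Fin r × Fin r =>
    (Sum.inr (p.1, γ p.2) : (Fin m × Fin r) ⊕ (Fin r × Fin n))) (fun p q h => by
      simp only [Sum.inr.injEq, Prod.mk.injEq] at h
      exact Prod.ext h.1 (hγ h.2)) (prime_det_mvPolynomialX k r h0)
  rw [AlgHom.map_det]
  congr 1
  ext i j
  simp [rightMat]

theorem pairLift_left_minor {A : Type} [CommRing A] [Algebra k A] (Y : Matrix (Fin m) (Fin r) A)
    (Z : Matrix (Fin r) (Fin n) A) (ρ : Fin r → Fin m) :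
    pairLift (k := k) Y Z ((leftMat k m n r).submatrix ρ id).det = (Y.submatrix ρ id).det := by
  rw [AlgHom.map_det]
  congr 1
  ext i j
  simp

theorem pairLift_right_minor {A : Type} [CommRing A] [Algebra k A] (Y : Matrix (Fin m) (Fin r) A)
    (Z : Matrix (Fin r) (Fin n) A) (γ : Fin r → Fin n) :
    pairLift (k := k) Y Z ((rightMat k m n r).submatrix id γ).det = (Z.submatrix id γ).det := by
  rw [AlgHom.map_det]
  congr 1
  ext i j
  simp

/-- The incidence matrix of a function. -/
def incidence (k : Type) [Field k] (ρ : Fin r → Fin m) : Matrix (Fin m) (Fin r) k :=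
  Matrix.of fun i l => if i = ρ l then 1 else 0

theorem incidence_det_self {ρ : Fin r → Fin m} (hρ : Function.Injective ρ) :
    ((incidence k ρ).submatrix ρ id).det = 1 := by
  rw [← Matrix.det_one (n := Fin r)]
  congr 1
  ext i j
  simp [incidence, Matrix.one_apply, hρ.eq_iff]

theorem incidence_det_of_notMem {ρ ρ' : Fin r → Fin m} (i : Fin r) (hi : ∀ l, ρ' i ≠ ρ l) :
    ((incidence k ρ).submatrix ρ' id).det = 0 :=
  Matrix.det_eq_zero_of_row_eq_zero i fun l => by simp [incidence, hi]

/-- The inclusion of the first `r` indices. -/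
def firstIdx (h : r < m) : Fin r → Fin m := fun i => ⟨i, by omega⟩

/-- The inclusion of the indices `1, …, r`. -/
def nextIdx (h : r < m) : Fin r → Fin m := fun i => ⟨i + 1, by omega⟩

theorem firstIdx_injective (h : r < m) : Function.Injective (firstIdx h) :=
  fun _ _ hij => Fin.ext (Fin.mk.inj_iff.1 hij)

theorem nextIdx_injective (h : r < m) : Function.Injective (nextIdx h) :=
  fun _ _ hij => Fin.ext (Nat.succ_injective (Fin.mk.inj_iff.1 hij))

theorem firstIdx_notMem (h0 : 0 < r) (h : r < m) (l : Fin r) :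
    firstIdx h ⟨0, h0⟩ ≠ nextIdx h l := by
  simp [firstIdx, nextIdx]

theorem nextIdx_notMem (h0 : 0 < r) (h : r < m) (l : Fin r) :
    nextIdx h ⟨r - 1, by omega⟩ ≠ firstIdx h l := by
  have := l.2
  simp only [firstIdx, nextIdx, ne_eq, Fin.mk.injEq]
  omega

theorem left_minors_independent (h0 : 0 < r) (hm : r < m) (a b : k)
    (h : a • ((leftMat k m n r).submatrix (firstIdx hm) id).det +
      b • ((leftMat k m n r).submatrix (nextIdx hm) id).det = 0) : a = 0 ∧ b = 0 := by
  have h1 := congrArg (pairLift (incidence k (firstIdx hm)) 0) h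
  have h2 := congrArg (pairLift (incidence k (nextIdx hm)) 0) h
  simp only [map_add, map_smul, pairLift_left_minor, map_zero] at h1 h2
  rw [incidence_det_self (firstIdx_injective hm),
    incidence_det_of_notMem _ (nextIdx_notMem h0 hm)] at h1
  rw [incidence_det_self (nextIdx_injective hm),
    incidence_det_of_notMem _ (firstIdx_notMem h0 hm)] at h2
  simpa using And.intro h1 h2

theorem right_minors_independent (h0 : 0 < r) (hn : r < n) (a b : k)
    (h : a • ((rightMat k m n r).submatrix id (firstIdx hn)).det +
      b • ((rightMat k m n r).submatrix id (nextIdx hn)).det = 0) : a = 0 ∧ b = 0 := by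
  have h1 := congrArg (pairLift 0 (incidence k (firstIdx hn)).transpose) h
  have h2 := congrArg (pairLift 0 (incidence k (nextIdx hn)).transpose) h
  simp only [map_add, map_smul, pairLift_right_minor, map_zero, ← Matrix.transpose_submatrix,
    Matrix.det_transpose] at h1 h2
  rw [incidence_det_self (firstIdx_injective hn),
    incidence_det_of_notMem _ (nextIdx_notMem h0 hn)] at h1
  rw [incidence_det_self (nextIdx_injective hn),
    incidence_det_of_notMem _ (firstIdx_notMem h0 hn)] at h2
  simpa using And.intro h1 h2

theorem not_left_dvd_right (h0 : 0 < r) {ρ : Fin r → Fin m} {γ : Fin r → Fin n}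
    (hγ : Function.Injective γ) :
    ¬ ((leftMat k m n r).submatrix ρ id).det ∣ ((rightMat k m n r).submatrix id γ).det := by
  intro h
  have h1 := map_dvd (pairLift 0 (incidence k γ).transpose) h
  rw [pairLift_left_minor, pairLift_right_minor, ← Matrix.transpose_submatrix,
    Matrix.det_transpose, incidence_det_self hγ,
    Matrix.det_eq_zero_of_row_eq_zero ⟨0, h0⟩ (by simp)] at h1
  exact one_ne_zero (zero_dvd_iff.1 h1)

theorem not_right_dvd_left (h0 : 0 < r) {ρ : Fin r → Fin m} {γ : Fin r → Fin n}
    (hρ : Function.Injective ρ) :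
    ¬ ((rightMat k m n r).submatrix id γ).det ∣ ((leftMat k m n r).submatrix ρ id).det := by
  intro h
  have h1 := map_dvd (pairLift (incidence k ρ) 0) h
  rw [pairLift_left_minor, pairLift_right_minor, incidence_det_self hρ,
    Matrix.det_eq_zero_of_row_eq_zero ⟨0, h0⟩ (by simp)] at h1
  exact one_ne_zero (zero_dvd_iff.1 h1)

/-- The multiplication map exhibits the determinantal ring as a frame. -/
theorem detRing_frame (h0 : 0 < r) (hm : r < m) (hn : r < n) :
    let _ : Algebra (DetRing k m n (r + 1)) (PairRing k m n r) := (toPair k m n r).toAlgebra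
    Frame k (DetRing k m n (r + 1)) (PairRing k m n r) (PairRing k m n r) (PairRing k m n r)
      ((detMat k m n (r + 1)).submatrix (firstIdx hm) (firstIdx hn)).det
      ((leftMat k m n r).submatrix (firstIdx hm) id).det
      ((rightMat k m n r).submatrix id (firstIdx hn)).det
      ((leftMat k m n r).submatrix (nextIdx hm) id).det
      ((rightMat k m n r).submatrix id (nextIdx hn)).det
      (pairLift (leftMat k m n r) 0) (pairLift 0 (rightMat k m n r)) := by
  intro _
  have hL := prime_left_minor (k := k) (n := n) h0 (firstIdx_injective hm)
  have hR := prime_right_minor (k := k) (m := m) h0 (firstIdx_injective hn)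
  refine
  { inj := toPair_injective h0 hm hn
    prime_left := hL
    prime_right := hR
    not_dvd := not_left_dvd_right h0 (firstIdx_injective hn)
    not_dvd' := not_right_dvd_left h0 (firstIdx_injective hm)
    map_d := (toPair_minor _ _ _).trans (Matrix.det_mul _ _)
    not_dvd_left := ?_
    mem_left := ⟨_, (toPair_minor _ _ _).trans (Matrix.det_mul _ _)⟩
    not_dvd_right := ?_
    mem_right := ⟨_, (toPair_minor _ _ _).trans (Matrix.det_mul _ _)⟩
    contract := fun x y h => dvd_of_toPair_dvd h0 hm hn h
    const_left := ?_
    const_right := ?_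
    not_isUnit_left := ?_
    not_isUnit_right := ?_
    linearIndependent_left := ?_
    linearIndependent_right := ?_ }
  · intro h
    have h1 := map_dvd (pairLift (incidence k (nextIdx hm)) 0) h
    rw [pairLift_left_minor, pairLift_left_minor, incidence_det_self (nextIdx_injective hm),
      incidence_det_of_notMem _ (firstIdx_notMem h0 hm)] at h1
    exact one_ne_zero (zero_dvd_iff.1 h1)
  · intro h
    have h1 := map_dvd (pairLift 0 (incidence k (nextIdx hn)).transpose) h
    rw [pairLift_right_minor, pairLift_right_minor, ← Matrix.transpose_submatrix,
      ← Matrix.transpose_submatrix, Matrix.det_transpose, Matrix.det_transpose,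
      incidence_det_self (nextIdx_injective hn),
      incidence_det_of_notMem _ (firstIdx_notMem h0 hn)] at h1
    exact one_ne_zero (zero_dvd_iff.1 h1)
  · intro x
    refine ⟨pairLift (k := k) 0 0 (toPair k m n r x), ?_⟩
    refine DFunLike.congr_fun (f := (pairLift (leftMat k m n r) 0).comp (toPair k m n r))
      (g := (Algebra.ofId k _).comp ((pairLift (k := k) 0 0).comp (toPair k m n r)))
      (detRing_hom_ext fun i j => ?_) x
    simp only [AlgHom.comp_apply, pairLift_toPair, Matrix.mul_zero, Matrix.zero_apply, map_zero]
  · intro x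
    refine ⟨pairLift (k := k) 0 0 (toPair k m n r x), ?_⟩
    refine DFunLike.congr_fun (f := (pairLift 0 (rightMat k m n r)).comp (toPair k m n r))
      (g := (Algebra.ofId k _).comp ((pairLift (k := k) 0 0).comp (toPair k m n r)))
      (detRing_hom_ext fun i j => ?_) x
    simp only [AlgHom.comp_apply, pairLift_toPair, Matrix.zero_mul, Matrix.zero_apply, map_zero]
  · rw [pairLift_left_minor]
    exact hL.not_isUnit
  · rw [pairLift_right_minor]
    exact hR.not_isUnit
  · rw [pairLift_left_minor, pairLift_left_minor]
    exact left_minors_independent h0 hm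
  · rw [pairLift_right_minor, pairLift_right_minor]
    exact right_minors_independent h0 hn

end Generic
end Semidual

end

section

namespace Semidual
open Abelian TensorProduct

open Polynomial in
theorem fid_localization_away {P : Type} [CommRing P] [IsDomain P] {e : ℕ} (hP : GlDim P e)
    {x : P} (hx : x ≠ 0) {A : Type} [CommRing A] (f : Localization.Away x ≃+* A) : FID A A := by
  have h0 : (C x * X - 1 : P[X]) ≠ 0 := by
    intro h
    have := congrArg (Polynomial.coeff · 1) h
    simp [Polynomial.coeff_one, hx] at this
  let g : P[X] →+* A := (f.toRingHom.comp (Localization.awayEquivAdjoin x).symm.toRingEquiv.toRingHom).comp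
    (AdjoinRoot.mk (C x * X - 1))
  have hg : RingHom.ker g = ⊥ ⊔ Ideal.span {C x * X - 1} := by
    rw [bot_sup_eq, ← Ideal.mk_ker (I := Ideal.span {C x * X - 1})]
    exact RingHom.ker_equiv_comp (AdjoinRoot.mk (C x * X - 1))
      ((Localization.awayEquivAdjoin x).symm.toRingEquiv.trans f)
  let _ : Algebra P[X] A := g.toAlgebra
  refine FID.of_regChain (K := Set.univ) (.snoc .nil (C x * X - 1) trivial fun y hy => ?_)
    (hP.polynomial.fid _) A ?_ hg
  · exact (mul_eq_zero.1 hy).resolve_left h0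
  · exact f.surjective.comp ((Localization.awayEquivAdjoin x).symm.surjective.comp
      AdjoinRoot.mk_surjective)

section Generic

variable (k : Type) [Field k] (m n r : ℕ)

/-- The positions of a matrix in the first `r` rows or the first `r` columns. -/
abbrev Hook : Type := {p : Fin m × Fin n // p.1.1 < r ∨ p.2.1 < r}

/-- The matrix of indeterminates in the first `r` rows or the first `r` columns. -/
noncomputable def hookMat : Matrix (Fin m) (Fin n) (MvPolynomial (Hook m n r) k) :=
  Matrix.of fun i j => if h : i.1 < r ∨ j.1 < r then MvPolynomial.X ⟨(i, j), h⟩ else 0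

variable {k m n r}

/-- The completion of rank `r` of a matrix from its first `r` rows and columns. -/
noncomputable def rankCompletion {A : Type} [CommRing A] (hm : r < m) (hn : r < n) (M : Matrix (Fin m) (Fin n) A) :
    Matrix (Fin m) (Fin n) A :=
  M.submatrix id (firstIdx hn) * (M.submatrix (firstIdx hm) (firstIdx hn))⁻¹ *
    M.submatrix (firstIdx hm) id

theorem rankCompletion_minor {A : Type} [CommRing A] (hm : r < m) (hn : r < n)
    (M : Matrix (Fin m) (Fin n) A) (ρ : Fin (r + 1) → Fin m) (γ : Fin (r + 1) → Fin n) :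
    ((rankCompletion hm hn M).submatrix ρ γ).det = 0 := by
  rw [rankCompletion, Matrix.submatrix_mul _ _ _ id _ Function.bijective_id]
  exact det_mul_eq_zero_of_lt _ _

theorem rankCompletion_apply {A : Type} [CommRing A] (hm : r < m) (hn : r < n)
    (M : Matrix (Fin m) (Fin n) A)
    (hu : IsUnit (M.submatrix (firstIdx hm) (firstIdx hn)).det) (i : Fin m) (j : Fin n)
    (h : i.1 < r ∨ j.1 < r) : rankCompletion hm hn M i j = M i j := by
  rcases h with h | h
  · have h1 : (rankCompletion hm hn M).submatrix (firstIdx hm) id =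
        M.submatrix (firstIdx hm) id := by
      rw [rankCompletion, Matrix.submatrix_mul _ _ _ id _ Function.bijective_id,
        Matrix.submatrix_mul _ _ _ id _ Function.bijective_id, Matrix.submatrix_submatrix,
        Matrix.submatrix_id_id]
      exact (congrArg (· * M.submatrix (firstIdx hm) id) (Matrix.mul_nonsing_inv _ hu)).trans
        (Matrix.one_mul _)
    exact congrFun (congrFun h1 ⟨i, h⟩) j
  · have h1 : (rankCompletion hm hn M).submatrix id (firstIdx hn) =
        M.submatrix id (firstIdx hn) := by
      rw [rankCompletion, Matrix.mul_assoc, Matrix.submatrix_mul _ _ _ id _ Function.bijective_id,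
        Matrix.submatrix_mul _ _ _ id _ Function.bijective_id, Matrix.submatrix_submatrix,
        Matrix.submatrix_id_id]
      exact (congrArg (M.submatrix id (firstIdx hn) * ·) (Matrix.nonsing_inv_mul _ hu)).trans
        (Matrix.mul_one _)
    exact congrFun (congrFun h1 i) ⟨j, h⟩

theorem map_nonsing_inv {A B : Type} [CommRing A] [CommRing B] (f : A →+* B)
    (M : Matrix (Fin r) (Fin r) A) (hu : IsUnit M.det) : M⁻¹.map f = (M.map f)⁻¹ := by
  symm
  apply Matrix.inv_eq_right_inv
  rw [← Matrix.map_mul, Matrix.mul_nonsing_inv _ hu]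
  exact Matrix.map_one f f.map_zero f.map_one

theorem rankCompletion_map {A B : Type} [CommRing A] [CommRing B] (hm : r < m) (hn : r < n)
    (f : A →+* B) (M : Matrix (Fin m) (Fin n) A)
    (hu : IsUnit (M.submatrix (firstIdx hm) (firstIdx hn)).det) :
    (rankCompletion hm hn M).map f = rankCompletion hm hn (M.map f) := by
  rw [rankCompletion, Matrix.map_mul, Matrix.map_mul, map_nonsing_inv f _ hu]
  rfl

theorem rankCompletion_congr {A : Type} [CommRing A] (hm : r < m) (hn : r < n)
    {M N : Matrix (Fin m) (Fin n) A} (h : ∀ i j, i.1 < r ∨ j.1 < r → M i j = N i j) :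
    rankCompletion hm hn M = rankCompletion hm hn N := by
  have h1 : M.submatrix id (firstIdx hn) = N.submatrix id (firstIdx hn) := by
    ext i j
    exact h _ _ (.inr j.2)
  have h2 : M.submatrix (firstIdx hm) id = N.submatrix (firstIdx hm) id := by
    ext i j
    exact h _ _ (.inl i.2)
  have h3 : M.submatrix (firstIdx hm) (firstIdx hn) = N.submatrix (firstIdx hm) (firstIdx hn) := by
    ext i j
    exact h _ _ (.inl i.2)
  rw [rankCompletion, h1, h2, h3, rankCompletion]

/-- The determinantal ring is, up to inverting a minor, a polynomial ring. -/
theorem nonempty_localization_equiv (hm : r < m) (hn : r < n) :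
    Nonempty (Localization.Away ((hookMat k m n r).submatrix (firstIdx hm) (firstIdx hn)).det ≃+*
      Localization.Away ((detMat k m n (r + 1)).submatrix (firstIdx hm) (firstIdx hn)).det) := by
  set δ₀ := ((hookMat k m n r).submatrix (firstIdx hm) (firstIdx hn)).det with hδ₀
  set δ := ((detMat k m n (r + 1)).submatrix (firstIdx hm) (firstIdx hn)).det with hδ
  let V := Localization.Away δ₀
  let W := Localization.Away δ
  let MV : Matrix (Fin m) (Fin n) V := (hookMat k m n r).map (algebraMap _ V)
  let MW : Matrix (Fin m) (Fin n) W := (detMat k m n (r + 1)).map (algebraMap _ W)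
  have hV : (MV.submatrix (firstIdx hm) (firstIdx hn)).det = algebraMap _ V δ₀ := by
    rw [Matrix.submatrix_map, ← RingHom.mapMatrix_apply, ← RingHom.map_det]
  have hW : (MW.submatrix (firstIdx hm) (firstIdx hn)).det = algebraMap _ W δ := by
    rw [Matrix.submatrix_map, ← RingHom.mapMatrix_apply, ← RingHom.map_det]
  have huV : IsUnit (algebraMap _ V δ₀) := IsLocalization.Away.algebraMap_isUnit δ₀
  have huW : IsUnit (algebraMap _ W δ) := IsLocalization.Away.algebraMap_isUnit δ
  have hMW : MW = rankCompletion hm hn MW := by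
    refine eq_mul_of_minors_eq_zero MW ?_ _ _ (hW ▸ huW)
    intro ρ γ
    rw [Matrix.submatrix_map, ← RingHom.mapMatrix_apply, ← RingHom.map_det, detMat_minor_eq_zero,
      map_zero]
  let Φ : DetRing k m n (r + 1) →ₐ[k] V :=
    detLift (rankCompletion hm hn MV) (rankCompletion_minor hm hn MV)
  let Ψ : MvPolynomial (Hook m n r) k →ₐ[k] W := MvPolynomial.aeval fun p => MW p.1.1 p.1.2
  have hΨ : ∀ i j, i.1 < r ∨ j.1 < r → Ψ (hookMat k m n r i j) = MW i j := by
    intro i j h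
    simp [Ψ, hookMat, h]
  have hΦδ : Φ δ = algebraMap _ V δ₀ := by
    rw [hδ, AlgHom.map_det, ← hV]
    congr 1
    ext i j
    simp only [AlgHom.mapMatrix_apply, Matrix.map_apply, Matrix.submatrix_apply, Φ,
      detLift_detMat]
    exact rankCompletion_apply hm hn MV (hV ▸ huV) _ _ (.inl i.2)
  have hΨδ : Ψ δ₀ = algebraMap _ W δ := by
    rw [hδ₀, AlgHom.map_det, ← hW]
    congr 1
    ext i j
    exact hΨ _ _ (.inl i.2)
  let F : W →ₐ[k] V := IsLocalization.liftAlgHom (M := Submonoid.powers δ) (f := Φ) (by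
    rintro ⟨_, a, rfl⟩
    dsimp only
    rw [map_pow, hΦδ]
    exact huV.pow a)
  let G : V →ₐ[k] W := IsLocalization.liftAlgHom (M := Submonoid.powers δ₀) (f := Ψ) (by
    rintro ⟨_, a, rfl⟩
    dsimp only
    rw [map_pow, hΨδ]
    exact huW.pow a)
  have hF : ∀ x, F (algebraMap _ W x) = Φ x := fun x => IsLocalization.lift_eq _ _
  have hG : ∀ x, G (algebraMap _ V x) = Ψ x := fun x => IsLocalization.lift_eq _ _
  have hGM : ∀ i j, i.1 < r ∨ j.1 < r → G (MV i j) = MW i j :=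
    fun i j h => (hG _).trans (hΨ i j h)
  refine ⟨(AlgEquiv.ofAlgHom G F ?_ ?_).toRingEquiv⟩
  · apply IsLocalization.algHom_ext (Submonoid.powers δ)
    refine detRing_hom_ext fun i j => ?_
    change G (F (algebraMap _ W _)) = algebraMap _ W _
    rw [hF]
    simp only [Φ, detLift_detMat]
    change ((rankCompletion hm hn MV).map (G : V →+* W)) i j = MW i j
    rw [rankCompletion_map hm hn _ _ (hV ▸ huV), hMW, ← rankCompletion_congr hm hn hGM]
    rfl
  · apply IsLocalization.algHom_ext (Submonoid.powers δ₀)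
    refine MvPolynomial.algHom_ext fun p => ?_
    have h1 : Ψ (MvPolynomial.X p) = algebraMap _ W (detMat k m n (r + 1) p.1.1 p.1.2) :=
      MvPolynomial.aeval_X _ _
    have h2 : MV p.1.1 p.1.2 = algebraMap (MvPolynomial (Hook m n r) k) V (MvPolynomial.X p) := by
      simp [MV, hookMat, p.2]
    refine ((congrArg F ((hG _).trans h1)).trans (hF _)).trans ?_
    simp only [Φ, detLift_detMat]
    rw [rankCompletion_apply hm hn MV (hV ▸ huV) _ _ p.2]
    exact h2

theorem hookMat_minor_ne_zero (hm : r < m) (hn : r < n) :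
    ((hookMat k m n r).submatrix (firstIdx hm) (firstIdx hn)).det ≠ 0 := by
  intro h
  have h1 := congrArg (MvPolynomial.aeval (R := k) fun p : Hook m n r =>
    if p.1.1.1 = p.1.2.1 then (1 : k) else 0) h
  rw [AlgHom.map_det, map_zero] at h1
  refine one_ne_zero (α := k) (Eq.trans ?_ h1)
  rw [← Matrix.det_one (n := Fin r)]
  congr 1
  ext i j
  simp [hookMat, firstIdx, Matrix.one_apply, Fin.ext_iff]

/-- Over a determinantal ring a semidualizing module is isomorphic to the ring or to any
given dualizing module. -/
theorem IsSD.equiv_or_equiv_detRing (h0 : 0 < r) (hm : r < m) (hn : r < n) {C E : Type}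
    [AddCommGroup C] [Module (DetRing k m n (r + 1)) C]
    [AddCommGroup E] [Module (DetRing k m n (r + 1)) E]
    (hC : IsSD (DetRing k m n (r + 1)) C)
    (hE : IsSD (DetRing k m n (r + 1)) E) (hE' : FID (DetRing k m n (r + 1)) E) :
    Nonempty (C ≃ₗ[DetRing k m n (r + 1)] DetRing k m n (r + 1)) ∨
      Nonempty (C ≃ₗ[DetRing k m n (r + 1)] E) := by
  have := isDomain_detRing (k := k) h0 hm hn
  let _ : Algebra (DetRing k m n (r + 1)) (PairRing k m n r) := (toPair k m n r).toAlgebra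
  have F := detRing_frame (k := k) h0 hm hn
  refine F.equiv_or_equiv (fun C _ _ hC => ?_) hC hE hE'
  obtain ⟨f⟩ := nonempty_localization_equiv (k := k) hm hn
  have hδ := hookMat_minor_ne_zero (k := k) hm hn
  have hδ' : (0 : DetRing k m n (r + 1)) ∉ Submonoid.powers
      ((detMat k m n (r + 1)).submatrix (firstIdx hm) (firstIdx hn)).det := by
    rintro ⟨a, ha⟩
    exact pow_ne_zero a F.d_ne_zero ha
  obtain ⟨e, he⟩ := exists_glDim_mvPolynomial k (Hook m n r)
  have hle := powers_le_nonZeroDivisors_of_noZeroDivisors hδ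
  have hle' := le_nonZeroDivisors_of_noZeroDivisors hδ'
  have := IsLocalization.isDomain_localization hle
  have := IsLocalization.isDomain_localization hle'
  have := UniqueFactorizationMonoid.of_isLocalization
    (Submonoid.powers ((hookMat k m n r).submatrix (firstIdx hm) (firstIdx hn)).det)
    (Localization.Away ((hookMat k m n r).submatrix (firstIdx hm) (firstIdx hn)).det)
  have := f.toMulEquiv.uniqueFactorizationMonoid this
  obtain ⟨J, ⟨_, a, rfl⟩, hs, h⟩ := hC.exists_ideal _ hδ' (fid_localization_away he hδ f)
  exact ⟨J, a, hs, h⟩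

end Generic
end Semidual

end

section

namespace Semidual
open Abelian TensorProduct

theorem FID.of_ringEquiv {A B : Type} [CommRing A] [CommRing B] (e : A ≃+* B) (h : FID A A) :
    FID B B := by
  let _ : Algebra A B := (e : A →+* B).toAlgebra
  exact FID.of_regChain (K := Set.univ) .nil h B e.surjective
    ((RingHom.injective_iff_ker_eq_bot _).1 e.injective)

theorem FID.of_span_singleton {A B : Type} [CommRing A] [CommRing B] (h : FID A A) (g : A →+* B)
    (hg : Function.Surjective g) {x : A} (hx : ∀ y, x * y = 0 → y = 0)
    (hk : RingHom.ker g = Ideal.span {x}) : FID B B := by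
  let _ : Algebra A B := g.toAlgebra
  exact FID.of_regChain (K := Set.univ) (.snoc .nil x trivial hx) h B hg
    (hk.trans (bot_sup_eq _).symm)

theorem FID.of_mvPolynomial {B σ : Type} [CommRing B] [Finite σ]
    (h : FID (MvPolynomial σ B) (MvPolynomial σ B)) : FID B B := by
  have key : ∀ n, FID (MvPolynomial (Fin n) B) (MvPolynomial (Fin n) B) → FID B B := by
    intro n
    induction n with
    | zero => exact fun h => h.of_ringEquiv (MvPolynomial.isEmptyRingEquiv B (Fin 0))
    | succ n ih =>
      intro h
      refine ih (FID.of_span_singleton (h.of_ringEquiv (MvPolynomial.finSuccEquiv B n).toRingEquiv)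
        Polynomial.constantCoeff (fun a => ⟨Polynomial.C a, by simp⟩) (x := Polynomial.X)
        (fun y hy => ?_) ?_)
      · exact (Polynomial.monic_X.mul_right_eq_zero_iff).1 hy
      · ext p
        rw [RingHom.mem_ker, Ideal.mem_span_singleton, Polynomial.X_dvd_iff]
        rfl
  obtain ⟨n, ⟨e⟩⟩ := Finite.exists_equiv_fin σ
  exact key n (h.of_ringEquiv (MvPolynomial.renameEquiv B e).toRingEquiv)

section Generic

variable {k : Type} [Field k] {m n r : ℕ}

theorem detRing_subalgebra_eq_top {t : ℕ} (K : Subalgebra k (DetRing k m n t))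
    (h : ∀ i j, detMat k m n t i j ∈ K) (x : DetRing k m n t) : x ∈ K := by
  obtain ⟨x, rfl⟩ := Ideal.Quotient.mk_surjective x
  induction x using MvPolynomial.induction_on with
  | C a => exact K.algebraMap_mem a
  | add p q hp hq =>
    rw [map_add]
    exact K.add_mem hp hq
  | mul_X p i hp =>
    rw [map_mul]
    exact K.mul_mem hp (h i.1 i.2)

theorem fid_detRing_transpose {t : ℕ} (h : FID (DetRing k m n t) (DetRing k m n t)) :
    FID (DetRing k n m t) (DetRing k n m t) := by
  have hT : ∀ (a b : ℕ) (ρ : Fin t → Fin b) (γ : Fin t → Fin a),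
      ((detMat k a b t).transpose.submatrix ρ γ).det = 0 := fun a b ρ γ => by
    rw [← Matrix.transpose_submatrix, Matrix.det_transpose, detMat_minor_eq_zero]
  refine h.of_ringEquiv (AlgEquiv.ofAlgHom (detLift (k := k) (detMat k n m t).transpose (hT n m))
    (detLift (k := k) (detMat k m n t).transpose (hT m n)) ?_ ?_).toRingEquiv
  all_goals exact detRing_hom_ext fun i j => by simp

end Generic
end Semidual

end

section

namespace Semidual
open Abelian TensorProduct

section Border

variable {A : Type} [CommRing A] {m n r : ℕ}

/-- The matrix with corner `1`, first row `y`, first column `z` and Schur complement `M`. -/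
def border (M : Matrix (Fin m) (Fin n) A) (z : Fin m → A) (y : Fin n → A) :
    Matrix (Fin (m + 1)) (Fin (n + 1)) A :=
  Matrix.of fun i j => Fin.cases (Fin.cases 1 y j)
    (fun i => Fin.cases (z i) (fun j => M i j + z i * y j) j) i

@[simp] theorem border_zero_zero (M : Matrix (Fin m) (Fin n) A) (z : Fin m → A) (y : Fin n → A) :
    border M z y 0 0 = 1 := rfl

@[simp] theorem border_zero_succ (M : Matrix (Fin m) (Fin n) A) (z : Fin m → A) (y : Fin n → A)
    (j) : border M z y 0 (Fin.succ j) = y j := rfl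

@[simp] theorem border_succ_zero (M : Matrix (Fin m) (Fin n) A) (z : Fin m → A) (y : Fin n → A)
    (i) : border M z y (Fin.succ i) 0 = z i := rfl

@[simp] theorem border_succ_succ (M : Matrix (Fin m) (Fin n) A) (z : Fin m → A) (y : Fin n → A)
    (i j) : border M z y (Fin.succ i) (Fin.succ j) = M i j + z i * y j := rfl

theorem border_minor_of_mul (Y : Matrix (Fin m) (Fin r) A) (Z : Matrix (Fin r) (Fin n) A)
    (z : Fin m → A) (y : Fin n → A) (ρ : Fin (r + 2) → Fin (m + 1))
    (γ : Fin (r + 2) → Fin (n + 1)) : ((border (Y * Z) z y).submatrix ρ γ).det = 0 := by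
  let P : Matrix (Fin (m + 1)) (Fin (r + 1)) A :=
    Matrix.of fun i l => Fin.cases (Fin.cases 1 0 l) (fun i => Fin.cases (z i) (Y i) l) i
  let Q : Matrix (Fin (r + 1)) (Fin (n + 1)) A :=
    Matrix.of fun l j => Fin.cases (Fin.cases 1 y j) (fun l => Fin.cases 0 (Z l) j) l
  have h : border (Y * Z) z y = P * Q := by
    ext i j
    cases i using Fin.cases <;> cases j using Fin.cases <;>
      simp [Matrix.mul_apply, Fin.sum_univ_succ, P, Q, add_comm]
  rw [h, Matrix.submatrix_mul _ _ _ id _ Function.bijective_id]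
  exact det_mul_eq_zero_of_lt _ _

theorem det_submatrix_eq_zero_of_map {B I J : Type} [CommRing B] (μ : A →+* B)
    (hμ : Function.Injective μ) (N : Matrix I J A) (N' : Matrix I J B) (h : N.map μ = N') {t : ℕ}
    (ρ : Fin t → I) (γ : Fin t → J) (hN : (N'.submatrix ρ γ).det = 0) :
    (N.submatrix ρ γ).det = 0 := by
  apply hμ
  rw [map_zero, RingHom.map_det, ← hN, ← h]
  rfl

theorem map_border {B : Type} [CommRing B] (μ : A →+* B) (M : Matrix (Fin m) (Fin n) A) (z y) :
    (border M z y).map μ = border (M.map μ) (μ ∘ z) (μ ∘ y) := by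
  ext i j
  cases i using Fin.cases <;> cases j using Fin.cases <;> simp

theorem schur_minor {t : ℕ} (M : Matrix (Fin (m + 1)) (Fin (n + 1)) A) (h1 : M 0 0 = 1)
    (hM : ∀ (ρ : Fin (t + 1) → Fin (m + 1)) (γ : Fin (t + 1) → Fin (n + 1)),
      (M.submatrix ρ γ).det = 0) (ρ : Fin t → Fin m) (γ : Fin t → Fin n) :
    ((Matrix.of fun i j => M (Fin.succ i) (Fin.succ j) - M (Fin.succ i) 0 * M 0 (Fin.succ j) :
      Matrix (Fin m) (Fin n) A).submatrix ρ γ).det = 0 := by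
  let e : Unit ⊕ Fin t ≃ Fin (t + 1) :=
    ((Equiv.sumCongr (Equiv.ofUnique Unit (Fin 1)) (Equiv.refl _)).trans finSumFinEquiv).trans
      (finCongr (add_comm 1 t))
  have h := hM (Sum.elim (fun _ => 0) (Fin.succ ∘ ρ) ∘ e.symm)
    (Sum.elim (fun _ => 0) (Fin.succ ∘ γ) ∘ e.symm)
  have h2 : (M.submatrix (Sum.elim (fun _ : Unit => 0) (Fin.succ ∘ ρ))
      (Sum.elim (fun _ : Unit => 0) (Fin.succ ∘ γ))).det = 0 := by
    rw [← h, ← Matrix.det_submatrix_equiv_self e.symm]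
    rfl
  rw [← Matrix.fromBlocks_toBlocks (M.submatrix _ _)] at h2
  have h3 : (M.submatrix (Sum.elim (fun _ : Unit => 0) (Fin.succ ∘ ρ))
      (Sum.elim (fun _ : Unit => 0) (Fin.succ ∘ γ))).toBlocks₁₁ = 1 := by
    ext i j
    simp [Matrix.toBlocks₁₁, h1]
  rw [h3, Matrix.det_fromBlocks_one₁₁] at h2
  rw [← h2]
  congr 1
  ext i j
  simp [Matrix.mul_apply, Matrix.toBlocks₁₂, Matrix.toBlocks₂₁, Matrix.toBlocks₂₂]

end Border

section Generic

variable {k : Type} [Field k] {m n r : ℕ}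

variable (k m n r) in
/-- The generic bordered matrix. -/
noncomputable def genericBorder : Matrix (Fin (m + 1)) (Fin (n + 1))
    (MvPolynomial (Fin m ⊕ Fin n) (DetRing k m n (r + 1))) :=
  border ((detMat k m n (r + 1)).map MvPolynomial.C)
    (fun i => MvPolynomial.X (Sum.inl i)) (fun j => MvPolynomial.X (Sum.inr j))

theorem genericBorder_minor (h0 : 0 < r) (hm : r < m) (hn : r < n)
    (ρ : Fin (r + 2) → Fin (m + 1)) (γ : Fin (r + 2) → Fin (n + 1)) :
    ((genericBorder k m n r).submatrix ρ γ).det = 0 := by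
  let μ : MvPolynomial (Fin m ⊕ Fin n) (DetRing k m n (r + 1)) →+*
    MvPolynomial (Fin m ⊕ Fin n) (PairRing k m n r) := MvPolynomial.map (toPair k m n r).toRingHom
  have hμ : Function.Injective μ :=
    MvPolynomial.map_injective (toPair k m n r).toRingHom (toPair_injective h0 hm hn)
  refine det_submatrix_eq_zero_of_map μ hμ _ _ ?_ ρ γ
    (border_minor_of_mul ((leftMat k m n r).map MvPolynomial.C)
      ((rightMat k m n r).map MvPolynomial.C) (fun i => MvPolynomial.X (Sum.inl i))
      (fun j => MvPolynomial.X (Sum.inr j)) ρ γ)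
  refine (map_border (A := MvPolynomial (Fin m ⊕ Fin n) (DetRing k m n (r + 1)))
    (B := MvPolynomial (Fin m ⊕ Fin n) (PairRing k m n r)) μ _ _ _).trans ?_
  congr 1
  · rw [← Matrix.map_mul]
    ext1 i j
    refine (MvPolynomial.map_C _ _).trans ?_
    exact congrArg _ (detLift_detMat _ _ _ _)
  · ext1 i
    exact MvPolynomial.map_X _ _
  · ext1 i
    exact MvPolynomial.map_X _ _

/-- The dehomogenization of the determinantal ring at a corner entry. -/
noncomputable def borderHom (k : Type) [Field k] (h0 : 0 < r) (hm : r < m) (hn : r < n) :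
    DetRing k (m + 1) (n + 1) (r + 2) →ₐ[k]
      MvPolynomial (Fin m ⊕ Fin n) (DetRing k m n (r + 1)) :=
  detLift (genericBorder k m n r) (genericBorder_minor h0 hm hn)

theorem borderHom_detMat (h0 : 0 < r) (hm : r < m) (hn : r < n) (i j) :
    borderHom k h0 hm hn (detMat k (m + 1) (n + 1) (r + 2) i j) = genericBorder k m n r i j :=
  detLift_detMat _ _ _ _

theorem borderHom_surjective (h0 : 0 < r) (hm : r < m) (hn : r < n) :
    Function.Surjective (borderHom k h0 hm hn) := by
  have hX : ∀ v, MvPolynomial.X v ∈ (borderHom k h0 hm hn).range := by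
    rintro (i | j)
    · exact ⟨_, borderHom_detMat h0 hm hn i.succ 0⟩
    · exact ⟨_, borderHom_detMat h0 hm hn 0 j.succ⟩
  have hC : ∀ b, MvPolynomial.C b ∈ (borderHom k h0 hm hn).range := by
    intro b
    refine detRing_subalgebra_eq_top ((borderHom k h0 hm hn).range.comap
      (IsScalarTower.toAlgHom k (DetRing k m n (r + 1)) _)) (fun i j => ?_) b
    have h2 : genericBorder k m n r i.succ j.succ ∈ (borderHom k h0 hm hn).range :=
      ⟨_, borderHom_detMat h0 hm hn i.succ j.succ⟩
    obtain ⟨a, ha⟩ := h2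
    obtain ⟨b', hb⟩ := hX (.inl i)
    obtain ⟨c, hc⟩ := hX (.inr j)
    refine ⟨a - b' * c, ?_⟩
    refine (map_sub (borderHom k h0 hm hn) _ _).trans ?_
    refine (congrArg₂ _ ha ((map_mul (borderHom k h0 hm hn) _ _).trans
      (congrArg₂ _ hb hc))).trans ?_
    rw [genericBorder, border_succ_succ]
    exact add_sub_cancel_right (G := MvPolynomial (Fin m ⊕ Fin n) (DetRing k m n (r + 1))) _ _
  intro q
  change q ∈ (borderHom k h0 hm hn).range
  induction q using MvPolynomial.induction_on with
  | C b => exact hC b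
  | add p q hp hq => exact add_mem hp hq
  | mul_X p v hp => exact mul_mem hp (hX v)

theorem eq_zero_of_borderHom_eq_zero (h0 : 0 < r) (hm : r < m) (hn : r < n) {W : Type} [CommRing W]
    [Algebra k W] (q : DetRing k (m + 1) (n + 1) (r + 2) →ₐ[k] W)
    (hq : q (detMat k (m + 1) (n + 1) (r + 2) 0 0) = 1) {a} (ha : borderHom k h0 hm hn a = 0) :
    q a = 0 := by
  let MW : Matrix (Fin (m + 1)) (Fin (n + 1)) W := (detMat k (m + 1) (n + 1) (r + 2)).map q
  have hMW : ∀ (ρ : Fin (r + 2) → Fin (m + 1)) (γ : Fin (r + 2) → Fin (n + 1)),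
      (MW.submatrix ρ γ).det = 0 := by
    intro ρ γ
    rw [Matrix.submatrix_map, ← AlgHom.mapMatrix_apply, ← AlgHom.map_det, detMat_minor_eq_zero,
      map_zero]
  let f₀ : DetRing k m n (r + 1) →ₐ[k] W := detLift _ (schur_minor MW hq hMW)
  let f : MvPolynomial (Fin m ⊕ Fin n) (DetRing k m n (r + 1)) →+* W :=
    MvPolynomial.eval₂Hom f₀.toRingHom
      (Sum.elim (fun i => MW (Fin.succ i) 0) fun j => MW 0 (Fin.succ j))
  have hk : ∀ c, f (algebraMap k _ c) = algebraMap k W c := fun c =>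
    (MvPolynomial.eval₂_C _ _ _).trans (f₀.commutes c)
  let fk : MvPolynomial (Fin m ⊕ Fin n) (DetRing k m n (r + 1)) →ₐ[k] W :=
    { f with commutes' := hk }
  have h1 : fk.comp (borderHom k h0 hm hn) = q := by
    refine detRing_hom_ext fun i j => ?_
    change f (borderHom k h0 hm hn _) = MW i j
    rw [borderHom_detMat, genericBorder]
    cases i using Fin.cases <;> cases j using Fin.cases <;> simp [f, f₀]
    exact hq.symm
  rw [← h1, AlgHom.comp_apply, ha, map_zero]

theorem detMat_sub_one_ne_zero {t : ℕ} (i : Fin m) (j : Fin n) (ht : 0 < t) :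
    detMat k m n t i j - 1 ≠ 0 := by
  intro h
  have := congrArg (detLift (k := k) (t := t) (0 : Matrix (Fin m) (Fin n) k) fun ρ γ =>
    Matrix.det_eq_zero_of_row_eq_zero ⟨0, ht⟩ (by simp)) h
  simp at this

/-- Localizing at an entry, the Gorenstein property passes to smaller determinantal rings. -/
theorem fid_detRing_of_succ (h0 : 0 < r) (hm : r < m) (hn : r < n)
    (h : FID (DetRing k (m + 1) (n + 1) (r + 2)) (DetRing k (m + 1) (n + 1) (r + 2))) :
    FID (DetRing k m n (r + 1)) (DetRing k m n (r + 1)) := by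
  have := isDomain_detRing (k := k) (m := m + 1) (n := n + 1) (r := r + 1) (by omega) (by omega)
    (by omega)
  refine FID.of_mvPolynomial (h.of_span_singleton (borderHom k h0 hm hn).toRingHom
    (borderHom_surjective h0 hm hn) (x := detMat k (m + 1) (n + 1) (r + 2) 0 0 - 1)
    (fun y hy => ?_) ?_)
  · exact (mul_eq_zero.1 hy).resolve_left (detMat_sub_one_ne_zero _ _ (by omega))
  · apply le_antisymm
    · intro a ha
      rw [← Ideal.Quotient.eq_zero_iff_mem]
      let I : Ideal (DetRing k (m + 1) (n + 1) (r + 2)) :=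
        Ideal.span {detMat k (m + 1) (n + 1) (r + 2) 0 0 - 1}
      let q : DetRing k (m + 1) (n + 1) (r + 2) →ₐ[k]
        (DetRing k (m + 1) (n + 1) (r + 2) ⧸ I) := Ideal.Quotient.mkₐ k I
      refine eq_zero_of_borderHom_eq_zero (W := DetRing k (m + 1) (n + 1) (r + 2) ⧸ I)
        h0 hm hn q ?_ ha
      exact sub_eq_zero.1 ((map_sub (Ideal.Quotient.mk _) _ _).symm.trans
        (Ideal.Quotient.eq_zero_iff_mem.2 (Ideal.mem_span_singleton_self _)))
    · rw [Ideal.span_singleton_le_iff_mem, RingHom.mem_ker]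
      refine (map_sub (borderHom k h0 hm hn) _ _).trans ?_
      rw [borderHom_detMat, map_one]
      exact sub_self 1

end Generic
end Semidual

end

section

namespace Semidual
open Abelian TensorProduct

section Graded

variable {k σ : Type} [Field k] {w : σ → ℤ} {R : Type} [CommRing R] [Algebra R (MvPolynomial σ k)]

/-- The homogeneous polynomials of degree `i`, as a module over a ring acting in degree zero. -/
noncomputable def homSub (hR : ∀ a, MvPolynomial.IsWeightedHomogeneous w (algebraMap R (MvPolynomial σ k) a) 0)
    (i : ℤ) : Submodule R (MvPolynomial σ k) where
  carrier := {f | MvPolynomial.IsWeightedHomogeneous w f i}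
  add_mem' := fun ha hb => MvPolynomial.IsWeightedHomogeneous.add ha hb
  zero_mem' := MvPolynomial.isWeightedHomogeneous_zero k w i
  smul_mem' := fun a f hf => by
    have := (hR a).mul hf
    rwa [zero_add, ← Algebra.smul_def] at this

/-- The homogeneous polynomials in the ideal generated by the variables in `s`. -/
noncomputable def homRel (hR : ∀ a, MvPolynomial.IsWeightedHomogeneous w (algebraMap R (MvPolynomial σ k) a) 0)
    (s : Set σ) (i : ℤ) : Submodule R (homSub hR i) :=
  ((Ideal.span (MvPolynomial.X '' s : Set (MvPolynomial σ k))).restrictScalars R).comap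
    (homSub hR i).subtype

theorem mem_homRel
    {hR : ∀ a, MvPolynomial.IsWeightedHomogeneous w (algebraMap R (MvPolynomial σ k) a) 0}
    {s : Set σ} {i : ℤ} {f : homSub hR i} : f ∈ homRel hR s i ↔
      (f : MvPolynomial σ k) ∈ Ideal.span (MvPolynomial.X '' s : Set (MvPolynomial σ k)) := Iff.rfl

/-- The degree `i` part of the quotient by the variables in `s`. -/
abbrev HomQuot
    (hR : ∀ a, MvPolynomial.IsWeightedHomogeneous w (algebraMap R (MvPolynomial σ k) a) 0)
    (s : Set σ) (i : ℤ) : Type := homSub hR i ⧸ homRel hR s i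

/-- Multiplication by a variable. -/
noncomputable def homMulX
    (hR : ∀ a, MvPolynomial.IsWeightedHomogeneous w (algebraMap R (MvPolynomial σ k) a) 0)
    (x : σ) {i j : ℤ} (hij : i + w x = j) : homSub hR i →ₗ[R] homSub hR j :=
  (LinearMap.mulLeft R (MvPolynomial.X x : MvPolynomial σ k)).restrict fun f hf => by
    have := (MvPolynomial.isWeightedHomogeneous_X k w x).mul hf
    rwa [add_comm, hij] at this

@[simp] theorem coe_homMulX
    {hR : ∀ a, MvPolynomial.IsWeightedHomogeneous w (algebraMap R (MvPolynomial σ k) a) 0}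
    {x : σ} {i j : ℤ} (hij : i + w x = j) (f : homSub hR i) :
    (homMulX hR x hij f : MvPolynomial σ k) = MvPolynomial.X x * (f : MvPolynomial σ k) := rfl

theorem X_mul_mem_span_X {s : Set σ} {x : σ} (hx : x ∉ s) {f : MvPolynomial σ k}
    (h : MvPolynomial.X x * f ∈ Ideal.span (MvPolynomial.X '' s : Set (MvPolynomial σ k))) :
    f ∈ Ideal.span (MvPolynomial.X '' s : Set (MvPolynomial σ k)) := by
  classical
  rw [MvPolynomial.mem_ideal_span_X_image] at h ⊢
  intro d hd
  obtain ⟨y, hy, h2⟩ := h (Finsupp.single x 1 + d) (by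
    rw [MvPolynomial.mem_support_iff] at hd ⊢
    rwa [MvPolynomial.coeff_X_mul])
  refine ⟨y, hy, ?_⟩
  have : x ≠ y := fun h => hx (h ▸ hy)
  simpa [Finsupp.single_apply, this] using h2

theorem exists_sub_X_mul_mem {s : Set σ} {x : σ} {i : ℤ} {f : MvPolynomial σ k}
    (hf : MvPolynomial.IsWeightedHomogeneous w f i)
    (h : f ∈ Ideal.span (MvPolynomial.X '' insert x s : Set (MvPolynomial σ k))) :
    ∃ g, MvPolynomial.IsWeightedHomogeneous w g (i - w x) ∧
      f - MvPolynomial.X x * g ∈ Ideal.span (MvPolynomial.X '' s : Set (MvPolynomial σ k)) := by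
  classical
  refine ⟨f.divMonomial (Finsupp.single x 1), fun d hd => ?_, ?_⟩
  · rw [MvPolynomial.coeff_divMonomial] at hd
    have := hf hd
    rw [map_add, Finsupp.weight_single] at this
    simp at this
    linarith
  · have h1 := MvPolynomial.divMonomial_add_modMonomial_single f x
    rw [sub_eq_iff_eq_add'.2 h1.symm, MvPolynomial.mem_ideal_span_X_image]
    rw [MvPolynomial.mem_ideal_span_X_image] at h
    intro d hd
    rw [MvPolynomial.mem_support_iff] at hd
    by_cases hx : Finsupp.single x 1 ≤ d
    · exact absurd (MvPolynomial.coeff_modMonomial_of_le _ hx) hd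
    · rw [MvPolynomial.coeff_modMonomial_of_not_le _ hx] at hd
      obtain ⟨y, hy, h2⟩ := h d (MvPolynomial.mem_support_iff.2 hd)
      refine ⟨y, ?_, h2⟩
      rcases hy with rfl | hy
      · refine absurd ?_ hx
        rw [Finsupp.single_le_iff]
        omega
      · exact hy

theorem exists_homQuot_ses
    (hR : ∀ a, MvPolynomial.IsWeightedHomogeneous w (algebraMap R (MvPolynomial σ k) a) 0)
    {s : Set σ} {x : σ} (hx : x ∉ s) {i j : ℤ} (hij : i + w x = j) :
    ∃ (f : HomQuot hR s i →ₗ[R] HomQuot hR s j) (g : HomQuot hR s j →ₗ[R] HomQuot hR (insert x s) j),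
      SES f g := by
  let f : HomQuot hR s i →ₗ[R] HomQuot hR s j :=
    Submodule.mapQ (homRel hR s i) (homRel hR s j) (homMulX hR x hij) fun a ha => by
      rw [mem_homRel] at ha
      rw [Submodule.mem_comap, mem_homRel, coe_homMulX]
      exact Ideal.mul_mem_left _ _ ha
  let g : HomQuot hR s j →ₗ[R] HomQuot hR (insert x s) j :=
    Submodule.mapQ (homRel hR s j) (homRel hR (insert x s) j) LinearMap.id fun a ha => by
      rw [mem_homRel] at ha
      rw [Submodule.mem_comap, mem_homRel]
      exact Ideal.span_mono (Set.image_mono (Set.subset_insert x s)) ha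
  have hf : ∀ a, f (Submodule.Quotient.mk a) = Submodule.Quotient.mk (homMulX hR x hij a) :=
    fun a => rfl
  have hg : ∀ a, g (Submodule.Quotient.mk a) = Submodule.Quotient.mk a := fun a => rfl
  refine ⟨f, g, ?_, ?_, ?_⟩
  · rw [injective_iff_map_eq_zero]
    intro a ha
    obtain ⟨a, rfl⟩ := Submodule.Quotient.mk_surjective _ a
    rw [hf, Submodule.Quotient.mk_eq_zero, mem_homRel, coe_homMulX] at ha
    rw [Submodule.Quotient.mk_eq_zero, mem_homRel]
    exact X_mul_mem_span_X hx ha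
  · intro b
    constructor
    · intro hb
      obtain ⟨b, rfl⟩ := Submodule.Quotient.mk_surjective _ b
      rw [hg, Submodule.Quotient.mk_eq_zero, mem_homRel] at hb
      obtain ⟨c, hc, hbc⟩ := exists_sub_X_mul_mem b.2 hb
      rw [← hij, add_sub_cancel_right] at hc
      refine ⟨Submodule.Quotient.mk ⟨c, hc⟩, ?_⟩
      rw [hf, eq_comm, Submodule.Quotient.eq, mem_homRel]
      exact hbc
    · rintro ⟨a, rfl⟩
      obtain ⟨a, rfl⟩ := Submodule.Quotient.mk_surjective _ a
      rw [hf, hg, Submodule.Quotient.mk_eq_zero, mem_homRel, coe_homMulX]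
      exact Ideal.mul_mem_right _ _ (Ideal.subset_span ⟨x, Set.mem_insert x s, rfl⟩)
  · intro b
    obtain ⟨b, rfl⟩ := Submodule.Quotient.mk_surjective _ b
    exact ⟨Submodule.Quotient.mk b, hg b⟩

theorem nonempty_homQuot_empty
    (hR : ∀ a, MvPolynomial.IsWeightedHomogeneous w (algebraMap R (MvPolynomial σ k) a) 0) (i : ℤ) :
    Nonempty (HomQuot hR ∅ i ≃ₗ[R] homSub hR i) := by
  refine ⟨Submodule.quotEquivOfEqBot _ ?_⟩
  rw [eq_bot_iff]
  intro a ha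
  have h : (a : MvPolynomial σ k) ∈ Ideal.span (MvPolynomial.X '' ∅ : Set (MvPolynomial σ k)) := ha
  rw [Set.image_empty, Ideal.span_empty] at h
  exact Subtype.ext h

end Graded
end Semidual

end

section

namespace Semidual
open Abelian TensorProduct

section Duality

variable {k σ : Type} [Field k] {w : σ → ℤ} {R : Type} [CommRing R] [Algebra R (MvPolynomial σ k)]
  (hR : ∀ a, MvPolynomial.IsWeightedHomogeneous w (algebraMap R (MvPolynomial σ k) a) 0)
  (hinj : Function.Injective (algebraMap R (MvPolynomial σ k)))
  (hsurj : ∀ f, MvPolynomial.IsWeightedHomogeneous w f 0 →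
    ∃ a, algebraMap R (MvPolynomial σ k) a = f)

include hinj hsurj

theorem exists_homSub_zero_equiv : ∃ e : R ≃ₗ[R] homSub hR 0, ∀ a,
    (e a : MvPolynomial σ k) = algebraMap R (MvPolynomial σ k) a := by
  let f : R →ₗ[R] homSub hR 0 := (Algebra.linearMap R (MvPolynomial σ k)).codRestrict _ hR
  refine ⟨LinearEquiv.ofBijective f ⟨fun a b h => hinj (congrArg Subtype.val h), fun b => ?_⟩,
    fun _ => rfl⟩
  obtain ⟨a, ha⟩ := hsurj _ b.2
  exact ⟨a, Subtype.ext ha⟩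

theorem finite_homSub [IsNoetherianRing R] {z : σ} (hz : w z = -1) (i : ℕ) :
    Module.Finite R (homSub hR i) := by
  obtain ⟨e, -⟩ := exists_homSub_zero_equiv hR hinj hsurj
  induction i with
  | zero => exact Module.Finite.equiv e
  | succ i ih =>
    refine Module.Finite.of_injective (homMulX hR z (j := (i : ℤ)) (by push_cast; omega)) ?_
    intro a b h
    have h := congrArg Subtype.val h
    rw [coe_homMulX, coe_homMulX] at h
    exact Subtype.ext (mul_left_cancel₀ (MvPolynomial.X_ne_zero z) h)

omit hinj hsurj in
theorem isWeightedHomogeneous_of_X_pow_mul {x : σ} {i : ℕ} {d : ℤ} {g : MvPolynomial σ k}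
    (h : MvPolynomial.IsWeightedHomogeneous w (MvPolynomial.X x ^ i * g) (i * w x + d)) :
    MvPolynomial.IsWeightedHomogeneous w g d := by
  intro c hc
  have h1 : MvPolynomial.coeff (Finsupp.single x i + c) (MvPolynomial.X x ^ i * g) ≠ 0 := by
    rw [MvPolynomial.X_pow_eq_monomial, MvPolynomial.coeff_monomial_mul, one_mul]
    exact hc
  have := h h1
  rw [map_add, Finsupp.weight_single] at this
  simp at this
  exact this

theorem nonempty_homSub_dual {x y z : σ} (hxy : x ≠ y) (hx : w x = 1) (hy : w y = 1)
    (hz : w z = -1) (i : ℕ) :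
    Nonempty (homSub hR (-i) ≃ₗ[R] (homSub hR i →ₗ[R] R)) := by
  obtain ⟨e, he⟩ := exists_homSub_zero_equiv hR hinj hsurj
  let μ : homSub hR (-i) →ₗ[R] homSub hR i →ₗ[R] homSub hR 0 :=
    LinearMap.mk₂ R (fun g f => ⟨f * g, by
      have := (f.2 : MvPolynomial.IsWeightedHomogeneous w _ _).mul g.2
      rwa [add_neg_cancel] at this⟩)
      (fun a b c => Subtype.ext (mul_add _ _ _)) (fun a b c => Subtype.ext (mul_smul_comm _ _ _))
      (fun a b c => Subtype.ext (add_mul _ _ _)) (fun a b c => Subtype.ext (smul_mul_assoc _ _ _))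
  have hμ : ∀ g f, (μ g f : MvPolynomial σ k) = f * g := fun _ _ => rfl
  have hpow : ∀ v : σ, w v = 1 → MvPolynomial.IsWeightedHomogeneous w
      ((MvPolynomial.X v : MvPolynomial σ k) ^ i) (i : ℤ) := fun v hv => by
    have := (MvPolynomial.isWeightedHomogeneous_X k w v).pow i
    rwa [hv, nsmul_one] at this
  have hzpow : MvPolynomial.IsWeightedHomogeneous w
      ((MvPolynomial.X z : MvPolynomial σ k) ^ i) (-i : ℤ) := by
    have := (MvPolynomial.isWeightedHomogeneous_X k w z).pow i
    rwa [hz, nsmul_eq_mul, mul_neg_one] at this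
  let xi : homSub hR i := ⟨_, hpow x hx⟩
  let yi : homSub hR i := ⟨_, hpow y hy⟩
  have hbij : Function.Bijective μ := by
    constructor
    · intro a b h
      have h1 := congrArg Subtype.val (LinearMap.congr_fun h xi)
      rw [hμ, hμ] at h1
      exact Subtype.ext (mul_left_cancel₀ (pow_ne_zero _ (MvPolynomial.X_ne_zero x)) h1)
    · intro h
      have hcomm : ∀ f : homSub hR i, (f : MvPolynomial σ k) * (h xi : MvPolynomial σ k) =
          MvPolynomial.X x ^ i * (h f : MvPolynomial σ k) := by
        intro f
        have h0 : ∀ p : homSub hR i, ∃ a : R, algebraMap R (MvPolynomial σ k) a =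
            MvPolynomial.X z ^ i * (p : MvPolynomial σ k) := fun p => hsurj _ (by
          have := hzpow.mul p.2
          rwa [neg_add_cancel] at this)
        obtain ⟨a, ha⟩ := h0 f
        obtain ⟨b, hb⟩ := h0 xi
        have h1 : a • xi = b • f := Subtype.ext (by
          rw [Submodule.coe_smul, Submodule.coe_smul, Algebra.smul_def, Algebra.smul_def, ha, hb]
          ring)
        have h2 := congrArg Subtype.val (congrArg h h1)
        rw [map_smul, map_smul, Submodule.coe_smul, Submodule.coe_smul, Algebra.smul_def,
          Algebra.smul_def, ha, hb, mul_assoc, mul_assoc] at h2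
        exact mul_left_cancel₀ (pow_ne_zero _ (MvPolynomial.X_ne_zero z)) h2
      have hdvd : (MvPolynomial.X x : MvPolynomial σ k) ^ i ∣ (h xi : MvPolynomial σ k) := by
        refine Prime.pow_dvd_of_dvd_mul_left MvPolynomial.X_prime i (a := MvPolynomial.X y ^ i)
          (fun hd => ?_) ⟨_, hcomm yi⟩
        exact hxy ((MvPolynomial.X_dvd_X).1 ((MvPolynomial.X_prime (R := k)).dvd_of_dvd_pow hd))
      obtain ⟨g, hg⟩ := hdvd
      have hg' : g ∈ homSub hR (-i) := by
        refine isWeightedHomogeneous_of_X_pow_mul (x := x) (i := i) ?_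
        rw [← hg, hx, mul_one, add_neg_cancel]
        exact (h xi).2
      refine ⟨⟨g, hg'⟩, LinearMap.ext fun f => Subtype.ext ?_⟩
      refine mul_left_cancel₀ (pow_ne_zero i (MvPolynomial.X_ne_zero (R := k) x)) ?_
      rw [hμ, ← hcomm, hg]
      ring
  exact ⟨(LinearEquiv.ofBijective μ hbij).trans (LinearEquiv.congrRight e.symm)⟩

end Duality
end Semidual

end

section

namespace Semidual
open Abelian TensorProduct

theorem exists_weight_signs {σ : Type} {w : σ → ℤ} (hw : ∀ v, w v = 1 ∨ w v = -1) {d : σ →₀ ℕ}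
    (hd : d ≠ 0) (h : Finsupp.weight w d = 0) :
    (∃ v, w v = 1 ∧ d v ≠ 0) ∧ ∃ v, w v = -1 ∧ d v ≠ 0 := by
  rw [Finsupp.weight_apply, Finsupp.sum] at h
  have hne : d.support.Nonempty := Finsupp.support_nonempty_iff.2 hd
  have hpos : ∀ v ∈ d.support, (0 : ℤ) < d v := fun v hv =>
    Int.natCast_pos.2 (Nat.pos_of_ne_zero (Finsupp.mem_support_iff.1 hv))
  constructor
  · by_contra! hcon
    refine (Finset.sum_neg (fun v hv => ?_) hne).ne h
    rw [(hw v).resolve_left fun h1 => Finsupp.mem_support_iff.1 hv (hcon v h1), nsmul_eq_mul,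
      mul_neg_one]
    exact neg_neg_of_pos (hpos v hv)
  · by_contra! hcon
    refine (Finset.sum_pos (fun v hv => ?_) hne).ne' h
    rw [(hw v).resolve_right fun h1 => Finsupp.mem_support_iff.1 hv (hcon v h1), nsmul_eq_mul,
      mul_one]
    exact hpos v hv

section Segre

variable {k : Type} [Field k] {m n : ℕ}

variable (m n) in
/-- The grading of the Segre coordinates. -/
def segreWeight : (Fin m × Fin 1) ⊕ (Fin 1 × Fin n) → ℤ := Sum.elim (fun _ => 1) fun _ => -1

noncomputable instance segreAlgebra : Algebra (DetRing k m n 2) (PairRing k m n 1) :=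
  (toPair k m n 1).toRingHom.toAlgebra

noncomputable instance segreGenericAlgebra :
    Algebra (MvPolynomial (Fin m × Fin n) k) (PairRing k m n 1) :=
  ((algebraMap (DetRing k m n 2) (PairRing k m n 1)).comp
    (algebraMap (MvPolynomial (Fin m × Fin n) k) (DetRing k m n 2))).toAlgebra

instance segre_isScalarTower :
    IsScalarTower (MvPolynomial (Fin m × Fin n) k) (DetRing k m n 2) (PairRing k m n 1) :=
  IsScalarTower.of_algebraMap_eq' (R := MvPolynomial (Fin m × Fin n) k) (S := DetRing k m n 2)
    (A := PairRing k m n 1) rfl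

theorem algebraMap_segre_detMat (i : Fin m) (j : Fin n) :
    algebraMap (DetRing k m n 2) (PairRing k m n 1) (detMat k m n 2 i j) =
      MvPolynomial.X (Sum.inl (i, 0)) * MvPolynomial.X (Sum.inr (0, j)) := by
  refine (detLift_detMat _ _ i j).trans ?_
  simp [Matrix.mul_apply, leftMat, rightMat]

theorem algebraMap_segre_X (i : Fin m) (j : Fin n) :
    algebraMap (MvPolynomial (Fin m × Fin n) k) (PairRing k m n 1) (MvPolynomial.X (i, j)) =
      MvPolynomial.X (Sum.inl (i, 0)) * MvPolynomial.X (Sum.inr (0, j)) :=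
  algebraMap_segre_detMat i j

theorem segre_homogeneous (a : DetRing k m n 2) : MvPolynomial.IsWeightedHomogeneous
    (segreWeight m n) (algebraMap (DetRing k m n 2) (PairRing k m n 1) a) 0 := by
  let K : Subalgebra k (DetRing k m n 2) :=
    { carrier := {a | MvPolynomial.IsWeightedHomogeneous
        (segreWeight m n) (algebraMap (DetRing k m n 2) (PairRing k m n 1) a) 0}
      mul_mem' := fun {a b} ha hb => by
        have := MvPolynomial.IsWeightedHomogeneous.mul ha hb
        rwa [add_zero, ← map_mul] at this
      add_mem' := fun {a b} ha hb => by
        have := MvPolynomial.IsWeightedHomogeneous.add ha hb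
        rwa [← map_add] at this
      algebraMap_mem' := fun c => by
        change MvPolynomial.IsWeightedHomogeneous _ (toPair k m n 1 (algebraMap k _ c)) 0
        rw [AlgHom.commutes]
        exact MvPolynomial.isWeightedHomogeneous_C _ c }
  refine detRing_subalgebra_eq_top K (fun i j => ?_) a
  change MvPolynomial.IsWeightedHomogeneous _ (algebraMap _ _ (detMat k m n 2 i j)) 0
  rw [algebraMap_segre_detMat]
  exact (MvPolynomial.isWeightedHomogeneous_X k _ _).mul (MvPolynomial.isWeightedHomogeneous_X k _ _)

theorem exists_algebraMap_segre_eq (f : PairRing k m n 1)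
    (hf : MvPolynomial.IsWeightedHomogeneous (segreWeight m n) f 0) :
    ∃ a, algebraMap (DetRing k m n 2) (PairRing k m n 1) a = f := by
  suffices h : ∀ (e : ℕ) (d : (Fin m × Fin 1) ⊕ (Fin 1 × Fin n) →₀ ℕ), d.degree = e →
      Finsupp.weight (segreWeight m n) d = 0 →
      MvPolynomial.monomial d 1 ∈ (toPair k m n 1).range by
    change f ∈ (toPair k m n 1).range
    rw [← MvPolynomial.support_sum_monomial_coeff f]
    refine sum_mem fun d hd => ?_
    rw [← mul_one (MvPolynomial.coeff d f), ← smul_eq_mul, ← MvPolynomial.smul_monomial]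
    exact Subalgebra.smul_mem _ (h _ d rfl (hf (MvPolynomial.mem_support_iff.1 hd))) _
  intro e
  induction e using Nat.strong_induction_on with
  | _ e ih =>
  intro d hde hd
  by_cases h0 : d = 0
  · rw [h0]
    exact one_mem _
  have hw : ∀ v, segreWeight m n v = 1 ∨ segreWeight m n v = -1 := by
    rintro (v | v) <;> simp [segreWeight]
  obtain ⟨⟨p, hp, hdp⟩, q, hq, hdq⟩ := exists_weight_signs hw h0 hd
  have hpq : p ≠ q := fun h => by rw [h, hq] at hp; omega
  have h1 : Finsupp.single p 1 + Finsupp.single q 1 ≤ d := by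
    classical
    intro v
    rw [Finsupp.add_apply, Finsupp.single_apply, Finsupp.single_apply]
    split_ifs with h1 h2 h2
    · exact absurd (h1.trans h2.symm) hpq
    · subst h1; omega
    · subst h2; omega
    · omega
  obtain ⟨d', rfl⟩ := exists_add_of_le h1
  rw [map_add, map_add, Finsupp.weight_single, Finsupp.weight_single, hp, hq] at hd
  rw [map_add, map_add, Finsupp.degree_single, Finsupp.degree_single] at hde
  have hmem := ih d'.degree (by omega) d' rfl (by simpa using hd)
  have hmem2 : (MvPolynomial.monomial (Finsupp.single p 1 + Finsupp.single q 1) 1 :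
      PairRing k m n 1) ∈ (toPair k m n 1).range := by
    rcases p with ⟨i, i'⟩ | p
    · rcases q with q | ⟨j', j⟩
      · simp [segreWeight] at hq
      · refine ⟨detMat k m n 2 i j, (algebraMap_segre_detMat i j).trans ?_⟩
        rw [Subsingleton.elim i' 0, Subsingleton.elim j' 0, MvPolynomial.X, MvPolynomial.X,
          MvPolynomial.monomial_mul, one_mul]
    · simp [segreWeight] at hp
  have := mul_mem hmem2 hmem
  rwa [MvPolynomial.monomial_mul, one_mul] at this

end Segre
end Semidual

end

section

namespace Semidual
open Abelian TensorProduct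

theorem rect_gen_one {k : Type} [Field k] {m n l : ℕ} (J : Ideal (MvPolynomial (Fin m × Fin n) k)) :
    rect (gen k m n) 1 m l ≤ J ↔
      ∀ (i : Fin m) (j : Fin n), (j : ℕ) < l → MvPolynomial.X (i, j) ∈ J := by
  rw [rect, Ideal.span_le]
  constructor
  · intro h i j hj
    refine h ⟨fun _ => i, fun _ => j, fun _ => i.2, fun _ => hj, ?_⟩
    simp [minor, gen]
  · rintro h _ ⟨ρ, γ, hρ, hγ, rfl⟩
    rw [minor, Matrix.det_unique]
    change gen k m n (ρ default) (γ default) ∈ J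
    rw [gen]
    split_ifs with h1
    · exact h _ _ (hγ _)
    · exact zero_mem _

section Segre

variable {k : Type} [Field k] {m n : ℕ}

variable (m n) in
/-- The first `l` column coordinates. -/
def segreCols (l : ℕ) : Set ((Fin m × Fin 1) ⊕ (Fin 1 × Fin n)) :=
  {v | ∃ j : Fin n, (j : ℕ) < l ∧ v = Sum.inr (0, j)}

variable (m n) in
/-- The first `l` row coordinates. -/
def segreRows (l : ℕ) : Set ((Fin m × Fin 1) ⊕ (Fin 1 × Fin n)) :=
  {v | ∃ i : Fin m, (i : ℕ) < l ∧ v = Sum.inl (i, 0)}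

theorem segreCols_succ {l : ℕ} (hl : l < n) :
    segreCols m n (l + 1) = insert (Sum.inr (0, ⟨l, hl⟩)) (segreCols m n l) := by
  ext v
  constructor
  · rintro ⟨j, hj, rfl⟩
    rcases Nat.lt_succ_iff_lt_or_eq.1 hj with h | rfl
    · exact Or.inr ⟨j, h, rfl⟩
    · exact Or.inl rfl
  · rintro (rfl | ⟨j, hj, rfl⟩)
    · exact ⟨_, Nat.lt_succ_self l, rfl⟩
    · exact ⟨j, by omega, rfl⟩

theorem segreRows_succ {l : ℕ} (hl : l < m) :
    segreRows m n (l + 1) = insert (Sum.inl (⟨l, hl⟩, 0)) (segreRows m n l) := by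
  ext v
  constructor
  · rintro ⟨j, hj, rfl⟩
    rcases Nat.lt_succ_iff_lt_or_eq.1 hj with h | rfl
    · exact Or.inr ⟨j, h, rfl⟩
    · exact Or.inl rfl
  · rintro (rfl | ⟨j, hj, rfl⟩)
    · exact ⟨_, Nat.lt_succ_self l, rfl⟩
    · exact ⟨j, by omega, rfl⟩

theorem notMem_segreCols {l : ℕ} (hl : l < n) : Sum.inr (0, ⟨l, hl⟩) ∉ segreCols m n l := by
  rintro ⟨j, hj, h⟩
  simp only [Sum.inr.injEq, Prod.mk.injEq] at h
  rw [← h.2] at hj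
  exact lt_irrefl _ hj

theorem notMem_segreRows {l : ℕ} (hl : l < m) : Sum.inl (⟨l, hl⟩, 0) ∉ segreRows m n l := by
  rintro ⟨j, hj, h⟩
  simp only [Sum.inl.injEq, Prod.mk.injEq] at h
  rw [← h.1] at hj
  exact lt_irrefl _ hj

variable (k m n) in
/-- Setting the first `l` columns to zero. -/
noncomputable def killCols (l : ℕ) :
    MvPolynomial (Fin m × Fin n) k →ₐ[k] MvPolynomial (Fin m × Fin n) k :=
  MvPolynomial.aeval fun p => if (p.2 : ℕ) < l then 0 else MvPolynomial.X p

variable (k m n) in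
/-- Setting the first `l` column coordinates to zero. -/
noncomputable def killSegreCols (l : ℕ) : PairRing k m n 1 →ₐ[k] PairRing k m n 1 :=
  MvPolynomial.aeval (Sum.elim (fun p => MvPolynomial.X (Sum.inl p))
    fun p => if (p.2 : ℕ) < l then 0 else MvPolynomial.X (Sum.inr p))

theorem killCols_sub_mem (l : ℕ) (f : MvPolynomial (Fin m × Fin n) k) :
    f - killCols k m n l f ∈ rect (gen k m n) 1 m l := by
  rw [← Ideal.Quotient.eq_zero_iff_mem, map_sub, sub_eq_zero]
  have : Ideal.Quotient.mkₐ k (rect (gen k m n) 1 m l) =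
      (Ideal.Quotient.mkₐ k (rect (gen k m n) 1 m l)).comp (killCols k m n l) := by
    apply MvPolynomial.algHom_ext
    intro p
    rw [AlgHom.comp_apply, killCols, MvPolynomial.aeval_X]
    split_ifs with h
    · rw [map_zero]
      exact Ideal.Quotient.eq_zero_iff_mem.2 ((rect_gen_one _).1 le_rfl p.1 p.2 h)
    · rfl
  exact AlgHom.congr_fun this f

theorem algebraMap_killCols (l : ℕ) (f : MvPolynomial (Fin m × Fin n) k) :
    algebraMap (MvPolynomial (Fin m × Fin n) k) (PairRing k m n 1) (killCols k m n l f) =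
      killSegreCols k m n l
        (algebraMap (MvPolynomial (Fin m × Fin n) k) (PairRing k m n 1) f) := by
  let φ : MvPolynomial (Fin m × Fin n) k →ₐ[k] PairRing k m n 1 :=
    (toPair k m n 1).comp (Ideal.Quotient.mkₐ k _)
  have hφ : ∀ p, φ (MvPolynomial.X p) =
      MvPolynomial.X (Sum.inl (p.1, 0)) * MvPolynomial.X (Sum.inr (0, p.2)) := fun p =>
    algebraMap_segre_X p.1 p.2
  have : φ.comp (killCols k m n l) = (killSegreCols k m n l).comp φ := by
    apply MvPolynomial.algHom_ext
    intro p
    change φ (killCols k m n l _) = killSegreCols k m n l (φ _)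
    rw [killCols, MvPolynomial.aeval_X, hφ, map_mul,
      killSegreCols, MvPolynomial.aeval_X, MvPolynomial.aeval_X, Sum.elim_inl, Sum.elim_inr]
    split_ifs with h
    · rw [map_zero, mul_zero]
    · exact hφ p
  exact AlgHom.congr_fun this f

theorem killSegreCols_eq_zero {l : ℕ} {f : PairRing k m n 1} (hf : f ∈ Ideal.span
    (MvPolynomial.X '' segreCols m n l : Set (PairRing k m n 1))) : killSegreCols k m n l f = 0 := by
  have : Ideal.span (MvPolynomial.X '' segreCols m n l : Set (PairRing k m n 1)) ≤
      RingHom.ker (killSegreCols k m n l) := by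
    rw [Ideal.span_le]
    rintro _ ⟨_, ⟨j, hj, rfl⟩, rfl⟩
    simp [killSegreCols, hj]
  exact this hf

theorem algebraMap_segre_eq_zero (hm : 1 < m) (hn : 1 < n) {f : MvPolynomial (Fin m × Fin n) k} :
    algebraMap (MvPolynomial (Fin m × Fin n) k) (PairRing k m n 1) f = 0 ↔
      f ∈ minorsIdeal k m n 2 := by
  rw [← Ideal.Quotient.eq_zero_iff_mem]
  exact map_eq_zero_iff (toPair k m n 1) (toPair_injective one_pos hm hn)
    (x := Ideal.Quotient.mk (minorsIdeal k m n 2) f)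

theorem algebraMap_segre_mem (hm : 1 < m) (hn : 1 < n) {l : ℕ}
    {f : MvPolynomial (Fin m × Fin n) k} :
    algebraMap (MvPolynomial (Fin m × Fin n) k) (PairRing k m n 1) f ∈ Ideal.span
        (MvPolynomial.X '' segreCols m n l : Set (PairRing k m n 1)) ↔
      f ∈ minorsIdeal k m n 2 ⊔ rect (gen k m n) 1 m l := by
  constructor
  · intro h
    have h1 := killSegreCols_eq_zero h
    rw [← algebraMap_killCols, algebraMap_segre_eq_zero hm hn] at h1
    rw [← add_sub_cancel (killCols k m n l f) f]
    exact Submodule.add_mem_sup h1 (killCols_sub_mem l f)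
  · have : minorsIdeal k m n 2 ⊔ rect (gen k m n) 1 m l ≤ (Ideal.span
        (MvPolynomial.X '' segreCols m n l : Set (PairRing k m n 1))).comap (algebraMap _ _) := by
      refine sup_le (fun a ha => ?_) ((rect_gen_one _).2 fun i j hj => ?_)
      · rw [Ideal.mem_comap, (algebraMap_segre_eq_zero hm hn).2 ha]
        exact zero_mem _
      · rw [Ideal.mem_comap, algebraMap_segre_X]
        exact Ideal.mul_mem_left _ _ (Ideal.subset_span ⟨_, ⟨j, hj, rfl⟩, rfl⟩)
    exact fun h => this h

variable (k m n) in
/-- The degree `i` part of the Segre coordinate ring modulo the variables in `s`. -/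
abbrev SegreQuot (s : Set ((Fin m × Fin 1) ⊕ (Fin 1 × Fin n))) (i : ℤ) : Type :=
  HomQuot (segre_homogeneous (k := k) (m := m) (n := n)) s i

theorem nonempty_segreQuot_zero_equiv (hm : 1 < m) (hn : 1 < n) (l : ℕ) :
    Nonempty ((_ ⧸ minorsIdeal k m n 2 ⊔ rect (gen k m n) 1 m l) ≃ₗ[MvPolynomial (Fin m × Fin n) k]
      SegreQuot k m n (segreCols m n l) 0) := by
  let o : homSub (segre_homogeneous (k := k) (m := m) (n := n)) 0 :=
    ⟨1, MvPolynomial.isWeightedHomogeneous_one k _⟩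
  let f : MvPolynomial (Fin m × Fin n) k →ₗ[MvPolynomial (Fin m × Fin n) k]
      SegreQuot k m n (segreCols m n l) 0 :=
    LinearMap.toSpanSingleton _ _ (Submodule.Quotient.mk o)
  have hf : ∀ a, f a = Submodule.Quotient.mk (a • o) := fun a => rfl
  have ho : ∀ a : MvPolynomial (Fin m × Fin n) k, ((a • o : homSub _ 0) : PairRing k m n 1) =
      algebraMap _ _ a := fun a => (Algebra.algebraMap_eq_smul_one a).symm
  have hs : Function.Surjective f := by
    intro b
    obtain ⟨b, rfl⟩ := Submodule.Quotient.mk_surjective _ b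
    obtain ⟨a, ha⟩ := exists_algebraMap_segre_eq _ b.2
    obtain ⟨a, rfl⟩ := Ideal.Quotient.mk_surjective a
    refine ⟨a, ?_⟩
    rw [hf]
    congr 1
    exact Subtype.ext ((ho a).trans ha)
  refine ⟨(Submodule.quotEquivOfEq _ _ ?_).trans (f.quotKerEquivOfSurjective hs)⟩
  ext a
  rw [← algebraMap_segre_mem hm hn, LinearMap.mem_ker, hf, Submodule.Quotient.mk_eq_zero, mem_homRel,
    ho]

end Segre
end Semidual

end

section

namespace Semidual
open Abelian TensorProduct

section Segre

variable {k : Type} [Field k] {m n : ℕ}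

theorem exists_segreQuot_cols_ses {l : ℕ} (hl : l < n) (i : ℤ) :
    ∃ (f : SegreQuot k m n (segreCols m n l) (i + 1) →ₗ[DetRing k m n 2]
        SegreQuot k m n (segreCols m n l) i)
      (g : SegreQuot k m n (segreCols m n l) i →ₗ[DetRing k m n 2]
        SegreQuot k m n (segreCols m n (l + 1)) i), SES f g := by
  rw [segreCols_succ hl]
  exact exists_homQuot_ses _ (notMem_segreCols hl) (by simp [segreWeight])

theorem exists_segreQuot_rows_ses {l : ℕ} (hl : l < m) (i : ℤ) :
    ∃ (f : SegreQuot k m n (segreRows m n l) (i - 1) →ₗ[DetRing k m n 2]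
        SegreQuot k m n (segreRows m n l) i)
      (g : SegreQuot k m n (segreRows m n l) i →ₗ[DetRing k m n 2]
        SegreQuot k m n (segreRows m n (l + 1)) i), SES f g := by
  rw [segreRows_succ hl]
  exact exists_homQuot_ses _ (notMem_segreRows hl) (by simp [segreWeight])

theorem pdLE_segreQuot (hm : 1 < m) (hn : 1 < n) (i : ℕ) : ∀ l, i + l < n →
    PdLE (MvPolynomial (Fin m × Fin n) k) (SegreQuot k m n (segreCols m n l) i)
      ((m - 1) * (n - 1) + l) := by
  induction i with
  | zero =>
    intro l hl
    obtain ⟨e⟩ := nonempty_segreQuot_zero_equiv (k := k) hm hn l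
    exact (minors_columns_pdLE k m n l hm (by omega)).congr e
  | succ i ih =>
    intro l hl
    obtain ⟨f, g, h⟩ := exists_segreQuot_cols_ses (k := k) (m := m) (n := n) (l := l) (by omega) i
    rw [Nat.cast_succ]
    exact PdLE.sub (h.restrictScalars (MvPolynomial (Fin m × Fin n) k)) (ih (l + 1) (by omega))
      (ih l (by omega))

theorem nonempty_segreQuot_nil_equiv (s : Set ((Fin m × Fin 1) ⊕ (Fin 1 × Fin n))) (hs : s = ∅)
    (i : ℤ) : Nonempty (SegreQuot k m n s i ≃ₗ[DetRing k m n 2]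
      homSub (segre_homogeneous (k := k) (m := m) (n := n)) i) := by
  subst hs
  exact nonempty_homQuot_empty _ i

theorem segreCols_zero : segreCols m n 0 = ∅ := by ext; simp [segreCols]

theorem segreRows_zero : segreRows m n 0 = ∅ := by ext; simp [segreRows]

/-- Canonical data for the determinantal ring. -/
theorem exists_canonical_detRing (k : Type) [Field k] {m n r : ℕ} (hm : r < m) (hn : r < n) :
    ∃ (D : Type) (_ : AddCommGroup D) (_ : Module (DetRing k m n (r + 1)) D),
      IsSD (DetRing k m n (r + 1)) D ∧ FID (DetRing k m n (r + 1)) D ∧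
      ∀ (N : Type) [AddCommGroup N] [Module (MvPolynomial (Fin m × Fin n) k) N]
        [Module (DetRing k m n (r + 1)) N]
        [IsScalarTower (MvPolynomial (Fin m × Fin n) k) (DetRing k m n (r + 1)) N] (i : ℕ),
        ExtVanish (MvPolynomial (Fin m × Fin n) k) N (MvPolynomial (Fin m × Fin n) k)
          (i + (m - r) * (n - r) + 1) → ExtVanish (DetRing k m n (r + 1)) N D (i + 1) := by
  obtain ⟨h1, h2⟩ := minors_perfect k m n r hm hn
  obtain ⟨I, hI, hle⟩ := Gr.exists_regChain ⊤ (Ideal.subset_span.trans (Ideal.span_mono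
    fun x hx => ⟨hx, trivial⟩)) h2
  obtain ⟨d, hd⟩ := exists_glDim_mvPolynomial k (Fin m × Fin n)
  exact exists_canonical (hd.fid _) hI Ideal.Quotient.mk_surjective
    (hle.trans Ideal.mk_ker.ge) (fun i hi => h1 _ i hi)

theorem FID.congr {R E F : Type} [CommRing R] [AddCommGroup E] [Module R E] [AddCommGroup F]
    [Module R F] (e : E ≃ₗ[R] F) (h : FID R E) : FID R F :=
  h.imp fun _ hn K _ _ i hi => (hn K i hi).congr_right e

theorem IsSD.self {R : Type} [CommRing R] : IsSD R R where
  fin := inferInstance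
  homothety := by
    constructor
    · intro a b h
      simpa using LinearMap.congr_fun h 1
    · exact fun f => ⟨f 1, LinearMap.ext_ring (by simp)⟩
  ext i hi := by
    obtain ⟨i, rfl⟩ := Nat.exists_eq_succ_of_ne_zero hi.ne'
    exact ExtVanish.of_projective i

theorem not_fid_segre_of_lt (hm : 1 < m) (hmn : m < n) :
    ¬ FID (DetRing k m n 2) (DetRing k m n 2) := by
  intro hfid
  have hn : 1 < n := by omega
  have hdom : IsDomain (DetRing k m n 2) := isDomain_detRing one_pos hm hn
  have hinj : Function.Injective (algebraMap (DetRing k m n 2) (PairRing k m n 1)) :=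
    toPair_injective one_pos hm hn
  let hR := segre_homogeneous (k := k) (m := m) (n := n)
  have hcan : ∀ (N : Type) [AddCommGroup N] [Module (MvPolynomial (Fin m × Fin n) k) N]
      [Module (DetRing k m n 2) N]
      [IsScalarTower (MvPolynomial (Fin m × Fin n) k) (DetRing k m n 2) N] (i : ℕ),
      ExtVanish (MvPolynomial (Fin m × Fin n) k) N (MvPolynomial (Fin m × Fin n) k)
        (i + (m - 1) * (n - 1) + 1) → ExtVanish (DetRing k m n 2) N (DetRing k m n 2) (i + 1) := by
    obtain ⟨D, _, _, hD, hD', h⟩ := exists_canonical_detRing k hm hn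
    obtain ⟨e⟩ := or_self_iff.1
      (IsSD.equiv_or_equiv_detRing one_pos hm hn hD IsSD.self hfid)
    exact fun N _ _ _ _ i hi => (h N i hi).congr_right e
  have hpos : ∀ i j : ℕ, i ≤ m → 0 < j → ExtVanish (DetRing k m n 2) (homSub hR i)
      (DetRing k m n 2) j := by
    intro i j hi hj
    obtain ⟨j, rfl⟩ := Nat.exists_eq_succ_of_ne_zero hj.ne'
    obtain ⟨e⟩ := nonempty_segreQuot_nil_equiv (k := k) _ (segreCols_zero (m := m) (n := n)) i
    exact (hcan _ j (pdLE_segreQuot hm hn i 0 (by omega) _ _ (by omega))).congr_left e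
  have hneg : ∀ i j : ℕ, i ≤ m → 0 < j → ExtVanish (DetRing k m n 2) (homSub hR (-i))
      (DetRing k m n 2) j := by
    intro i j hi hj
    have : Module.Finite (DetRing k m n 2) (homSub hR i) :=
      finite_homSub hR hinj exists_algebraMap_segre_eq (z := Sum.inr (0, ⟨0, by omega⟩)) rfl i
    obtain ⟨e⟩ := nonempty_homSub_dual hR hinj exists_algebraMap_segre_eq
      (x := Sum.inl (⟨0, by omega⟩, 0)) (y := Sum.inl (⟨1, hm⟩, 0))
      (z := Sum.inr (0, ⟨0, by omega⟩)) (by simp) rfl rfl rfl i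
    exact (ExtVanish.dual hfid (fun j hj => hpos i j hi hj) j hj).congr_left e.symm
  have hrows : ∀ l ≤ m, ∀ i j : ℕ, i + l ≤ m → l < j → ExtVanish (DetRing k m n 2)
      (SegreQuot k m n (segreRows m n l) (-i)) (DetRing k m n 2) j := by
    intro l
    induction l with
    | zero =>
      intro _ i j hi hj
      obtain ⟨e⟩ := nonempty_segreQuot_nil_equiv (k := k) _ (segreRows_zero (m := m) (n := n)) (-i)
      exact (hneg i j hi hj).congr_left e.symm
    | succ l ih =>
      intro hl i j hi hj
      obtain ⟨j, rfl⟩ := Nat.exists_eq_succ_of_ne_zero (by omega : j ≠ 0)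
      obtain ⟨f, g, h⟩ := exists_segreQuot_rows_ses (k := k) (n := n) (l := l) hl (-i)
      have h2 := ih (by omega) (i + 1) j (by omega) (by omega)
      rw [Nat.cast_succ, neg_add] at h2
      exact ExtVanish.quot_left h h2 (ih (by omega) i (j + 1) (by omega) (by omega))
  let κ := SegreQuot k m n (segreRows m n m) 0
  let o : homSub hR 0 := ⟨1, MvPolynomial.isWeightedHomogeneous_one k _⟩
  have ho : ∀ (a : DetRing k m n 2), ((a • o : homSub _ 0) : PairRing k m n 1) =
      algebraMap _ _ a := fun a => (Algebra.algebraMap_eq_smul_one a).symm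
  have hgen : ∀ x : κ, ∃ a : DetRing k m n 2, x = a • Submodule.Quotient.mk o := by
    intro b
    obtain ⟨b, rfl⟩ := Submodule.Quotient.mk_surjective _ b
    obtain ⟨a, ha⟩ := exists_algebraMap_segre_eq _ b.2
    refine ⟨a, ?_⟩
    rw [← Submodule.Quotient.mk_smul]
    congr 1
    exact Subtype.ext (ha.symm.trans (ho a).symm)
  have hkill : ∀ (i : Fin m) (j : Fin n) (x : κ), detMat k m n 2 i j • x = 0 := by
    intro i j x
    obtain ⟨a, rfl⟩ := hgen x
    rw [smul_comm, ← Submodule.Quotient.mk_smul]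
    have : Submodule.Quotient.mk (detMat k m n 2 i j • o) = (0 : κ) := by
      rw [Submodule.Quotient.mk_eq_zero, mem_homRel, ho, algebraMap_segre_detMat]
      exact Ideal.mul_mem_right _ _ (Ideal.subset_span ⟨_, ⟨i, i.2, rfl⟩, rfl⟩)
    rw [this, smul_zero]
  have hfinR : Module.Finite (DetRing k m n 2) κ := by
    refine Module.Finite.of_surjective
      (LinearMap.toSpanSingleton (DetRing k m n 2) κ (Submodule.Quotient.mk o)) fun x => ?_
    obtain ⟨a, ha⟩ := hgen x
    exact ⟨a, ha.symm⟩
  have hfinS : Module.Finite (MvPolynomial (Fin m × Fin n) k) κ :=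
    Module.Finite.trans (DetRing k m n 2) κ
  have hext : ∀ j, 0 < j → ExtVanish (DetRing k m n 2) κ (DetRing k m n 2) j := by
    intro j hj
    by_cases hjm : m < j
    · have := hrows m le_rfl 0 j (by omega) hjm
      rwa [Nat.cast_zero, neg_zero] at this
    · obtain ⟨j, rfl⟩ := Nat.exists_eq_succ_of_ne_zero hj.ne'
      refine hcan κ j ?_
      obtain ⟨I, hI, hle⟩ := Gr.exists_regChain ⊤ (Ideal.subset_span.trans (Ideal.span_mono
        fun x hx => ⟨hx, trivial⟩)) (minors_perfect k m n 0 (by omega) (by omega)).2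
      refine Gr.extVanish hI (fun a ha x => ?_) _ ?_
      · have hmem : minorsIdeal k m n 1 ≤ Module.annihilator (MvPolynomial (Fin m × Fin n) k) κ := by
          rw [minorsIdeal_eq_rect, rect_gen_one]
          intro i j _
          rw [Module.mem_annihilator]
          intro x
          exact (algebraMap_smul (DetRing k m n 2) _ x).symm.trans (hkill i j x)
        exact Module.mem_annihilator.1 (hmem (hle ha)) x
      · obtain ⟨m, rfl⟩ := Nat.exists_eq_add_of_lt hm
        obtain ⟨n, rfl⟩ := Nat.exists_eq_add_of_lt hn
        simp only [Nat.sub_zero]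
        have e1 : 1 + m + 1 - 1 = m + 1 := by omega
        have e2 : 1 + n + 1 - 1 = n + 1 := by omega
        rw [e1, e2]
        nlinarith
  have hbij := dual_eval_bijective hfid hext
  have hzero : ∀ φ : κ →ₗ[DetRing k m n 2] DetRing k m n 2, φ = 0 := by
    intro φ
    refine LinearMap.ext fun x => ?_
    have h1 : detMat k m n 2 ⟨0, by omega⟩ ⟨0, by omega⟩ * φ x = 0 := by
      rw [← smul_eq_mul, ← map_smul, hkill, map_zero]
    refine (mul_eq_zero.1 h1).resolve_left fun h2 => ?_
    have h3 := congrArg (algebraMap (DetRing k m n 2) (PairRing k m n 1)) h2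
    rw [algebraMap_segre_detMat, map_zero] at h3
    exact mul_ne_zero (MvPolynomial.X_ne_zero _) (MvPolynomial.X_ne_zero _) h3
  have h1 : (Submodule.Quotient.mk o : κ) = 0 := hbij.1 (LinearMap.ext fun φ => by
    rw [hzero φ, map_zero, map_zero])
  rw [Submodule.Quotient.mk_eq_zero, mem_homRel, MvPolynomial.mem_ideal_span_X_image] at h1
  obtain ⟨v, -, hv⟩ := h1 0 (by
    rw [MvPolynomial.mem_support_iff]
    exact (MvPolynomial.coeff_zero_one).trans_ne one_ne_zero)
  exact hv rfl

theorem not_fid_detRing {r : ℕ} (h0 : 0 < r) : ∀ {m n : ℕ}, r < m → r < n → m ≠ n →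
    ¬ FID (DetRing k m n (r + 1)) (DetRing k m n (r + 1)) := by
  induction r, h0 using Nat.le_induction with
  | base =>
    intro m n hm hn hmn h
    rcases lt_or_gt_of_ne hmn with hlt | hlt
    · exact not_fid_segre_of_lt hm hlt h
    · exact not_fid_segre_of_lt hn hlt (fid_detRing_transpose h)
  | succ r h0 ih =>
    intro m n hm hn hmn h
    obtain ⟨m, rfl⟩ := Nat.exists_eq_succ_of_ne_zero (by omega : m ≠ 0)
    obtain ⟨n, rfl⟩ := Nat.exists_eq_succ_of_ne_zero (by omega : n ≠ 0)
    exact ih (by omega) (by omega) (by omega)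
      (fid_detRing_of_succ (m := m) (n := n) h0 (by omega) (by omega) h)

end Segre
end Semidual

end

/-- for a field `k` and `0 < r < min{m,n}` with `m ≠ n`, the determinantal
ring `R = R_{r+1}(k;m,n)` has exactly two isomorphism classes of semidualizing modules:
the class of `R` and the class of a dualizing module. -/
theorem statement16
    (k : Type) [Field k] (m n r : ℕ)
    (h0 : 0 < r) (hm : r < m) (hn : r < n) (hmn : m ≠ n) :
    (∃ D : ModuleCat.{0} (DetRing k m n (r + 1)),
       IsSemidualizing (DetRing k m n (r + 1)) ↥D ∧
       HasFiniteInjectiveDimension (DetRing k m n (r + 1)) ↥D) ∧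
    (∀ (C : Type) [AddCommGroup C] [Module (DetRing k m n (r + 1)) C],
       IsSemidualizing (DetRing k m n (r + 1)) C →
       Nonempty (C ≃ₗ[DetRing k m n (r + 1)] DetRing k m n (r + 1)) ∨
         HasFiniteInjectiveDimension (DetRing k m n (r + 1)) C) ∧
    (∀ (C : Type) [AddCommGroup C] [Module (DetRing k m n (r + 1)) C],
       IsSemidualizing (DetRing k m n (r + 1)) C →
       HasFiniteInjectiveDimension (DetRing k m n (r + 1)) C →
       ¬ Nonempty (C ≃ₗ[DetRing k m n (r + 1)] DetRing k m n (r + 1))) ∧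
    (∀ (C C' : Type) [AddCommGroup C] [Module (DetRing k m n (r + 1)) C]
       [AddCommGroup C'] [Module (DetRing k m n (r + 1)) C'],
       IsSemidualizing (DetRing k m n (r + 1)) C →
       IsSemidualizing (DetRing k m n (r + 1)) C' →
       HasFiniteInjectiveDimension (DetRing k m n (r + 1)) C →
       HasFiniteInjectiveDimension (DetRing k m n (r + 1)) C' →
       Nonempty (C ≃ₗ[DetRing k m n (r + 1)] C')) := by
  simp only [Semidual.hasFiniteInjectiveDimension_iff, Semidual.isSD_iff]
  have hR := Semidual.not_fid_detRing (k := k) h0 hm hn hmn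
  have h3 : ∀ (C : Type) [AddCommGroup C] [Module (DetRing k m n (r + 1)) C],
      Semidual.FID (DetRing k m n (r + 1)) C →
      ¬ Nonempty (C ≃ₗ[DetRing k m n (r + 1)] DetRing k m n (r + 1)) :=
    fun C _ _ hC ⟨e⟩ => hR (hC.congr e)
  obtain ⟨D, _, _, hD, hD', -⟩ := Semidual.exists_canonical_detRing k hm hn
  refine ⟨⟨ModuleCat.of _ D, hD, hD'⟩, fun C _ _ hC => ?_, fun C _ _ _ hC' => h3 C hC',
    fun C C' _ _ _ _ hC hC' hf hf' => ?_⟩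
  · exact (Semidual.IsSD.equiv_or_equiv_detRing h0 hm hn hC hD hD').imp_right
      fun ⟨e⟩ => hD'.congr e.symm
  · exact (Semidual.IsSD.equiv_or_equiv_detRing h0 hm hn hC hC' hf').resolve_left (h3 C hf)
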